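/- Let R and R' be rectangular diagrams of a link such that Γ_→II(R) and Γ_→II(R') have the same set X of double points and there is an isotopy of T^2 fixed on an open neighborhood of X taking Γ_→II(R) to Γ_→II(R'). Then [R]_→II = [R']_→II. -/

import Mathlib

open Set

noncomputable section

/-- The circle `S¹`, modeled as `ℝ/ℤ`. -/
abbrev 𝕊 : Type := AddCircle (1 : ℝ)

/-- The torus `T² = S¹ × S¹`. -/
abbrev Torus : Type := 𝕊 × 𝕊

instance : Fact ((0:ℝ) < 1) := ⟨one_pos⟩

/-- The representative of a point of `S¹` in `[0,1)`. -/
noncomputable def toIco (x : 𝕊) : ℝ := (AddCircle.equivIco 1 0 x).1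

/-- The closed positively oriented arc `[a;b]` in `S¹`. -/
def closedArc (a b : 𝕊) : Set 𝕊 := {x | toIco (x - a) ≤ toIco (b - a)}

/-- The open positively oriented arc `(a;b)` in `S¹`. -/
def openArc (a b : 𝕊) : Set 𝕊 := {x | 0 < toIco (x - a) ∧ toIco (x - a) < toIco (b - a)}

/-- An oriented rectangular diagram of a link. -/
structure RectDiagram where
  pos : Finset Torus
  neg : Finset Torus
  disj : Disjoint pos neg
  nonempty : (pos ∪ neg).Nonempty
  thetaEq : pos.image Prod.fst = neg.image Prod.fst
  phiEq : pos.image Prod.snd = neg.image Prod.snd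
  thetaInjPos : Set.InjOn Prod.fst (pos : Set Torus)
  thetaInjNeg : Set.InjOn Prod.fst (neg : Set Torus)
  phiInjPos : Set.InjOn Prod.snd (pos : Set Torus)
  phiInjNeg : Set.InjOn Prod.snd (neg : Set Torus)

namespace RectDiagram

/-- The set of vertices of a rectangular diagram. -/
def verts (R : RectDiagram) : Finset Torus := R.pos ∪ R.neg

/-- The projection of the vertex set to the `θ`-circle. -/
def pθ (R : RectDiagram) : Finset 𝕊 := R.verts.image Prod.fst

/-- The projection of the vertex set to the `φ`-circle. -/
def pφ (R : RectDiagram) : Finset 𝕊 := R.verts.image Prod.snd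

/-- Vertical edges: unordered pairs of distinct vertices with equal `θ`-coordinate. -/
def vertEdges (R : RectDiagram) : Set (Finset Torus) :=
  {e | ∃ u ∈ R.verts, ∃ v ∈ R.verts, u ≠ v ∧ u.1 = v.1 ∧ e = {u, v}}

/-- Horizontal edges: unordered pairs of distinct vertices with equal `φ`-coordinate. -/
def horizEdges (R : RectDiagram) : Set (Finset Torus) :=
  {e | ∃ u ∈ R.verts, ∃ v ∈ R.verts, u ≠ v ∧ u.2 = v.2 ∧ e = {u, v}}

end RectDiagram

/-- A set of one, two, or three consecutive corners of the rectangle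
`[θ₁;θ₂] × [φ₁;φ₂]` (in the cyclic order of the corners). -/
def ConsecCorners (θ₁ θ₂ φ₁ φ₂ : 𝕊) (s : Set Torus) : Prop :=
  let c₁ : Torus := (θ₁, φ₁); let c₂ : Torus := (θ₂, φ₁)
  let c₃ : Torus := (θ₂, φ₂); let c₄ : Torus := (θ₁, φ₂)
  s = {c₁} ∨ s = {c₂} ∨ s = {c₃} ∨ s = {c₄} ∨
  s = {c₁, c₂} ∨ s = {c₂, c₃} ∨ s = {c₃, c₄} ∨ s = {c₄, c₁} ∨
  s = {c₁, c₂, c₃} ∨ s = {c₂, c₃, c₄} ∨ s = {c₃, c₄, c₁} ∨ s = {c₄, c₁, c₂}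

/-- An elementary move `R₁ ↦ R₂` with the given data `θ₁, θ₂, φ₁, φ₂`. -/
def ElemMoveData (R₁ R₂ : RectDiagram) (θ₁ θ₂ φ₁ φ₂ : 𝕊) : Prop :=
  θ₁ ≠ θ₂ ∧ φ₁ ≠ φ₂ ∧
  symmDiff (↑R₁.verts : Set Torus) ↑R₂.verts = ({θ₁, θ₂} : Set 𝕊) ×ˢ ({φ₁, φ₂} : Set 𝕊) ∧
  (closedArc θ₁ θ₂ ×ˢ closedArc φ₁ φ₂) ∩ ((↑R₁.verts : Set Torus) ∪ ↑R₂.verts)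
    = symmDiff (↑R₁.verts : Set Torus) ↑R₂.verts ∧
  (∃ s : Set Torus, ConsecCorners θ₁ θ₂ φ₁ φ₂ s ∧
    (↑R₁.verts : Set Torus) ∩ (({θ₁, θ₂} : Set 𝕊) ×ˢ ({φ₁, φ₂} : Set 𝕊)) = s ∧
    (({θ₁, θ₂} : Set 𝕊) ×ˢ ({φ₁, φ₂} : Set 𝕊)) \ s ⊆ (↑R₂.verts : Set Torus)) ∧
  ((↑R₁.pos : Set Torus) ∩ ↑R₂.verts = (↑R₁.verts : Set Torus) ∩ ↑R₂.pos)

/-- An elementary move of rectangular diagrams. -/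
def ElemMove (R₁ R₂ : RectDiagram) : Prop :=
  ∃ θ₁ θ₂ φ₁ φ₂, ElemMoveData R₁ R₂ θ₁ θ₂ φ₁ φ₂

/-- An exchange move. -/
def ExchangeMove (R₁ R₂ : RectDiagram) : Prop :=
  ElemMove R₁ R₂ ∧ R₁.verts.card = R₂.verts.card

/-- A stabilization move. -/
def Stab (R₁ R₂ : RectDiagram) : Prop :=
  ElemMove R₁ R₂ ∧ R₂.verts.card = R₁.verts.card + 2

/-- A destabilization move. -/
def Destab (R₁ R₂ : RectDiagram) : Prop :=
  ElemMove R₁ R₂ ∧ R₁.verts.card = R₂.verts.card + 2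

/-- The four oriented types of stabilizations: `→I`, `←I`, `→II`, `←II`. -/
inductive OType | rI | lI | rII | lII
deriving DecidableEq

/-- A stabilization `R₁ ↦ R₂` with data `θ₁, θ₂, φ₁, φ₂` has oriented type `T`:
`v` is the (unique) vertex of `R₁` in the rectangle, type I means
`v ∈ {(θ₁,φ₁),(θ₂,φ₂)}`, type II means `v ∈ {(θ₁,φ₂),(θ₂,φ₁)}`, and the arrow is
`→` or `←` according to the sign of `(θ₂,φ₀)` in `R₂`, where
`{θ₁,θ₂} × {φ₀} ⊆ R₂`. -/
def StabTypeData (R₁ R₂ : RectDiagram) (θ₁ θ₂ φ₁ φ₂ : 𝕊) (T : OType) : Prop :=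
  ∃ v ∈ (↑R₁.verts : Set Torus) ∩ (closedArc θ₁ θ₂ ×ˢ closedArc φ₁ φ₂),
    ∃ φ₀ ∈ ({φ₁, φ₂} : Set 𝕊), (θ₁, φ₀) ∈ R₂.verts ∧ (θ₂, φ₀) ∈ R₂.verts ∧
    (match T with
     | .rI => (v = (θ₁, φ₁) ∨ v = (θ₂, φ₂)) ∧ (θ₂, φ₀) ∈ R₂.pos
     | .lI => (v = (θ₁, φ₁) ∨ v = (θ₂, φ₂)) ∧ (θ₂, φ₀) ∈ R₂.neg
     | .rII => (v = (θ₁, φ₂) ∨ v = (θ₂, φ₁)) ∧ (θ₂, φ₀) ∈ R₂.pos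
     | .lII => (v = (θ₁, φ₂) ∨ v = (θ₂, φ₁)) ∧ (θ₂, φ₀) ∈ R₂.neg)

/-- A stabilization of oriented type `T`. -/
def StabOfType (R₁ R₂ : RectDiagram) (T : OType) : Prop :=
  ∃ θ₁ θ₂ φ₁ φ₂, ElemMoveData R₁ R₂ θ₁ θ₂ φ₁ φ₂ ∧
    R₂.verts.card = R₁.verts.card + 2 ∧ StabTypeData R₁ R₂ θ₁ θ₂ φ₁ φ₂ T

/-- A destabilization of oriented type `T` (the type is read off from the inverse
stabilization `R₂ ↦ R₁`). -/
def DestabOfType (R₁ R₂ : RectDiagram) (T : OType) : Prop :=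
  ∃ θ₁ θ₂ φ₁ φ₂, ElemMoveData R₁ R₂ θ₁ θ₂ φ₁ φ₂ ∧
    R₁.verts.card = R₂.verts.card + 2 ∧ StabTypeData R₂ R₁ θ₁ θ₂ φ₁ φ₂ T

/-- The union of staircase curves `Γ_→II(R)` on the torus. -/
def Gamma (R : RectDiagram) : Set Torus :=
  {p | ∃ θ₀ φ₁ φ₂, (θ₀, φ₁) ∈ R.pos ∧ (θ₀, φ₂) ∈ R.neg ∧ p.1 = θ₀ ∧ p.2 ∈ closedArc φ₁ φ₂} ∪
  {p | ∃ θ₁ θ₂ φ₀, (θ₁, φ₀) ∈ R.neg ∧ (θ₂, φ₀) ∈ R.pos ∧ p.2 = φ₀ ∧ p.1 ∈ closedArc θ₁ θ₂}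

/-- Number of intersection points of a subset of the torus with the meridian `{θ₀} × S¹`. -/
def merCount (A : Set Torus) (θ₀ : 𝕊) : ℕ := (A ∩ {p | p.1 = θ₀}).ncard

/-- Number of intersection points of a subset of the torus with the longitude `S¹ × {φ₀}`. -/
def lonCount (A : Set Torus) (φ₀ : 𝕊) : ℕ := (A ∩ {p | p.2 = φ₀}).ncard

/-- `(k,l)` is the homology class of `Γ_→II(R)` in `H₁(T²;ℤ)`: it counts the
intersections of `Γ_→II(R)` with generic meridians and longitudes respectively. -/
def IsHomClass (R : RectDiagram) (k l : ℕ) : Prop :=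
  (∀ θ₀ : 𝕊, θ₀ ∉ R.pθ → merCount (Gamma R) θ₀ = k) ∧
  (∀ φ₀ : 𝕊, φ₀ ∉ R.pφ → lonCount (Gamma R) φ₀ = l)

/-- `p` lies in the relative interior of a vertical segment of `Γ_→II(R)`. -/
def OnVertInt (R : RectDiagram) (p : Torus) : Prop :=
  ∃ θ₀ φ₁ φ₂, (θ₀, φ₁) ∈ R.pos ∧ (θ₀, φ₂) ∈ R.neg ∧ p.1 = θ₀ ∧ p.2 ∈ openArc φ₁ φ₂

/-- `p` lies in the relative interior of a horizontal segment of `Γ_→II(R)`. -/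
def OnHorizInt (R : RectDiagram) (p : Torus) : Prop :=
  ∃ θ₁ θ₂ φ₀, (θ₁, φ₀) ∈ R.neg ∧ (θ₂, φ₀) ∈ R.pos ∧ p.2 = φ₀ ∧ p.1 ∈ openArc θ₁ θ₂

/-- The set of double (self-intersection) points of `Γ_→II(R)`. -/
def DoublePts (R : RectDiagram) : Set Torus := {p | OnVertInt R p ∧ OnHorizInt R p}

/-- An exchange move or a type-`T` stabilization or destabilization. -/
def MoveOfType (T : OType) (R₁ R₂ : RectDiagram) : Prop :=
  ExchangeMove R₁ R₂ ∨ StabOfType R₁ R₂ T ∨ DestabOfType R₁ R₂ T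

/-- The equivalence generated by exchange moves and type-`T` (de)stabilizations:
`[R₁]_T = [R₂]_T`. -/
def EquivOfType (T : OType) : RectDiagram → RectDiagram → Prop :=
  Relation.ReflTransGen (MoveOfType T)

/-- An (ambient) isotopy of the torus: a continuous family of homeomorphisms
starting from the identity. -/
def Isotopy (H : ℝ → Torus ≃ₜ Torus) : Prop :=
  Continuous (fun q : ℝ × Torus => H q.1 q.2) ∧ H 0 = Homeomorph.refl Torus

/-- `A` is isotopic to `B` by an ambient isotopy of `T²` fixed on `X`. -/
def IsotopicRelFixed (A B X : Set Torus) : Prop :=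
  ∃ H : ℝ → Torus ≃ₜ Torus, Isotopy H ∧ (∀ t : ℝ, ∀ x ∈ X, H t x = x) ∧ (H 1) '' A = B

/-- `F` is an embedded closed disc in the torus. -/
def IsClosedDisc (F : Set Torus) : Prop :=
  Nonempty (↥F ≃ₜ ↥(Metric.closedBall (0 : ℝ × ℝ) 1))

/-- `F` is an embedded closed annulus in the torus. -/
def IsClosedAnnulus (F : Set Torus) : Prop :=
  Nonempty (↥F ≃ₜ (𝕊 × ↥(Set.Icc (0:ℝ) 1)))

/-- A self-homeomorphism of `S¹` is orientation-preserving if it preserves the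
cyclic order (sends points of open positively oriented arcs to points of the
corresponding open positively oriented arcs). -/
def OrientPres (f : 𝕊 ≃ₜ 𝕊) : Prop :=
  ∀ a b c : 𝕊, b ∈ openArc a c → f b ∈ openArc (f a) (f c)

/-- Combinatorial equivalence of rectangular diagrams: related by a product of
orientation-preserving self-homeomorphisms of the two circle factors. -/
def CombEquiv (R R' : RectDiagram) : Prop :=
  ∃ f g : 𝕊 ≃ₜ 𝕊, OrientPres f ∧ OrientPres g ∧
    (fun p : Torus => (f p.1, g p.2)) '' ↑R.pos = ↑R'.pos ∧
    (fun p : Torus => (f p.1, g p.2)) '' ↑R.neg = ↑R'.neg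

/-- `R` and `R'` have the same `→II`-homology type. -/
def SameHomType (R R' : RectDiagram) : Prop :=
  ∃ R'' : RectDiagram, CombEquiv R' R'' ∧
    IsotopicRelFixed (Gamma R) (Gamma R'') (DoublePts R)

section

/-! ### Circle basics -/

lemma toIco_coe (x : ℝ) : toIco (x : 𝕊) = Int.fract x := by
  have := AddCircle.coe_equivIco_mk_apply (1:ℝ) x
  simpa [toIco] using this

lemma coe_toIco (a : 𝕊) : ((toIco a : ℝ) : 𝕊) = a := (AddCircle.equivIco 1 0).symm_apply_apply a

lemma toIco_nonneg (a : 𝕊) : 0 ≤ toIco a := (AddCircle.equivIco 1 0 a).2.1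

lemma toIco_lt_one (a : 𝕊) : toIco a < 1 := by
  have := (AddCircle.equivIco 1 0 a).2.2
  simpa [toIco] using this

lemma coe_eq_iff {x y : ℝ} : (x : 𝕊) = (y : 𝕊) ↔ ∃ k : ℤ, x = y + k := by
  rw [← sub_eq_zero, ← AddCircle.coe_sub, AddCircle.coe_eq_zero_iff]
  constructor
  · rintro ⟨n, hn⟩; exact ⟨n, by simp at hn; linarith⟩
  · rintro ⟨n, hn⟩; exact ⟨n, by simp; linarith⟩

lemma coe_add_int (x : ℝ) (k : ℤ) : ((x + k : ℝ) : 𝕊) = x := coe_eq_iff.2 ⟨k, rfl⟩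

lemma coe_sub_int (x : ℝ) (k : ℤ) : ((x - k : ℝ) : 𝕊) = x := coe_eq_iff.2 ⟨-k, by push_cast; ring⟩

lemma exists_lift (a : 𝕊) : ∃ x : ℝ, (x : 𝕊) = a := ⟨toIco a, coe_toIco a⟩

lemma toIco_eq {r : ℝ} {a : 𝕊} (h0 : 0 ≤ r) (h1 : r < 1) (h : (r : 𝕊) = a) : toIco a = r := by
  rw [← h, toIco_coe, Int.fract_eq_self.2 ⟨h0, h1⟩]

lemma toIco_eq_zero {a : 𝕊} : toIco a = 0 ↔ a = 0 := by
  constructor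
  · intro h; rw [← coe_toIco a, h]; simp
  · intro h; exact toIco_eq le_rfl one_pos (by simp [h])

lemma toIco_zero : toIco 0 = 0 := toIco_eq_zero.2 rfl

lemma toIco_pos {a b : 𝕊} (h : a ≠ b) : 0 < toIco (b - a) :=
  lt_of_le_of_ne (toIco_nonneg _) fun h' => h (sub_eq_zero.1 (toIco_eq_zero.1 h'.symm)).symm

lemma toIco_add (a b : 𝕊) :
    (toIco (a + b) = toIco a + toIco b ∧ toIco a + toIco b < 1) ∨
    (toIco (a + b) = toIco a + toIco b - 1 ∧ 1 ≤ toIco a + toIco b) := by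
  have ha := toIco_nonneg a; have ha' := toIco_lt_one a
  have hb := toIco_nonneg b; have hb' := toIco_lt_one b
  rcases lt_or_ge (toIco a + toIco b) 1 with h | h
  · left; refine ⟨toIco_eq (by linarith) h ?_, h⟩
    rw [AddCircle.coe_add, coe_toIco, coe_toIco]
  · right; refine ⟨toIco_eq (by linarith) (by linarith) ?_, h⟩
    have := coe_sub_int (toIco a + toIco b) 1
    push_cast at this
    rw [this, AddCircle.coe_add, coe_toIco, coe_toIco]

/-- Cyclic triangle identity. -/
lemma toIco_tri (a b c : 𝕊) :
    (toIco (c - a) = toIco (b - a) + toIco (c - b) ∧ toIco (b - a) + toIco (c - b) < 1) ∨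
    (toIco (c - a) = toIco (b - a) + toIco (c - b) - 1 ∧ 1 ≤ toIco (b - a) + toIco (c - b)) := by
  have := toIco_add (b - a) (c - b)
  rwa [show b - a + (c - b) = c - a by abel] at this

lemma toIco_coe_sub {a b : ℝ} (h0 : a ≤ b) (h1 : b < a + 1) :
    toIco ((b : 𝕊) - (a : 𝕊)) = b - a :=
  toIco_eq (by linarith) (by linarith) (by rw [AddCircle.coe_sub])

lemma mem_closedArc_lift {a b x : ℝ} (h0 : a ≤ b) (h1 : b < a + 1) :
    (x : 𝕊) ∈ closedArc (a : 𝕊) (b : 𝕊) ↔ ∃ k : ℤ, a ≤ x + k ∧ x + k ≤ b := by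
  unfold closedArc
  rw [mem_ofPred_eq, toIco_coe_sub h0 h1, ← AddCircle.coe_sub, toIco_coe]
  constructor
  · intro h
    refine ⟨-⌊x - a⌋, ?_, ?_⟩
    · have := Int.floor_le (x - a); push_cast; linarith
    · have := Int.self_sub_floor (x - a); push_cast; linarith
  · rintro ⟨k, hk, hk'⟩
    have : Int.fract (x - a) = x + k - a := by
      rw [← Int.fract_add_intCast (x - a) k, Int.fract_eq_self.2 ⟨by linarith, by linarith⟩]; ring
    linarith

lemma mem_openArc_lift {a b x : ℝ} (h0 : a ≤ b) (h1 : b < a + 1) :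
    (x : 𝕊) ∈ openArc (a : 𝕊) (b : 𝕊) ↔ ∃ k : ℤ, a < x + k ∧ x + k < b := by
  unfold openArc
  rw [mem_ofPred_eq, toIco_coe_sub h0 h1, ← AddCircle.coe_sub, toIco_coe]
  constructor
  · intro h
    refine ⟨-⌊x - a⌋, ?_, ?_⟩
    · have := Int.self_sub_floor (x - a); push_cast; linarith
    · have := Int.self_sub_floor (x - a); push_cast; linarith
  · rintro ⟨k, hk, hk'⟩
    have : Int.fract (x - a) = x + k - a := by
      rw [← Int.fract_add_intCast (x - a) k, Int.fract_eq_self.2 ⟨by linarith, by linarith⟩]; ring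
    rw [this]; constructor <;> linarith

lemma left_mem_closedArc (a b : 𝕊) : a ∈ closedArc a b := by
  simp [closedArc, toIco_zero, toIco_nonneg]

lemma right_mem_closedArc (a b : 𝕊) : b ∈ closedArc a b := by
  simp [closedArc]

lemma int_eq_of_lt {a b : ℝ} {k l : ℤ} (h1 : (k:ℝ) < a) (h2 : a < k + 1) (h3 : (l:ℝ) < b) (h4 : b < l + 1)
   (h : a = b) : k = l := by
  subst h
  have : k < l + 1 := by exact_mod_cast h1.trans h4
  have : l < k + 1 := by exact_mod_cast h3.trans h2
  omega

end

section

/-! ### Symmetry of moves -/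

lemma consec_compl {θ₁ θ₂ φ₁ φ₂ : 𝕊} (hθ : θ₁ ≠ θ₂) (hφ : φ₁ ≠ φ₂) {s : Set Torus}
    (h : ConsecCorners θ₁ θ₂ φ₁ φ₂ s) :
    ConsecCorners θ₁ θ₂ φ₁ φ₂ ((({θ₁, θ₂} : Set 𝕊) ×ˢ ({φ₁, φ₂} : Set 𝕊)) \ s) := by
  have hθ' := hθ.symm
  have hφ' := hφ.symm
  have key : ∀ t u : Set Torus, s = t →
      (∀ a b, (a = θ₁ ∨ a = θ₂) → (b = φ₁ ∨ b = φ₂) → ((a, b) ∈ u ↔ (a, b) ∉ t)) →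
      u ⊆ (({θ₁, θ₂} : Set 𝕊) ×ˢ ({φ₁, φ₂} : Set 𝕊)) →
      (({θ₁, θ₂} : Set 𝕊) ×ˢ ({φ₁, φ₂} : Set 𝕊)) \ s = u := by
    rintro t u rfl h1 h2
    ext ⟨a, b⟩
    constructor
    · rintro ⟨⟨ha, hb⟩, hs⟩; exact (h1 a b ha hb).2 hs
    · intro h; exact ⟨h2 h, (h1 a b (h2 h).1 (h2 h).2).1 h⟩
  unfold ConsecCorners at h ⊢
  simp only at h ⊢
  rcases h with h | h | h | h | h | h | h | h | h | h | h | h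
  · have := key _ {(θ₂, φ₁), (θ₂, φ₂), (θ₁, φ₂)} h (by
      rintro a b (rfl | rfl) (rfl | rfl) <;> simp [*]) (by
      rintro ⟨a, b⟩; simp; tauto)
    simp only [this, true_or, or_true]
  · have := key _ {(θ₂, φ₂), (θ₁, φ₂), (θ₁, φ₁)} h (by
      rintro a b (rfl | rfl) (rfl | rfl) <;> simp [*]) (by
      rintro ⟨a, b⟩; simp; tauto)
    simp only [this, true_or, or_true]
  · have := key _ {(θ₁, φ₂), (θ₁, φ₁), (θ₂, φ₁)} h (by
      rintro a b (rfl | rfl) (rfl | rfl) <;> simp [*]) (by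
      rintro ⟨a, b⟩; simp; tauto)
    simp only [this, true_or, or_true]
  · have := key _ {(θ₁, φ₁), (θ₂, φ₁), (θ₂, φ₂)} h (by
      rintro a b (rfl | rfl) (rfl | rfl) <;> simp [*]) (by
      rintro ⟨a, b⟩; simp; tauto)
    simp only [this, true_or, or_true]
  · have := key _ {(θ₂, φ₂), (θ₁, φ₂)} h (by
      rintro a b (rfl | rfl) (rfl | rfl) <;> simp [*]) (by
      rintro ⟨a, b⟩; simp; tauto)
    simp only [this, true_or, or_true]
  · have := key _ {(θ₁, φ₂), (θ₁, φ₁)} h (by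
      rintro a b (rfl | rfl) (rfl | rfl) <;> simp [*]) (by
      rintro ⟨a, b⟩; simp; tauto)
    simp only [this, true_or, or_true]
  · have := key _ {(θ₁, φ₁), (θ₂, φ₁)} h (by
      rintro a b (rfl | rfl) (rfl | rfl) <;> simp [*]) (by
      rintro ⟨a, b⟩; simp; tauto)
    simp only [this, true_or, or_true]
  · have := key _ {(θ₂, φ₁), (θ₂, φ₂)} h (by
      rintro a b (rfl | rfl) (rfl | rfl) <;> simp [*]) (by
      rintro ⟨a, b⟩; simp; tauto)
    simp only [this, true_or, or_true]
  · have := key _ {(θ₁, φ₂)} h (by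
      rintro a b (rfl | rfl) (rfl | rfl) <;> simp [*]) (by
      rintro ⟨a, b⟩; simp; tauto)
    simp only [this, true_or, or_true]
  · have := key _ {(θ₁, φ₁)} h (by
      rintro a b (rfl | rfl) (rfl | rfl) <;> simp [*]) (by
      rintro ⟨a, b⟩; simp; tauto)
    simp only [this, true_or, or_true]
  · have := key _ {(θ₂, φ₁)} h (by
      rintro a b (rfl | rfl) (rfl | rfl) <;> simp [*]) (by
      rintro ⟨a, b⟩; simp; tauto)
    simp only [this, true_or, or_true]
  · have := key _ {(θ₂, φ₂)} h (by
      rintro a b (rfl | rfl) (rfl | rfl) <;> simp [*]) (by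
      rintro ⟨a, b⟩; simp; tauto)
    simp only [this, true_or, or_true]

lemma ElemMoveData.symm {R₁ R₂ : RectDiagram} {θ₁ θ₂ φ₁ φ₂ : 𝕊}
    (h : ElemMoveData R₁ R₂ θ₁ θ₂ φ₁ φ₂) : ElemMoveData R₂ R₁ θ₁ θ₂ φ₁ φ₂ := by
  obtain ⟨h1, h2, h3, h4, ⟨s, hs, hs1, hs2⟩, h6⟩ := h
  refine ⟨h1, h2, by rw [symmDiff_comm]; exact h3, ?_, ⟨_, consec_compl h1 h2 hs, ?_, ?_⟩, ?_⟩
  · rw [symmDiff_comm (↑R₂.verts : Set Torus), union_comm]; exact h4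
  · have key : ∀ p : Torus, p ∈ (({θ₁, θ₂} : Set 𝕊) ×ˢ ({φ₁, φ₂} : Set 𝕊)) →
        (p ∈ (R₂.verts : Set Torus) ↔ p ∉ (R₁.verts : Set Torus)) := by
      intro p hp
      rw [← h3, Set.mem_symmDiff] at hp
      tauto
    ext p
    rw [← hs1]
    have := key p
    simp only [Set.mem_inter_iff, Set.mem_sdiff]
    tauto
  · intro p hp
    have : p ∈ s := by
      by_contra hc; exact hp.2 ⟨hp.1, hc⟩
    rw [← hs1] at this; exact this.1
  · rw [inter_comm, ← h6, inter_comm]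

lemma ExchangeMove.symm {R₁ R₂ : RectDiagram} (h : ExchangeMove R₁ R₂) : ExchangeMove R₂ R₁ := by
  obtain ⟨⟨a, b, c, d, h⟩, hc⟩ := h
  exact ⟨⟨a, b, c, d, h.symm⟩, hc.symm⟩

lemma MoveOfType.symm {T : OType} {R₁ R₂ : RectDiagram} (h : MoveOfType T R₁ R₂) :
    MoveOfType T R₂ R₁ := by
  rcases h with h | ⟨a, b, c, d, h, h', h''⟩ | ⟨a, b, c, d, h, h', h''⟩
  · exact Or.inl h.symm
  · exact Or.inr (Or.inr ⟨a, b, c, d, h.symm, h', h''⟩)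
  · exact Or.inr (Or.inl ⟨a, b, c, d, h.symm, h', h''⟩)

lemma EquivOfType.symm {T : OType} {R₁ R₂ : RectDiagram} (h : EquivOfType T R₁ R₂) :
    EquivOfType T R₂ R₁ := by
  induction h with
  | refl => exact Relation.ReflTransGen.refl
  | tail _ h ih => exact Relation.ReflTransGen.head h.symm ih

/-- Equivalence through exchange moves only. -/
def Exch : RectDiagram → RectDiagram → Prop := Relation.ReflTransGen ExchangeMove

lemma Exch.symm {R₁ R₂ : RectDiagram} (h : Exch R₁ R₂) : Exch R₂ R₁ := by
  induction h with
  | refl => exact Relation.ReflTransGen.refl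
  | tail _ h ih => exact Relation.ReflTransGen.head h.symm ih

lemma Exch.trans {R₁ R₂ R₃ : RectDiagram} (h : Exch R₁ R₂) (h' : Exch R₂ R₃) : Exch R₁ R₃ :=
  Relation.ReflTransGen.trans h h'

lemma Exch.equiv {T : OType} {R₁ R₂ : RectDiagram} (h : Exch R₁ R₂) : EquivOfType T R₁ R₂ :=
  Relation.ReflTransGen.mono (fun _ _ h => Or.inl h) _ _ h

lemma rect_ext {R₁ R₂ : RectDiagram} (h1 : R₁.pos = R₂.pos) (h2 : R₁.neg = R₂.neg) : R₁ = R₂ := by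
  cases R₁; cases R₂; simp_all

/-! ### Diagrams given by edge data -/

structure Good (Z : Finset 𝕊) (top : 𝕊 → 𝕊) (x : 𝕊 → ℝ) : Prop where
  ne : Z.Nonempty
  maps : ∀ y ∈ Z, top y ∈ Z
  inj : ∀ y ∈ Z, ∀ z ∈ Z, top y = top z → y = z
  top_ne : ∀ y ∈ Z, top y ≠ y
  xinj : ∀ y ∈ Z, ∀ z ∈ Z, ((x y : ℝ) : 𝕊) = (x z : ℝ) → y = z

lemma Good.surj {Z top x} (h : Good Z top x) : Z.image top = Z := by
  apply Finset.eq_of_subset_of_card_le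
  · intro y hy
    obtain ⟨z, hz, rfl⟩ := Finset.mem_image.1 hy
    exact h.maps z hz
  · rw [Finset.card_image_of_injOn]
    intro y hy z hz; exact h.inj y hy z hz

def Dg {Z : Finset 𝕊} {top : 𝕊 → 𝕊} {x : 𝕊 → ℝ} (h : Good Z top x) : RectDiagram where
  pos := Z.image fun y => (((x y : ℝ) : 𝕊), y)
  neg := Z.image fun y => (((x y : ℝ) : 𝕊), top y)
  disj := by
    rw [Finset.disjoint_left]
    intro p hp hp'
    obtain ⟨y, hy, rfl⟩ := Finset.mem_image.1 hp
    obtain ⟨z, hz, hz'⟩ := Finset.mem_image.1 hp'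
    have h1 := congrArg Prod.fst hz'
    have h2 := congrArg Prod.snd hz'
    simp only at h1 h2
    have := h.xinj z hz y hy h1
    subst this
    exact h.top_ne z hz h2
  nonempty := by
    obtain ⟨y, hy⟩ := h.ne
    exact ⟨(((x y : ℝ) : 𝕊), y), Finset.mem_union_left _ (Finset.mem_image_of_mem _ hy)⟩
  thetaEq := by simp [Finset.image_image, Function.comp_def]
  phiEq := by
    rw [Finset.image_image, Finset.image_image]
    simp only [Function.comp_def]
    rw [Finset.image_id']
    exact h.surj.symm
  thetaInjPos := by
    intro p hp q hq hpq
    obtain ⟨y, hy, rfl⟩ := Finset.mem_image.1 hp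
    obtain ⟨z, hz, rfl⟩ := Finset.mem_image.1 hq
    rw [h.xinj y hy z hz hpq]
  thetaInjNeg := by
    intro p hp q hq hpq
    obtain ⟨y, hy, rfl⟩ := Finset.mem_image.1 hp
    obtain ⟨z, hz, rfl⟩ := Finset.mem_image.1 hq
    rw [h.xinj y hy z hz hpq]
  phiInjPos := by
    intro p hp q hq hpq
    obtain ⟨y, hy, rfl⟩ := Finset.mem_image.1 hp
    obtain ⟨z, hz, rfl⟩ := Finset.mem_image.1 hq
    simp only at hpq
    rw [hpq]
  phiInjNeg := by
    intro p hp q hq hpq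
    obtain ⟨y, hy, rfl⟩ := Finset.mem_image.1 hp
    obtain ⟨z, hz, rfl⟩ := Finset.mem_image.1 hq
    simp only at hpq
    rw [h.inj y hy z hz hpq]

section
variable {Z : Finset 𝕊} {top : 𝕊 → 𝕊} {x x' : 𝕊 → ℝ}

lemma mem_pos_Dg (h : Good Z top x) {a b : 𝕊} :
    (a, b) ∈ (Dg h).pos ↔ b ∈ Z ∧ a = ((x b : ℝ) : 𝕊) := by
  simp only [Dg, Finset.mem_image, Prod.mk.injEq]
  constructor
  · rintro ⟨y, hy, rfl, rfl⟩; exact ⟨hy, rfl⟩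
  · rintro ⟨hb, rfl⟩; exact ⟨b, hb, rfl, rfl⟩

lemma mem_neg_Dg (h : Good Z top x) {a b : 𝕊} :
    (a, b) ∈ (Dg h).neg ↔ ∃ y ∈ Z, a = ((x y : ℝ) : 𝕊) ∧ b = top y := by
  simp only [Dg, Finset.mem_image, Prod.mk.injEq]
  constructor
  · rintro ⟨y, hy, rfl, rfl⟩; exact ⟨y, hy, rfl, rfl⟩
  · rintro ⟨y, hb, rfl, rfl⟩; exact ⟨y, hb, rfl, rfl⟩

lemma mem_verts_Dg (h : Good Z top x) {a b : 𝕊} :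
    (a, b) ∈ (Dg h).verts ↔ ∃ y ∈ Z, a = ((x y : ℝ) : 𝕊) ∧ (b = y ∨ b = top y) := by
  rw [RectDiagram.verts, Finset.mem_union, mem_pos_Dg, mem_neg_Dg]
  constructor
  · rintro (⟨hb, rfl⟩ | ⟨y, hy, rfl, rfl⟩)
    · exact ⟨b, hb, rfl, Or.inl rfl⟩
    · exact ⟨y, hy, rfl, Or.inr rfl⟩
  · rintro ⟨y, hy, rfl, rfl | rfl⟩
    · exact Or.inl ⟨hy, rfl⟩
    · exact Or.inr ⟨y, hy, rfl, rfl⟩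

lemma card_verts_Dg (h : Good Z top x) : (Dg h).verts.card = 2 * Z.card := by
  rw [RectDiagram.verts, Finset.card_union_of_disjoint (Dg h).disj]
  have h1 : (Dg h).pos.card = Z.card := by
    simp only [Dg]
    rw [Finset.card_image_of_injOn]
    intro a _ b _ hab
    exact congrArg Prod.snd hab
  have h2 : (Dg h).neg.card = Z.card := by
    simp only [Dg]
    rw [Finset.card_image_of_injOn]
    intro a ha b hb hab
    exact h.xinj a ha b hb (congrArg Prod.fst hab)
  omega

end
end

section

section
variable {Z : Finset 𝕊} {top : 𝕊 → 𝕊} {x x' : 𝕊 → ℝ}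

/-- Edge `j` has an endpoint at a height in the closed range of edge `i`. -/
def Near (top : 𝕊 → 𝕊) (i j : 𝕊) : Prop :=
  j ∈ closedArc i (top i) ∨ top j ∈ closedArc i (top i)

lemma exch_step (h : Good Z top x) (h' : Good Z top x') {i : 𝕊} (hi : i ∈ Z)
    (hij : ∀ j ∈ Z, j ≠ i → x' j = x j) (hab : x i < x' i) (hab' : x' i < x i + 1)
    (hcl : ∀ j ∈ Z, j ≠ i → Near top i j →
      ((x j : ℝ) : 𝕊) ∉ closedArc ((x i : ℝ) : 𝕊) ((x' i : ℝ) : 𝕊)) :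
    ExchangeMove (Dg h) (Dg h') := by
  refine ⟨⟨(x i : ℝ), (x' i : ℝ), i, top i, ?_⟩, by rw [card_verts_Dg, card_verts_Dg]⟩
  have hne : ((x i : ℝ) : 𝕊) ≠ (x' i : ℝ) := by
    intro he
    obtain ⟨k, hk⟩ := coe_eq_iff.1 he
    have h1 : (k : ℝ) < 0 := by linarith
    have h2 : (-1 : ℝ) < k := by linarith
    have h1' : k < 0 := by exact_mod_cast h1
    have h2' : -1 < k := by exact_mod_cast h2
    omega
  have htn := (h.top_ne i hi).symm
  -- the new edge does not sit over an old one
  have hx'i : ∀ j ∈ Z, j ≠ i → ((x j : ℝ) : 𝕊) ≠ (x' i : ℝ) := by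
    intro j hj hji he
    rw [← hij j hj hji] at he
    exact hji (h'.xinj j hj i hi he)
  have hxi : ∀ j ∈ Z, j ≠ i → ((x j : ℝ) : 𝕊) ≠ (x i : ℝ) := by
    intro j hj hji he
    exact hji (h.xinj j hj i hi he)
  have hV1 : ∀ a b, (a, b) ∈ (Dg h).verts ↔ (a = (x i : ℝ) ∧ (b = i ∨ b = top i)) ∨
      ∃ j ∈ Z, j ≠ i ∧ a = ((x j : ℝ) : 𝕊) ∧ (b = j ∨ b = top j) := by
    intro a b
    rw [mem_verts_Dg]
    constructor
    · rintro ⟨y, hy, h1, h2⟩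
      by_cases hyi : y = i
      · subst hyi; exact Or.inl ⟨h1, h2⟩
      · exact Or.inr ⟨y, hy, hyi, h1, h2⟩
    · rintro (⟨h1, h2⟩ | ⟨y, hy, hyi, h1, h2⟩)
      · exact ⟨i, hi, h1, h2⟩
      · exact ⟨y, hy, h1, h2⟩
  have hV2 : ∀ a b, (a, b) ∈ (Dg h').verts ↔ (a = (x' i : ℝ) ∧ (b = i ∨ b = top i)) ∨
      ∃ j ∈ Z, j ≠ i ∧ a = ((x j : ℝ) : 𝕊) ∧ (b = j ∨ b = top j) := by
    intro a b
    rw [mem_verts_Dg]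
    constructor
    · rintro ⟨y, hy, h1, h2⟩
      by_cases hyi : y = i
      · subst hyi; exact Or.inl ⟨h1, h2⟩
      · exact Or.inr ⟨y, hy, hyi, by rw [h1, hij y hy hyi], h2⟩
    · rintro (⟨h1, h2⟩ | ⟨y, hy, hyi, h1, h2⟩)
      · exact ⟨i, hi, h1, h2⟩
      · exact ⟨y, hy, by rw [h1, hij y hy hyi], h2⟩
  have hsd : symmDiff (↑(Dg h).verts : Set Torus) ↑(Dg h').verts =
      ({((x i : ℝ) : 𝕊), ((x' i : ℝ) : 𝕊)} : Set 𝕊) ×ˢ ({i, top i} : Set 𝕊) := by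
    ext ⟨a, b⟩
    rw [Set.mem_symmDiff, Finset.mem_coe, Finset.mem_coe, hV1, hV2]
    simp only [Set.mem_prod, Set.mem_insert_iff, Set.mem_singleton_iff]
    constructor
    · rintro (⟨h1 | h1, h2⟩ | ⟨h1 | h1, h2⟩)
      · exact ⟨Or.inl h1.1, h1.2⟩
      · exact absurd (Or.inr h1) h2
      · exact ⟨Or.inr h1.1, h1.2⟩
      · exact absurd (Or.inr h1) h2
    · rintro ⟨rfl | rfl, hb⟩
      · refine Or.inl ⟨Or.inl ⟨rfl, hb⟩, ?_⟩
        rintro (⟨h1, -⟩ | ⟨j, hj, hji, h1, -⟩)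
        · exact hne h1
        · exact hxi j hj hji h1.symm
      · refine Or.inr ⟨Or.inl ⟨rfl, hb⟩, ?_⟩
        rintro (⟨h1, -⟩ | ⟨j, hj, hji, h1, -⟩)
        · exact hne h1.symm
        · exact hx'i j hj hji h1.symm
  refine ⟨hne, htn, hsd, ?_, ⟨{(((x i : ℝ) : 𝕊), top i), (((x i : ℝ) : 𝕊), i)}, ?_, ?_, ?_⟩, ?_⟩
  · apply Set.Subset.antisymm
    · rintro ⟨a, b⟩ ⟨⟨ha, hb⟩, hV⟩
      simp only at ha hb
      have hno : ¬ ∃ j ∈ Z, j ≠ i ∧ a = ((x j : ℝ) : 𝕊) ∧ (b = j ∨ b = top j) := by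
        rintro ⟨j, hj, hji, rfl, rfl | rfl⟩
        · exact hcl _ hj hji (Or.inl hb) ha
        · exact hcl _ hj hji (Or.inr hb) ha
      rw [hsd]
      rcases hV with hV | hV
      · rcases (hV1 a b).1 hV with h1 | h1
        · exact ⟨Or.inl h1.1, h1.2⟩
        · exact absurd h1 hno
      · rcases (hV2 a b).1 hV with h1 | h1
        · exact ⟨Or.inr h1.1, h1.2⟩
        · exact absurd h1 hno
    · intro p hp
      have hp' := hp
      refine ⟨?_, ?_⟩
      · rw [hsd] at hp'
        obtain ⟨a, b⟩ := p
        obtain ⟨ha, hb⟩ := hp'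
        simp only [Set.mem_insert_iff, Set.mem_singleton_iff] at ha hb
        constructor
        · rcases ha with rfl | rfl
          · exact left_mem_closedArc _ _
          · exact right_mem_closedArc _ _
        · rcases hb with rfl | rfl
          · exact left_mem_closedArc _ _
          · exact right_mem_closedArc _ _
      · rw [Set.mem_symmDiff] at hp
        rcases hp with hp | hp
        · exact Or.inl hp.1
        · exact Or.inr hp.1
  · unfold ConsecCorners; simp
  · ext ⟨a, b⟩
    simp only [Set.mem_inter_iff, Finset.mem_coe, hV1, Set.mem_prod, Set.mem_insert_iff,
      Set.mem_singleton_iff, Prod.mk.injEq]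
    constructor
    · rintro ⟨h1 | ⟨j, hj, hji, rfl, -⟩, h2, h3⟩
      · tauto
      · rcases h2 with h2 | h2
        · exact absurd h2 (hxi j hj hji)
        · exact absurd h2 (hx'i j hj hji)
    · rintro (⟨rfl, rfl⟩ | ⟨rfl, rfl⟩) <;> simp
  · rintro ⟨a, b⟩ ⟨⟨ha, hb⟩, hs⟩
    simp only [Set.mem_insert_iff, Set.mem_singleton_iff, Prod.mk.injEq] at ha hb hs
    rw [Finset.mem_coe, hV2]
    rcases ha with rfl | rfl
    · exfalso; tauto
    · exact Or.inl ⟨rfl, hb⟩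
  · ext ⟨a, b⟩
    simp only [Set.mem_inter_iff, Finset.mem_coe]
    constructor
    · rintro ⟨h1, h2⟩
      refine ⟨Finset.mem_union_left _ h1, ?_⟩
      rw [mem_pos_Dg] at h1 ⊢
      refine ⟨h1.1, ?_⟩
      by_cases hb : b = i
      · subst hb
        rw [hV2] at h2
        exfalso
        rcases h2 with ⟨h2, -⟩ | ⟨j, hj, hji, h2, -⟩
        · exact hne (h1.2.symm.trans h2)
        · exact hxi j hj hji (h2.symm.trans h1.2)
      · rw [hij b h1.1 hb]; exact h1.2
    · rintro ⟨h2, h1⟩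
      refine ⟨?_, Finset.mem_union_left _ h1⟩
      rw [mem_pos_Dg] at h1 ⊢
      refine ⟨h1.1, ?_⟩
      by_cases hb : b = i
      · subst hb
        rw [hV1] at h2
        exfalso
        rcases h2 with ⟨h2, -⟩ | ⟨j, hj, hji, h2, -⟩
        · exact hne (h2.symm.trans h1.2)
        · exact hx'i j hj hji (h2.symm.trans h1.2)
      · rw [← hij b h1.1 hb]; exact h1.2

lemma Dg_congr (h : Good Z top x) (h' : Good Z top x') (he : ∀ i ∈ Z, x i = x' i) :
    Dg h = Dg h' := by
  apply rect_ext
  · simp only [Dg]; apply Finset.image_congr; intro i hi; simp [he i hi]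
  · simp only [Dg]; apply Finset.image_congr; intro i hi; simp [he i hi]

lemma Dg_congr' {top' : 𝕊 → 𝕊} (h : Good Z top x) (h' : Good Z top' x') (he : ∀ i ∈ Z, ((x i : ℝ) : 𝕊) = x' i)
    (ht : ∀ i ∈ Z, top i = top' i) :
    Dg h = Dg h' := by
  apply rect_ext
  · simp only [Dg]; apply Finset.image_congr; intro i hi; simp [he i hi]
  · simp only [Dg]; apply Finset.image_congr; intro i hi; simp [he i hi, ht i hi]

lemma exch_step' (h : Good Z top x) (h' : Good Z top x') {i : 𝕊} (hi : i ∈ Z) {δ : ℝ}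
    (hδ : δ ≤ 1)
    (hij : ∀ j ∈ Z, j ≠ i → x' j = x j) (hab : |x i - x' i| < δ)
    (hcl : ∀ j ∈ Z, j ≠ i → Near top i j → ∀ k : ℤ, δ ≤ |x i - x j - k|) :
    Exch (Dg h) (Dg h') := by
  rw [abs_lt] at hab
  rcases lt_trichotomy (x i) (x' i) with hlt | heq | hgt
  · refine Relation.ReflTransGen.single (exch_step h h' hi hij hlt (by linarith) ?_)
    intro j hj hji hr hm
    obtain ⟨k, hk1, hk2⟩ := (mem_closedArc_lift hlt.le (by linarith)).1 hm
    have := hcl j hj hji hr k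
    rw [abs_of_nonpos (by linarith)] at this
    linarith
  · rw [Dg_congr h h']
    · exact Relation.ReflTransGen.refl
    · intro j hj
      by_cases hji : j = i
      · rw [hji, heq]
      · rw [hij j hj hji]
  · refine Relation.ReflTransGen.single (exch_step h' h hi (fun j hj hji => (hij j hj hji).symm)
      hgt (by linarith) ?_).symm
    intro j hj hji hr hm
    obtain ⟨k, hk1, hk2⟩ := (mem_closedArc_lift hgt.le (by linarith)).1 hm
    have := hcl j hj hji hr k
    rw [hij j hj hji] at hk1 hk2
    rw [abs_of_nonneg (by linarith)] at this
    linarith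

/-- Local move: all edges move by less than `δ`, compatible positions. -/
lemma exch_local (h : Good Z top x) (h' : Good Z top x') {δ : ℝ} (hδ : δ ≤ 1)
    (hd : ∀ i ∈ Z, |x i - x' i| < δ)
    (hcompat : ∀ i ∈ Z, ∀ j ∈ Z, i ≠ j → ((x' i : ℝ) : 𝕊) ≠ (x j : ℝ))
    (hcl : ∀ i ∈ Z, ∀ j ∈ Z, j ≠ i → Near top i j → ∀ k : ℤ, 3 * δ ≤ |x i - x j - k|) :
    Exch (Dg h) (Dg h') := by
  classical
  have hgood : ∀ S : Finset 𝕊, Good Z top (fun i => if i ∈ S then x' i else x i) := by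
    intro S
    refine ⟨h.ne, h.maps, h.inj, h.top_ne, ?_⟩
    intro y hy z hz hyz
    by_contra hne

    split_ifs at hyz
    · exact hne (h'.xinj y hy z hz hyz)
    · exact hcompat y hy z hz hne hyz
    · exact hcompat z hz y hy (Ne.symm hne) hyz.symm
    · exact hne (h.xinj y hy z hz hyz)
  have main : ∀ S : Finset 𝕊, S ⊆ Z → Exch (Dg h) (Dg (hgood S)) := by
    intro S
    induction S using Finset.induction_on with
    | empty =>
      intro _
      rw [Dg_congr h (hgood ∅) (by intro i _; simp)]
      exact Relation.ReflTransGen.refl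
    | insert i S hiS ih =>
      intro hS
      have hi : i ∈ Z := hS (Finset.mem_insert_self _ _)
      refine (ih fun j hj => hS (Finset.mem_insert_of_mem hj)).trans
        (exch_step' (hgood S) (hgood (insert i S)) hi hδ ?_ ?_ ?_)
      · intro j hj hji
        simp [Finset.mem_insert, hji]
      · simp [hiS, hd i hi]
      · intro j hj hji hr k
        have h1 := hcl i hi j hj hji hr k
        have h2 := hd j hj
        simp only [hiS, if_false]
        split_ifs
        · rw [le_abs] at h1 ⊢
          rw [abs_lt] at h2
          rcases h1 with h1 | h1
          · left; linarith
          · right; linarith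
        · linarith [abs_nonneg (x j - x' j)]
  refine (main Z (Finset.Subset.refl _)).trans ?_
  rw [Dg_congr (hgood Z) h' (by intro i hi; simp [hi])]
  exact Relation.ReflTransGen.refl

end

lemma uniform_pos {α : Type*} (s : Finset α) (P : α → ℝ → Prop)
    (hmono : ∀ a δ δ', P a δ → δ' ≤ δ → P a δ') (h : ∀ a ∈ s, ∃ δ > 0, P a δ) :
    ∃ δ > 0, ∀ a ∈ s, P a δ := by
  classical
  induction s using Finset.induction_on with
  | empty => exact ⟨1, one_pos, by simp⟩
  | insert i S hiS ih =>
    obtain ⟨δ, hδ, h1⟩ := ih fun a ha => h a (Finset.mem_insert_of_mem ha)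
    obtain ⟨δ', hδ', h2⟩ := h i (Finset.mem_insert_self _ _)
    refine ⟨min δ δ', lt_min hδ hδ', ?_⟩
    intro a ha
    rcases Finset.mem_insert.1 ha with rfl | ha
    · exact hmono _ _ _ h2 (min_le_right _ _)
    · exact hmono _ _ _ (h1 a ha) (min_le_left _ _)

end

section

lemma affine_countable (a b : ℝ) (h : b = 0 → ∀ k : ℤ, a ≠ k) :
    {t : ℝ | ∃ k : ℤ, a + t * b = k}.Countable := by
  by_cases hb : b = 0
  · convert Set.countable_empty
    ext t
    simp only [hb, mul_zero, add_zero, Set.mem_ofPred_eq, Set.mem_empty_iff_false, iff_false]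
    rintro ⟨k, hk⟩
    exact h hb k hk
  · refine (Set.countable_range fun k : ℤ => ((k : ℝ) - a) / b).mono ?_
    rintro t ⟨k, hk⟩
    refine ⟨k, ?_⟩
    simp only
    field_simp
    linarith

lemma far_of_between {r δ : ℝ} {k : ℤ} (h1 : k + δ ≤ r) (h2 : r ≤ k + 1 - δ) (l : ℤ) :
    δ ≤ |r - l| := by
  rw [le_abs]
  rcases le_or_gt l k with h | h
  · left
    have : (l : ℝ) ≤ k := by exact_mod_cast h
    linarith
  · right
    have : (k : ℝ) + 1 ≤ l := by exact_mod_cast h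
    linarith

lemma exists_margin {r : ℝ} {k : ℤ} (h1 : (k : ℝ) < r) (h2 : r < k + 1) :
    ∃ δ > 0, k + δ ≤ r ∧ r ≤ k + 1 - δ :=
  ⟨min (r - k) (k + 1 - r), lt_min (by linarith) (by linarith),
    by linarith [min_le_left (r - k) (k + 1 - r)], by linarith [min_le_right (r - k) (k + 1 - r)]⟩

section
variable {Z : Finset 𝕊} {top : 𝕊 → 𝕊} {x x' : 𝕊 → ℝ}

lemma exists_good_between (h : Good Z top x) {t s : ℝ} (hts : t < s) (C : Set ℝ) (hC : C.Countable) :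
    ∃ r ∈ Ioo t s, r ∉ C ∧ Good Z top (fun i => x i + r * (x' i - x i)) := by
  classical
  have hcount : (C ∪ ⋃ p ∈ (Z ×ˢ Z).filter (fun p => p.1 ≠ p.2),
      {t : ℝ | ∃ k : ℤ, (x p.1 - x p.2) + t * ((x' p.1 - x p.1) - (x' p.2 - x p.2)) = k}).Countable := by
    refine hC.union (Set.Countable.biUnion (Finset.countable_toSet _) ?_)
    rintro ⟨i, j⟩ hij
    simp only [Finset.coe_filter, Finset.mem_product, Set.mem_ofPred_eq] at hij
    apply affine_countable
    intro _ k hk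
    exact hij.2 (h.xinj i hij.1.1 j hij.1.2 (coe_eq_iff.2 ⟨k, by simp only at hk; linarith⟩))
  obtain ⟨r, hr, hr'⟩ := (hcount.dense_compl ℝ).exists_between hts
  refine ⟨r, hr', fun hc => hr (Or.inl hc), h.ne, h.maps, h.inj, h.top_ne, ?_⟩
  intro y hy z hz hyz
  by_contra hne
  apply hr
  right
  simp only [Set.mem_iUnion]
  refine ⟨(y, z), by simp [hy, hz, hne], ?_⟩
  obtain ⟨k, hk⟩ := coe_eq_iff.1 hyz
  exact ⟨k, by simp only; linarith⟩

lemma exch_path (h : Good Z top x) (h' : Good Z top x')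
    (hc : ∀ i ∈ Z, ∀ j ∈ Z, j ≠ i → Near top i j → ∃ k : ℤ, (k : ℝ) < x i - x j ∧ x i - x j < k + 1 ∧
      (k : ℝ) < x' i - x' j ∧ x' i - x' j < k + 1) :
    Exch (Dg h) (Dg h') := by
  classical
  obtain ⟨δ0, hδ0, hm⟩ := uniform_pos (Z ×ˢ Z) (fun p δ => p.2 ≠ p.1 → Near top p.1 p.2 →
      ∃ k : ℤ, (k : ℝ) + δ ≤ x p.1 - x p.2 ∧ x p.1 - x p.2 ≤ k + 1 - δ ∧
      (k : ℝ) + δ ≤ x' p.1 - x' p.2 ∧ x' p.1 - x' p.2 ≤ k + 1 - δ)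
    (by
      rintro ⟨i, j⟩ δ δ' h hle h1 h2
      obtain ⟨k, h3, h4, h5, h6⟩ := h h1 h2
      exact ⟨k, by linarith, by linarith, by linarith, by linarith⟩)
    (by
      rintro ⟨i, j⟩ hij
      rw [Finset.mem_product] at hij
      by_cases hh : j ≠ i ∧ Near top i j
      · obtain ⟨k, h1, h2, h3, h4⟩ := hc i hij.1 j hij.2 hh.1 hh.2
        obtain ⟨d, hd, h5, h6⟩ := exists_margin h1 h2
        obtain ⟨d', hd', h7, h8⟩ := exists_margin h3 h4
        refine ⟨min d d', lt_min hd hd', fun _ _ => ⟨k, ?_, ?_, ?_, ?_⟩⟩ <;>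
          simp only <;> linarith [min_le_left d d', min_le_right d d']
      · exact ⟨1, one_pos, fun a b => absurd ⟨a, b⟩ hh⟩)
  obtain ⟨M, hM, hMb⟩ : ∃ M > 0, ∀ i ∈ Z, |x' i - x i| < M := by
    refine ⟨1 + ∑ i ∈ Z, |x' i - x i|, by positivity, fun i hi => ?_⟩
    have := Finset.single_le_sum (f := fun i => |x' i - x i|) (fun i _ => abs_nonneg _) hi
    linarith
  set δ := min δ0 1 / 3 with hδ
  have hδpos : 0 < δ := by have := lt_min hδ0 one_pos; positivity
  have hδ1 : δ ≤ 1 := by have := min_le_right δ0 1; linarith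
  have hδ3 : 3 * δ ≤ δ0 := by have := min_le_left δ0 1; linarith
  set η := δ / M with hη
  have hηpos : 0 < η := by positivity
  let xt : ℝ → 𝕊 → ℝ := fun t i => x i + t * (x' i - x i)
  have hfar : ∀ t, 0 ≤ t → t ≤ 1 → ∀ i ∈ Z, ∀ j ∈ Z, j ≠ i → Near top i j →
      ∀ k : ℤ, 3 * δ ≤ |xt t i - xt t j - k| := by
    intro t ht0 ht1 i hi j hj hji hn k
    obtain ⟨l, h1, h2, h3, h4⟩ := hm (i, j) (Finset.mem_product.2 ⟨hi, hj⟩) hji hn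
    simp only at h1 h2 h3 h4
    refine far_of_between (k := l) ?_ ?_ k <;> simp only [xt] <;> nlinarith
  -- step A
  have stepA : ∀ t s, 0 ≤ t → t ≤ 1 → ∀ (ht : Good Z top (xt t)) (hs : Good Z top (xt s)),
      |t - s| < η → (∀ i ∈ Z, ∀ j ∈ Z, i ≠ j → ((xt s i : ℝ) : 𝕊) ≠ (xt t j : ℝ)) →
      Exch (Dg ht) (Dg hs) := by
    intro t s ht0 ht1 ht hs hts hcomp
    refine exch_local ht hs hδ1 ?_ hcomp (hfar t ht0 ht1)
    intro i hi
    have : xt t i - xt s i = (t - s) * (x' i - x i) := by simp only [xt]; ring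
    rw [this, abs_mul]
    have h1 := hMb i hi
    calc |t - s| * |x' i - x i| ≤ |t - s| * M := by gcongr
      _ < η * M := by gcongr
      _ = δ := by rw [hη]; field_simp
  have compat_count : ∀ t, Good Z top (xt t) →
      (⋃ p ∈ (Z ×ˢ Z).filter (fun p => p.1 ≠ p.2),
      {r : ℝ | ∃ k : ℤ, (x p.1 - xt t p.2) + r * (x' p.1 - x p.1) = k}).Countable := by
    intro t ht
    refine Set.Countable.biUnion (Finset.countable_toSet _) ?_
    rintro ⟨i, j⟩ hij
    simp only [Finset.coe_filter, Finset.mem_product, Set.mem_ofPred_eq] at hij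
    apply affine_countable
    intro h0 k hk
    apply hij.2 (ht.xinj i hij.1.1 j hij.1.2 (coe_eq_iff.2 ⟨k, ?_⟩))
    simp only at hk h0
    have : xt t i = x i := by simp only [xt]; rw [h0]; ring
    linarith
  have stepB' : ∀ t s, 0 ≤ t → s ≤ 1 → ∀ (ht : Good Z top (xt t)) (hs : Good Z top (xt s)),
      s - t < η → t < s → Exch (Dg ht) (Dg hs) := by
    intro t s ht0 hs1 ht hs hts hlt
    obtain ⟨r, ⟨hr1, hr2⟩, hrC, hrG⟩ := exists_good_between (x' := x') h hlt _
      ((compat_count t ht).union (compat_count s hs))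
    have hcomp : ∀ u, r ∉ (⋃ p ∈ (Z ×ˢ Z).filter (fun p => p.1 ≠ p.2),
      {r : ℝ | ∃ k : ℤ, (x p.1 - xt u p.2) + r * (x' p.1 - x p.1) = k}) →
        ∀ i ∈ Z, ∀ j ∈ Z, i ≠ j → ((xt r i : ℝ) : 𝕊) ≠ (xt u j : ℝ) := by
      intro u hu i hi j hj hij he
      apply hu
      simp only [Set.mem_iUnion]
      obtain ⟨k, hk⟩ := coe_eq_iff.1 he
      exact ⟨(i, j), by simp [hi, hj, hij], k, by simp only [xt] at hk ⊢; linarith⟩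
    have e1 := stepA t r ht0 (by linarith) ht hrG (by rw [abs_lt]; constructor <;> linarith)
      (hcomp t fun hc => hrC (Or.inl hc))
    have e2 := stepA s r (by linarith) hs1 hs hrG (by rw [abs_lt]; constructor <;> linarith)
      (hcomp s fun hc => hrC (Or.inr hc))
    exact e1.trans e2.symm
  have h0 : Good Z top (xt 0) := by
    have : xt 0 = x := by funext i; simp [xt]
    rwa [this]
  have h1 : Good Z top (xt 1) := by
    have : xt 1 = x' := by funext i; simp [xt]
    rwa [this]
  have chain : ∀ n : ℕ, ∀ t, 0 < t → t ≤ 1 → t < n * η → ∀ ht : Good Z top (xt t),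
      Exch (Dg h0) (Dg ht) := by
    intro n
    induction n with
    | zero => intro t h1 _ h2; simp at h2; linarith
    | succ n ih =>
      intro t ht0 ht1 htn ht
      by_cases hc : t < η
      · exact stepB' 0 t le_rfl ht1 h0 ht (by linarith) ht0
      · rw [not_lt] at hc
        push_cast at htn
        have hn : 0 < n * η := by
          rcases Nat.eq_zero_or_pos n with rfl | hn
          · simp at htn; linarith
          · positivity
        have hlt : max (t - η) 0 < min t (n * η) := by
          rw [max_lt_iff, lt_min_iff, lt_min_iff]
          refine ⟨⟨?_, ?_⟩, ?_, ?_⟩ <;> linarith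
        obtain ⟨r, ⟨hr1, hr2⟩, -, hrG⟩ := exists_good_between (x' := x') h hlt ∅ Set.countable_empty
        rw [max_lt_iff] at hr1
        rw [lt_min_iff] at hr2
        exact (ih r hr1.2 (by linarith) hr2.2 hrG).trans
          (stepB' r t hr1.2.le ht1 hrG ht (by linarith) hr2.1)
  obtain ⟨n, hn⟩ := exists_nat_gt (1 / η)
  have e := chain n 1 one_pos le_rfl (by rwa [div_lt_iff₀ hηpos] at hn) h1
  rwa [Dg_congr h0 h (by intro i _; simp [xt]), Dg_congr h1 h' (by intro i _; simp [xt])] at e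

end

/-! ### Swapping coordinates -/

def swapR (R : RectDiagram) : RectDiagram where
  pos := R.pos.image Prod.swap
  neg := R.neg.image Prod.swap
  disj := (Finset.disjoint_image Prod.swap_injective).2 R.disj
  nonempty := by rw [← Finset.image_union]; exact R.nonempty.image _
  thetaEq := by
    simp only [Finset.image_image]
    exact R.phiEq
  phiEq := by
    simp only [Finset.image_image]
    exact R.thetaEq
  thetaInjPos := by
    intro p hp q hq h
    simp only [Finset.coe_image, Set.mem_image] at hp hq
    obtain ⟨p, hp, rfl⟩ := hp
    obtain ⟨q, hq, rfl⟩ := hq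
    rw [R.phiInjPos hp hq h]
  thetaInjNeg := by
    intro p hp q hq h
    simp only [Finset.coe_image, Set.mem_image] at hp hq
    obtain ⟨p, hp, rfl⟩ := hp
    obtain ⟨q, hq, rfl⟩ := hq
    rw [R.phiInjNeg hp hq h]
  phiInjPos := by
    intro p hp q hq h
    simp only [Finset.coe_image, Set.mem_image] at hp hq
    obtain ⟨p, hp, rfl⟩ := hp
    obtain ⟨q, hq, rfl⟩ := hq
    rw [R.thetaInjPos hp hq h]
  phiInjNeg := by
    intro p hp q hq h
    simp only [Finset.coe_image, Set.mem_image] at hp hq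
    obtain ⟨p, hp, rfl⟩ := hp
    obtain ⟨q, hq, rfl⟩ := hq
    rw [R.thetaInjNeg hp hq h]

lemma mem_swap_pos {R : RectDiagram} {a b : 𝕊} : (a, b) ∈ (swapR R).pos ↔ (b, a) ∈ R.pos := by
  simp [swapR]

lemma mem_swap_neg {R : RectDiagram} {a b : 𝕊} : (a, b) ∈ (swapR R).neg ↔ (b, a) ∈ R.neg := by
  simp [swapR]

lemma mem_swap_verts {R : RectDiagram} {a b : 𝕊} : (a, b) ∈ (swapR R).verts ↔ (b, a) ∈ R.verts := by
  rw [RectDiagram.verts, RectDiagram.verts, Finset.mem_union, Finset.mem_union, mem_swap_pos, mem_swap_neg]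

lemma swap_swap (R : RectDiagram) : swapR (swapR R) = R := by
  apply rect_ext <;> ext ⟨a, b⟩
  · rw [mem_swap_pos, mem_swap_pos]
  · rw [mem_swap_neg, mem_swap_neg]

lemma card_verts_swap (R : RectDiagram) : (swapR R).verts.card = R.verts.card := by
  have : (swapR R).verts = R.verts.image Prod.swap := by
    simp [RectDiagram.verts, swapR, Finset.image_union]
  rw [this, Finset.card_image_of_injective _ Prod.swap_injective]

lemma consec_swap {θ₁ θ₂ φ₁ φ₂ : 𝕊} {s : Set Torus} (h : ConsecCorners θ₁ θ₂ φ₁ φ₂ s) :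
    ConsecCorners φ₁ φ₂ θ₁ θ₂ (Prod.swap '' s) := by
  unfold ConsecCorners at h ⊢
  simp only at h ⊢
  rcases h with rfl | rfl | rfl | rfl | rfl | rfl | rfl | rfl | rfl | rfl | rfl | rfl
  · left; simp
  · right; right; right; left; simp
  · right; right; left; simp
  · right; left; simp
  · iterate 7 right
    left; simp [Set.image_insert_eq, Set.pair_comm]
  · iterate 6 right
    left; simp [Set.image_insert_eq, Set.pair_comm]
  · iterate 5 right
    left; simp [Set.image_insert_eq, Set.pair_comm]
  · iterate 4 right
    left; simp [Set.image_insert_eq, Set.pair_comm]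
  · iterate 10 right
    left; ext ⟨a, b⟩; simp [Set.image_insert_eq]; tauto
  · iterate 9 right
    left; ext ⟨a, b⟩; simp [Set.image_insert_eq]; tauto
  · iterate 8 right
    left; ext ⟨a, b⟩; simp [Set.image_insert_eq]; tauto
  · iterate 11 right
    ext ⟨a, b⟩; simp [Set.image_insert_eq]; tauto

lemma ElemMoveData.swap {R₁ R₂ : RectDiagram} {θ₁ θ₂ φ₁ φ₂ : 𝕊}
    (h : ElemMoveData R₁ R₂ θ₁ θ₂ φ₁ φ₂) : ElemMoveData (swapR R₁) (swapR R₂) φ₁ φ₂ θ₁ θ₂ := by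
  obtain ⟨h1, h2, h3, h4, ⟨s, hs, hs1, hs2⟩, h6⟩ := h
  have e3 : ∀ a b : 𝕊, _ := fun a b => Set.ext_iff.1 h3 (b, a)
  have e4 : ∀ a b : 𝕊, _ := fun a b => Set.ext_iff.1 h4 (b, a)
  have e6 : ∀ a b : 𝕊, _ := fun a b => Set.ext_iff.1 h6 (b, a)
  have es : ∀ a b : 𝕊, _ := fun a b => Set.ext_iff.1 hs1 (b, a)
  simp only [Set.mem_symmDiff, Set.mem_inter_iff, Set.mem_union, Set.mem_prod, Finset.mem_coe] at e3 e4 e6 es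
  refine ⟨h2, h1, ?_, ?_, ⟨Prod.swap '' s, consec_swap hs, ?_, ?_⟩, ?_⟩
  · ext ⟨a, b⟩
    have := e3 a b
    simp only [Set.mem_symmDiff, Set.mem_prod, Finset.mem_coe, mem_swap_verts]
    tauto
  · ext ⟨a, b⟩
    have := e4 a b
    simp only [Set.mem_symmDiff, Set.mem_prod, Set.mem_inter_iff, Set.mem_union, Finset.mem_coe, mem_swap_verts]
    tauto
  · ext ⟨a, b⟩
    have := es a b
    simp only [Set.mem_prod, Set.mem_inter_iff, Finset.mem_coe, mem_swap_verts]
    rw [Set.image_swap_eq_preimage_swap]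
    simp only [Set.mem_preimage, Prod.swap_prod_mk]
    tauto
  · rintro ⟨a, b⟩ ⟨hp, hs'⟩
    rw [Set.image_swap_eq_preimage_swap] at hs'
    simp only [Finset.mem_coe, mem_swap_verts]
    exact hs2 ⟨⟨hp.2, hp.1⟩, hs'⟩
  · ext ⟨a, b⟩
    have := e6 a b
    simp only [Set.mem_inter_iff, Finset.mem_coe, mem_swap_verts, mem_swap_pos]
    exact this

lemma Exch.swap {R₁ R₂ : RectDiagram} (h : Exch R₁ R₂) : Exch (swapR R₁) (swapR R₂) := by
  induction h with
  | refl => exact Relation.ReflTransGen.refl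
  | tail _ h ih =>
    obtain ⟨⟨a, b, c, d, h⟩, hc⟩ := h
    exact ih.tail ⟨⟨c, d, a, b, h.swap⟩, by rw [card_verts_swap, card_verts_swap, hc]⟩

end

section

/-- Data for the chain of destabilizations. -/
structure Bd (Y Z : Finset 𝕊) (top : 𝕊 → 𝕊) (X x : 𝕊 → ℝ) (δ : ℝ) (N : Finset Torus) : Prop where
  good : Good Z top x
  sub : Y ⊆ Z
  hδ : 0 < δ
  hδ1 : δ < 1 / 8
  hA : ∀ y ∈ Z, ∀ z ∈ Z, z ≠ y → toIco (z - y) < toIco (top y - y) →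
    ∀ k : ℤ, 4 * δ ≤ |X y - X z - k|
  hB1 : ∀ y ∈ Z, top y ∈ Y → ∀ k : ℤ, 4 * δ ≤ |X (top y) - X y - k|
  hB2 : ∀ y ∈ Z, top y ∉ Y → ∃ k : ℤ, X (top y) - X y = k ∧ x y - X y < x (top y) - X (top y)
  orb : ∀ y ∈ Z, ∃ n : ℕ, top^[n] y ∈ Y
  cl : ∀ y ∈ Z, |x y - X y| < δ
  neg : ∀ y ∈ Z, top y ∈ Y → (((X y : ℝ) : 𝕊), top y) ∈ N

lemma toIco_rev {a b : 𝕊} (h : a ≠ b) : toIco (b - a) + toIco (a - b) = 1 := by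
  have h1 := toIco_pos h
  have h2 := toIco_pos h.symm
  rcases toIco_tri a b a with ⟨h3, h4⟩ | ⟨h3, h4⟩ <;> rw [sub_self, toIco_zero] at h3 <;> linarith

lemma toIco_sub_inj {a b c : 𝕊} (h : toIco (a - c) = toIco (b - c)) : a = b := by
  have := coe_toIco (a - c)
  rw [h, coe_toIco] at this
  exact (sub_left_inj.1 this).symm

section
variable {Y Z : Finset 𝕊} {top : 𝕊 → 𝕊} {X x : 𝕊 → ℝ} {δ : ℝ} {N : Finset Torus}

set_option maxHeartbeats 1600000 in
/-- Removal of a height `y ∉ Y`. -/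
lemma Bd.step (b : Bd Y Z top X x δ N) {y : 𝕊} (hy : y ∈ Z) (hyY : y ∉ Y) :
    ∃ top', ∃ b' : Bd Y (Z.erase y) top' X x δ N, MoveOfType .rII (Dg b.good) (Dg b'.good) := by
  classical
  obtain ⟨w, hw, hwy⟩ : ∃ w ∈ Z, top w = y := by
    have : y ∈ Z.image top := by rw [b.good.surj]; exact hy
    simpa using this
  have hwney : w ≠ y := fun h => b.good.top_ne w hw (by rw [hwy, h])
  obtain ⟨k0, hk0, hη⟩ := b.hB2 w hw (by rwa [hwy])
  rw [hwy] at hk0 hη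
  have hδ := b.hδ
  have hδ1 := b.hδ1
  have hty : top y ∈ Z := b.good.maps y hy
  have htyy : top y ≠ y := b.good.top_ne y hy
  have h1 : top y ≠ w := by
    intro htw
    by_cases hwY : w ∈ Y
    · have := b.hB1 y hy (by rwa [htw]) (-k0)
      rw [htw] at this
      have e : X w - X y - ((-k0 : ℤ) : ℝ) = 0 := by push_cast; linarith
      rw [e, abs_zero] at this
      linarith
    · obtain ⟨n, hn⟩ := b.orb y hy
      have : ∀ n : ℕ, top^[n] y = y ∨ top^[n] y = w := by
        intro n
        induction n with
        | zero => left; rfl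
        | succ n ih =>
          rw [Function.iterate_succ_apply']
          rcases ih with h | h <;> rw [h]
          · right; exact htw
          · left; exact hwy
      rcases this n with h | h <;> rw [h] at hn
      · exact hyY hn
      · exact hwY hn
  have h2 : toIco (top y - y) < toIco (w - y) := by
    by_contra hc
    rw [not_lt] at hc
    have hlt : toIco (w - y) < toIco (top y - y) :=
      lt_of_le_of_ne hc fun h => h1 (toIco_sub_inj h).symm
    have := b.hA y hy w hw hwney hlt k0
    have e : X y - X w - (k0 : ℝ) = 0 := by linarith
    rw [e, abs_zero] at this
    linarith
  have hrev := toIco_rev hwney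
  have h3 : toIco (top y - w) = toIco (y - w) + toIco (top y - y) := by
    rcases toIco_tri w y (top y) with ⟨h, h'⟩ | ⟨h, h'⟩
    · exact h
    · linarith
  let top' : 𝕊 → 𝕊 := fun z => if top z = y then top y else top z
  have top'w : top' w = top y := by simp [top', hwy]
  have top'o : ∀ z ∈ Z, z ≠ w → top' z = top z := by
    intro z hz hzw
    have : top z ≠ y := fun h => hzw (b.good.inj z hz w hw (by rw [h, hwy]))
    simp [top', this]
  have hgood : Good (Z.erase y) top' x := by
    refine ⟨⟨w, Finset.mem_erase.2 ⟨hwney, hw⟩⟩, ?_, ?_, ?_, ?_⟩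
    · intro z hz
      rw [Finset.mem_erase] at hz ⊢
      by_cases hzw : z = w
      · subst hzw; rw [top'w]; exact ⟨htyy, hty⟩
      · rw [top'o z hz.2 hzw]
        exact ⟨fun h => hzw (b.good.inj z hz.2 w hw (by rw [h, hwy])), b.good.maps z hz.2⟩
    · intro z hz u hu hzu
      rw [Finset.mem_erase] at hz hu
      by_cases hzw : z = w
      · by_cases huw : u = w
        · rw [hzw, huw]
        · rw [hzw, top'w, top'o u hu.2 huw] at hzu
          exact absurd (b.good.inj y hy u hu.2 hzu).symm hu.1
      · by_cases huw : u = w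
        · rw [huw, top'w, top'o z hz.2 hzw] at hzu
          exact absurd (b.good.inj z hz.2 y hy hzu) hz.1
        · rw [top'o z hz.2 hzw, top'o u hu.2 huw] at hzu
          exact b.good.inj z hz.2 u hu.2 hzu
    · intro z hz
      rw [Finset.mem_erase] at hz
      by_cases hzw : z = w
      · rw [hzw, top'w]; exact h1
      · rw [top'o z hz.2 hzw]; exact b.good.top_ne z hz.2
    · intro z hz u hu
      exact b.good.xinj z (Finset.mem_of_mem_erase hz) u (Finset.mem_of_mem_erase hu)
  have hb' : Bd Y (Z.erase y) top' X x δ N := by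
    refine ⟨hgood, ?_, hδ, hδ1, ?_, ?_, ?_, ?_, ?_, ?_⟩
    · intro z hz
      exact Finset.mem_erase.2 ⟨fun h => hyY (h ▸ hz), b.sub hz⟩
    · intro z hz u hu huz hlt k
      rw [Finset.mem_erase] at hz hu
      by_cases hzw : z = w
      · subst hzw
        rw [top'w, h3] at hlt
        by_cases hc : toIco (u - z) < toIco (y - z)
        · exact b.hA z hw u hu.2 huz (by rwa [hwy]) k
        · rw [not_lt] at hc
          have : toIco (u - y) < toIco (top y - y) := by
            have := toIco_lt_one (u - y)
            have := toIco_nonneg (u - y)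
            rcases toIco_tri z y u with ⟨h, h'⟩ | ⟨h, h'⟩ <;> linarith
          have := b.hA y hy u hu.2 hu.1 this (k + k0)
          have e : X y - X u - ((k + k0 : ℤ) : ℝ) = X z - X u - k := by push_cast; linarith
          rwa [e] at this
      · rw [top'o z hz.2 hzw] at hlt
        exact b.hA z hz.2 u hu.2 huz hlt k
    · intro z hz ht k
      rw [Finset.mem_erase] at hz
      by_cases hzw : z = w
      · subst hzw
        rw [top'w] at ht ⊢
        have := b.hB1 y hy ht (k - k0)
        have e : X (top y) - X y - ((k - k0 : ℤ) : ℝ) = X (top y) - X z - k := by push_cast; linarith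
        rwa [e] at this
      · rw [top'o z hz.2 hzw] at ht ⊢
        exact b.hB1 z hz.2 ht k
    · intro z hz ht
      rw [Finset.mem_erase] at hz
      by_cases hzw : z = w
      · subst hzw
        rw [top'w] at ht ⊢
        obtain ⟨k, hk, hk'⟩ := b.hB2 y hy ht
        exact ⟨k + k0, by push_cast; linarith, by linarith⟩
      · rw [top'o z hz.2 hzw] at ht ⊢
        exact b.hB2 z hz.2 ht
    · have key : ∀ n : ℕ, ∀ z ∈ Z.erase y, top^[n] z ∈ Y → ∃ m : ℕ, top'^[m] z ∈ Y := by
        intro n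
        induction n using Nat.strong_induction_on with
        | _ n ih =>
          intro z hz hn
          have hzZ := Finset.mem_of_mem_erase hz
          cases n with
          | zero => exact ⟨0, hn⟩
          | succ n =>
            rw [Function.iterate_succ_apply] at hn
            by_cases hzw : z = w
            · subst hzw
              rw [hwy] at hn
              cases n with
              | zero => exact absurd hn hyY
              | succ n =>
                rw [Function.iterate_succ_apply] at hn
                obtain ⟨m, hm⟩ := ih n (by omega) (top y) (Finset.mem_erase.2 ⟨htyy, hty⟩) hn
                exact ⟨m + 1, by rw [Function.iterate_succ_apply, top'w]; exact hm⟩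
            · obtain ⟨m, hm⟩ := ih n (by omega) (top z) (by
                rw [← top'o z hzZ hzw]; exact hgood.maps z hz) hn
              exact ⟨m + 1, by rw [Function.iterate_succ_apply, top'o z hzZ hzw]; exact hm⟩
      intro z hz
      obtain ⟨n, hn⟩ := b.orb z (Finset.mem_of_mem_erase hz)
      exact key n z hz hn
    · intro z hz; exact b.cl z (Finset.mem_of_mem_erase hz)
    · intro z hz ht
      rw [Finset.mem_erase] at hz
      by_cases hzw : z = w
      · subst hzw
        rw [top'w] at ht ⊢
        have := b.neg y hy ht
        rwa [show ((X y : ℝ) : 𝕊) = (X z : ℝ) from coe_eq_iff.2 ⟨k0, by linarith⟩] at this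
      · rw [top'o z hz.2 hzw] at ht ⊢
        exact b.neg z hz.2 ht
  refine ⟨top', hb', Or.inr (Or.inr ⟨(x w : ℝ), (x y : ℝ), y, top y, ?_, ?_, ?_⟩)⟩
  rotate_left
  · rw [card_verts_Dg, card_verts_Dg, Finset.card_erase_of_mem hy]
    have := Finset.card_pos.2 ⟨y, hy⟩
    omega
  · refine ⟨((x w : ℝ), top y), ⟨?_, left_mem_closedArc _ _, right_mem_closedArc _ _⟩,
      y, by simp, ?_, ?_, Or.inl rfl, ?_⟩
    · rw [Finset.mem_coe, mem_verts_Dg]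
      exact ⟨w, Finset.mem_erase.2 ⟨hwney, hw⟩, rfl, Or.inr top'w.symm⟩
    · rw [mem_verts_Dg]; exact ⟨w, hw, rfl, Or.inr hwy.symm⟩
    · rw [mem_verts_Dg]; exact ⟨y, hy, rfl, Or.inl rfl⟩
    · rw [mem_pos_Dg]; exact ⟨hy, rfl⟩
  have hxne : ((x w : ℝ) : 𝕊) ≠ (x y : ℝ) := fun h => hwney (b.good.xinj w hw y hy h)
  have hV1 : ∀ a c, (a, c) ∈ (Dg b.good).verts ↔ (a = (x w : ℝ) ∧ (c = w ∨ c = y)) ∨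
      (a = (x y : ℝ) ∧ (c = y ∨ c = top y)) ∨
      ∃ j ∈ Z, j ≠ y ∧ j ≠ w ∧ a = ((x j : ℝ) : 𝕊) ∧ (c = j ∨ c = top j) := by
    intro a c
    rw [mem_verts_Dg]
    constructor
    · rintro ⟨j, hj, g1, g2⟩
      by_cases hjw : j = w
      · subst hjw; exact Or.inl ⟨g1, by rwa [hwy] at g2⟩
      · by_cases hjy : j = y
        · subst hjy; exact Or.inr (Or.inl ⟨g1, g2⟩)
        · exact Or.inr (Or.inr ⟨j, hj, hjy, hjw, g1, g2⟩)
    · rintro (⟨g1, g2⟩ | ⟨g1, g2⟩ | ⟨j, hj, -, -, g1, g2⟩)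
      · exact ⟨w, hw, g1, by rwa [hwy]⟩
      · exact ⟨y, hy, g1, g2⟩
      · exact ⟨j, hj, g1, g2⟩
  have hV2 : ∀ a c, (a, c) ∈ (Dg hb'.good).verts ↔ (a = (x w : ℝ) ∧ (c = w ∨ c = top y)) ∨
      ∃ j ∈ Z, j ≠ y ∧ j ≠ w ∧ a = ((x j : ℝ) : 𝕊) ∧ (c = j ∨ c = top j) := by
    intro a c
    rw [mem_verts_Dg]
    constructor
    · rintro ⟨j, hj, g1, g2⟩
      rw [Finset.mem_erase] at hj
      by_cases hjw : j = w
      · subst hjw; exact Or.inl ⟨g1, by rwa [top'w] at g2⟩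
      · exact Or.inr ⟨j, hj.2, hj.1, hjw, g1, by rwa [top'o j hj.2 hjw] at g2⟩
    · rintro (⟨g1, g2⟩ | ⟨j, hj, hjy, hjw, g1, g2⟩)
      · exact ⟨w, Finset.mem_erase.2 ⟨hwney, hw⟩, g1, by rwa [top'w]⟩
      · exact ⟨j, Finset.mem_erase.2 ⟨hjy, hj⟩, g1, by rwa [top'o j hj hjw]⟩
  have hxj : ∀ j ∈ Z, j ≠ y → j ≠ w → ((x j : ℝ) : 𝕊) ≠ (x y : ℝ) ∧ ((x j : ℝ) : 𝕊) ≠ (x w : ℝ) :=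
    fun j hj hjy hjw => ⟨fun h => hjy (b.good.xinj j hj y hy h), fun h => hjw (b.good.xinj j hj w hw h)⟩
  have hclw := abs_lt.1 (b.cl w hw)
  have hcly := abs_lt.1 (b.cl y hy)
  -- no other edges in the rectangle
  have hno : ∀ j ∈ Z, j ≠ y → j ≠ w → Near top y j →
      ((x j : ℝ) : 𝕊) ∉ closedArc ((x w : ℝ) : 𝕊) ((x y : ℝ) : 𝕊) := by
    intro j hj hjy hjw hn hm
    rw [← coe_add_int (x w) k0, mem_closedArc_lift (by linarith) (by linarith)] at hm
    obtain ⟨k, hk1, hk2⟩ := hm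
    have hclj := abs_lt.1 (b.cl j hj)
    have hfar : ¬ ∀ k : ℤ, 4 * δ ≤ |X y - X j - k| := by
      intro h
      have := h k
      rw [le_abs] at this
      rcases this with h | h <;> linarith
    have hfar' : ¬ ∀ k : ℤ, 4 * δ ≤ |X j - X y - k| := by
      intro h
      have := h (-k)
      push_cast at this
      rw [le_abs] at this
      rcases this with h | h <;> linarith
    rcases hn with hn | hn
    · rcases lt_or_eq_of_le (show toIco (j - y) ≤ toIco (top y - y) from hn) with hlt | heq
      · exact hfar (b.hA y hy j hj hjy hlt)
      · have hjt : j = top y := toIco_sub_inj heq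
        by_cases htY : top y ∈ Y
        · exact hfar' (by rw [hjt]; exact b.hB1 y hy htY)
        · obtain ⟨k1, hk3, hk4⟩ := b.hB2 y hy htY
          rw [← hjt] at hk3 hk4
          have h5 : ((k1 + k : ℤ) : ℝ) < 0 := by push_cast; linarith
          have h6 : ((k1 + k : ℤ) : ℝ) ≤ -1 := by
            have : k1 + k < 0 := by exact_mod_cast h5
            have : k1 + k ≤ -1 := by omega
            exact_mod_cast this
          push_cast at h6
          linarith
    · have hle : toIco (top j - y) ≤ toIco (top y - y) := hn
      have hne1 : toIco (top j - y) ≠ toIco (top y - y) := fun h =>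
        hjy (b.good.inj j hj y hy (toIco_sub_inj h))
      have hpos : 0 < toIco (top j - y) := toIco_pos fun h =>
        hjw (b.good.inj j hj w hw (by rw [← h, hwy]))
      have hlt := lt_of_le_of_ne hle hne1
      by_cases hc : toIco (y - j) < toIco (top j - j)
      · exact hfar' (b.hA j hj y hy (Ne.symm hjy) hc)
      · rw [not_lt] at hc
        have hr := toIco_rev hjy
        apply hfar (b.hA y hy j hj hjy ?_)
        rcases toIco_tri j y (top j) with ⟨h, h'⟩ | ⟨h, h'⟩ <;> linarith
  have hwno : w ∉ closedArc y (top y) := fun h => by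
    have : toIco (w - y) ≤ toIco (top y - y) := h
    linarith
  have hsd : symmDiff (↑(Dg b.good).verts : Set Torus) ↑(Dg hb'.good).verts =
      ({((x w : ℝ) : 𝕊), ((x y : ℝ) : 𝕊)} : Set 𝕊) ×ˢ ({y, top y} : Set 𝕊) := by
    ext ⟨a, c⟩
    rw [Set.mem_symmDiff, Finset.mem_coe, Finset.mem_coe, hV1, hV2]
    simp only [Set.mem_prod, Set.mem_insert_iff, Set.mem_singleton_iff]
    constructor
    · rintro (⟨⟨g1, g2 | g2⟩ | ⟨g1, g2⟩ | g1, g3⟩ | ⟨⟨g1, g2 | g2⟩ | g1, g3⟩)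
      · exact absurd (Or.inl ⟨g1, Or.inl g2⟩) g3
      · exact ⟨Or.inl g1, Or.inl g2⟩
      · exact ⟨Or.inr g1, g2⟩
      · exact absurd (Or.inr g1) g3
      · exact absurd (Or.inl ⟨g1, Or.inl g2⟩) g3
      · exact ⟨Or.inl g1, Or.inr g2⟩
      · exact absurd (Or.inr (Or.inr g1)) g3
    · rintro ⟨rfl | rfl, rfl | rfl⟩
      · refine Or.inl ⟨Or.inl ⟨rfl, Or.inr rfl⟩, ?_⟩
        rintro (⟨-, h | h⟩ | ⟨j, hj, hjy, hjw, h, -⟩)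
        · exact hwney h.symm
        · exact htyy h.symm
        · exact (hxj j hj hjy hjw).2 h.symm
      · refine Or.inr ⟨Or.inl ⟨rfl, Or.inr rfl⟩, ?_⟩
        rintro (⟨-, h | h⟩ | ⟨h, -⟩ | ⟨j, hj, hjy, hjw, h, -⟩)
        · exact h1 h
        · exact htyy h
        · exact hxne h
        · exact (hxj j hj hjy hjw).2 h.symm
      · refine Or.inl ⟨Or.inr (Or.inl ⟨rfl, Or.inl rfl⟩), ?_⟩
        rintro (⟨h, -⟩ | ⟨j, hj, hjy, hjw, h, -⟩)
        · exact hxne h.symm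
        · exact (hxj j hj hjy hjw).1 h.symm
      · refine Or.inl ⟨Or.inr (Or.inl ⟨rfl, Or.inr rfl⟩), ?_⟩
        rintro (⟨h, -⟩ | ⟨j, hj, hjy, hjw, h, -⟩)
        · exact hxne h.symm
        · exact (hxj j hj hjy hjw).1 h.symm
  refine ⟨hxne, htyy.symm, hsd, ?_, ⟨{(((x w : ℝ) : 𝕊), y), (((x y : ℝ) : 𝕊), y),
    (((x y : ℝ) : 𝕊), top y)}, ?_, ?_, ?_⟩, ?_⟩
  · apply Set.Subset.antisymm
    · rintro ⟨a, c⟩ ⟨⟨ha, hc⟩, hV⟩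
      simp only at ha hc
      have hno' : ¬ ∃ j ∈ Z, j ≠ y ∧ j ≠ w ∧ a = ((x j : ℝ) : 𝕊) ∧ (c = j ∨ c = top j) := by
        rintro ⟨j, hj, hjy, hjw, rfl, rfl | rfl⟩
        · exact hno _ hj hjy hjw (Or.inl hc) ha
        · exact hno _ hj hjy hjw (Or.inr hc) ha
      have hcw : c ≠ w := fun h => hwno (h ▸ hc)
      rw [hsd]
      simp only [Set.mem_prod, Set.mem_insert_iff, Set.mem_singleton_iff]
      rcases hV with hV | hV
      · rcases (hV1 a c).1 hV with ⟨g1, g2 | g2⟩ | ⟨g1, g2⟩ | g1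
        · exact absurd g2 hcw
        · exact ⟨Or.inl g1, Or.inl g2⟩
        · exact ⟨Or.inr g1, g2⟩
        · exact absurd g1 hno'
      · rcases (hV2 a c).1 hV with ⟨g1, g2 | g2⟩ | g1
        · exact absurd g2 hcw
        · exact ⟨Or.inl g1, Or.inr g2⟩
        · exact absurd g1 hno'
    · intro p hp
      have hp' := hp
      refine ⟨?_, ?_⟩
      · rw [hsd] at hp'
        obtain ⟨a, c⟩ := p
        obtain ⟨ha, hc⟩ := hp'
        simp only [Set.mem_insert_iff, Set.mem_singleton_iff] at ha hc
        constructor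
        · rcases ha with rfl | rfl
          · exact left_mem_closedArc _ _
          · exact right_mem_closedArc _ _
        · rcases hc with rfl | rfl
          · exact left_mem_closedArc _ _
          · exact right_mem_closedArc _ _
      · rw [Set.mem_symmDiff] at hp
        rcases hp with hp | hp
        · exact Or.inl hp.1
        · exact Or.inr hp.1
  · unfold ConsecCorners; simp only [true_or, or_true]
  · ext ⟨a, c⟩
    simp only [Set.mem_inter_iff, Finset.mem_coe, hV1, Set.mem_prod, Set.mem_insert_iff,
      Set.mem_singleton_iff, Prod.mk.injEq]
    constructor
    · rintro ⟨⟨rfl, h4⟩ | ⟨rfl, h4⟩ | ⟨j, hj, hjy, hjw, rfl, -⟩, h2, h3⟩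
      · rcases h3 with rfl | rfl
        · simp
        · rcases h4 with h4 | h4
          · exact absurd h4 h1
          · exact absurd h4 htyy
      · rcases h4 with rfl | rfl <;> simp
      · exact absurd h2 (not_or.2 ⟨(hxj j hj hjy hjw).2, (hxj j hj hjy hjw).1⟩)
    · rintro (⟨rfl, rfl⟩ | ⟨rfl, rfl⟩ | ⟨rfl, rfl⟩) <;> simp
  · rintro ⟨a, c⟩ ⟨⟨ha, hc⟩, hs⟩
    simp only [Set.mem_insert_iff, Set.mem_singleton_iff, Prod.mk.injEq] at ha hc hs
    rw [Finset.mem_coe, hV2]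
    rcases ha with rfl | rfl
    · rcases hc with rfl | rfl
      · exact absurd (Or.inl ⟨rfl, rfl⟩) hs
      · exact Or.inl ⟨rfl, Or.inr rfl⟩
    · rcases hc with rfl | rfl
      · exact absurd (Or.inr (Or.inl ⟨rfl, rfl⟩)) hs
      · exact absurd (Or.inr (Or.inr ⟨rfl, rfl⟩)) hs
  · ext ⟨a, c⟩
    simp only [Set.mem_inter_iff, Finset.mem_coe]
    constructor
    · rintro ⟨h4, h5⟩
      refine ⟨Finset.mem_union_left _ h4, ?_⟩
      rw [mem_pos_Dg] at h4 ⊢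
      refine ⟨Finset.mem_erase.2 ⟨?_, h4.1⟩, h4.2⟩
      rintro rfl
      rw [hV2] at h5
      rcases h5 with ⟨h5, -⟩ | ⟨j, hj, hjy, hjw, h5, -⟩
      · exact hxne (h5.symm.trans h4.2)
      · exact (hxj j hj hjy hjw).1 (h5.symm.trans h4.2)
    · rintro ⟨h5, h4⟩
      refine ⟨?_, Finset.mem_union_left _ h4⟩
      rw [mem_pos_Dg] at h4 ⊢
      exact ⟨Finset.mem_of_mem_erase h4.1, h4.2⟩

lemma Bd.chain (b : Bd Y Z top X x δ N) :
    ∃ top', ∃ b' : Bd Y Y top' X x δ N, EquivOfType .rII (Dg b.good) (Dg b'.good) := by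
  classical
  obtain ⟨n, hn⟩ : ∃ n, (Z \ Y).card = n := ⟨_, rfl⟩
  induction n generalizing Z top with
  | zero =>
    have : Z = Y := by
      apply Finset.Subset.antisymm _ b.sub
      rw [Finset.card_eq_zero, Finset.sdiff_eq_empty_iff_subset] at hn
      exact hn
    subst this
    exact ⟨top, b, Relation.ReflTransGen.refl⟩
  | succ n ih =>
    obtain ⟨y, hy⟩ : (Z \ Y).Nonempty := by rw [← Finset.card_pos]; omega
    have hy' := Finset.mem_sdiff.1 hy
    obtain ⟨top1, b1, hm⟩ := b.step hy'.1 hy'.2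
    obtain ⟨top2, b2, he⟩ := ih b1 (by
      rw [Finset.erase_sdiff_comm, Finset.card_erase_of_mem hy]; omega)
    exact ⟨top2, b2, Relation.ReflTransGen.head hm he⟩

/-- The chain of destabilizations ends at the diagram `R`. -/
lemma Bd.final (b : Bd Y Z top X x δ N) (R : RectDiagram) (hN : N = R.neg)
    (hP : R.pos = Y.image fun y => (((X y : ℝ) : 𝕊), y)) :
    EquivOfType .rII (Dg b.good) R := by
  classical
  obtain ⟨top', b', he⟩ := b.chain
  have hX : Good Y top' X := by
    refine ⟨b'.good.ne, b'.good.maps, b'.good.inj, b'.good.top_ne, ?_⟩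
    intro y hy z hz hyz
    have h1 : (((X y : ℝ) : 𝕊), y) ∈ R.pos := by rw [hP]; exact Finset.mem_image_of_mem _ hy
    have h2 : (((X z : ℝ) : 𝕊), z) ∈ R.pos := by
      rw [hP]; exact Finset.mem_image.2 ⟨z, hz, rfl⟩
    exact congrArg Prod.snd (R.thetaInjPos h1 h2 hyz)
  have hR : Dg hX = R := by
    apply rect_ext
    · rw [hP]; rfl
    · apply Finset.eq_of_subset_of_card_le
      · rintro ⟨a, c⟩ hp
        rw [mem_neg_Dg] at hp
        obtain ⟨y, hy, rfl, rfl⟩ := hp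
        rw [← hN]
        exact b'.neg y hy (b'.good.maps y hy)
      · have e1 : R.neg.card = R.pos.card := by
          have h1 := Finset.card_image_of_injOn R.thetaInjPos
          have h2 := Finset.card_image_of_injOn R.thetaInjNeg
          rw [← h1, ← h2, R.thetaEq]
        have e2 : (Dg hX).neg.card = (Dg hX).pos.card := by
          have h1 := Finset.card_image_of_injOn (Dg hX).thetaInjPos
          have h2 := Finset.card_image_of_injOn (Dg hX).thetaInjNeg
          rw [← h1, ← h2, (Dg hX).thetaEq]
        rw [e1, e2, hP]
        exact le_rfl
  rw [← hR]
  refine Relation.ReflTransGen.trans he (Exch.equiv (exch_path b'.good hX ?_))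
  intro i hi j hj hji hn
  have hδ := b'.hδ
  have hfar : ∀ k : ℤ, 4 * δ ≤ |X i - X j - k| := by
    have hneg : (∀ k : ℤ, 4 * δ ≤ |X j - X i - k|) → ∀ k : ℤ, 4 * δ ≤ |X i - X j - k| := by
      intro h k
      have := h (-k)
      push_cast at this
      rwa [← abs_neg, show -(X j - X i - -(k:ℝ)) = X i - X j - k by ring] at this
    rcases hn with hn | hn
    · rcases lt_or_eq_of_le (show toIco (j - i) ≤ toIco (top' i - i) from hn) with hlt | heq
      · exact b'.hA i hi j hj hji hlt
      · have hjt : j = top' i := toIco_sub_inj heq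
        rw [hjt]
        exact hjt ▸ hneg (hjt ▸ b'.hB1 i hi (b'.good.maps i hi))
    · have hle : toIco (top' j - i) ≤ toIco (top' i - i) := hn
      have hne1 : toIco (top' j - i) ≠ toIco (top' i - i) := fun h =>
        hji (b'.good.inj j hj i hi (toIco_sub_inj h))
      have hlt := lt_of_le_of_ne hle hne1
      by_cases hp : top' j = i
      · have := b'.hB1 j hj (b'.good.maps j hj)
        rwa [hp] at this
      have hpos : 0 < toIco (top' j - i) := toIco_pos (Ne.symm hp)
      by_cases hc : toIco (i - j) < toIco (top' j - j)
      · exact hneg (b'.hA j hj i hi (Ne.symm hji) hc)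
      · rw [not_lt] at hc
        have hr := toIco_rev hji
        apply b'.hA i hi j hj hji
        rcases toIco_tri j i (top' j) with ⟨h, h'⟩ | ⟨h, h'⟩ <;> linarith
  have h1 := abs_lt.1 (b'.cl i hi)
  have h2 := abs_lt.1 (b'.cl j hj)
  have f1 := hfar ⌊X i - X j⌋
  have f2 := hfar (⌊X i - X j⌋ + 1)
  have f3 := Int.floor_le (X i - X j)
  have f4 := Int.lt_floor_add_one (X i - X j)
  push_cast at f2
  rw [abs_of_nonneg (by linarith)] at f1
  rw [abs_of_nonpos (by linarith)] at f2
  refine ⟨⌊X i - X j⌋, ?_, ?_, ?_, ?_⟩ <;> linarith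

end
end

section

lemma near_cases {Z : Finset 𝕊} {top : 𝕊 → 𝕊} (hinj : ∀ y ∈ Z, ∀ z ∈ Z, top y = top z → y = z)
    {i j : 𝕊} (hi : i ∈ Z) (hj : j ∈ Z) (hji : j ≠ i) (hn : Near top i j) :
    toIco (j - i) < toIco (top i - i) ∨ toIco (i - j) < toIco (top j - j) ∨ j = top i ∨ i = top j := by
  rcases hn with hn | hn
  · rcases lt_or_eq_of_le (show toIco (j - i) ≤ toIco (top i - i) from hn) with hlt | heq
    · exact Or.inl hlt
    · exact Or.inr (Or.inr (Or.inl (toIco_sub_inj heq)))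
  · have hle : toIco (top j - i) ≤ toIco (top i - i) := hn
    have hne1 : toIco (top j - i) ≠ toIco (top i - i) := fun h =>
      hji (hinj j hj i hi (toIco_sub_inj h))
    have hlt := lt_of_le_of_ne hle hne1
    by_cases hp : top j = i
    · exact Or.inr (Or.inr (Or.inr hp.symm))
    have hpos : 0 < toIco (top j - i) := toIco_pos (Ne.symm hp)
    by_cases hc : toIco (i - j) < toIco (top j - j)
    · exact Or.inr (Or.inl hc)
    · rw [not_lt] at hc
      have hr := toIco_rev hji
      left
      rcases toIco_tri j i (top j) with ⟨h, h'⟩ | ⟨h, h'⟩ <;> linarith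

lemma exists_good_between' {Z : Finset 𝕊} {top : 𝕊 → 𝕊} {x x' : 𝕊 → ℝ}
    (ne : Z.Nonempty) (maps : ∀ y ∈ Z, top y ∈ Z)
    (inj : ∀ y ∈ Z, ∀ z ∈ Z, top y = top z → y = z) (top_ne : ∀ y ∈ Z, top y ≠ y)
    (hx : ∀ i ∈ Z, ∀ j ∈ Z, i ≠ j → ∀ k : ℤ, x i - x j = k → x' i - x' j ≠ k)
    {t s : ℝ} (hts : t < s) :
    ∃ r ∈ Ioo t s, Good Z top (fun i => x i + r * (x' i - x i)) := by
  classical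
  have hcount : (⋃ p ∈ (Z ×ˢ Z).filter (fun p => p.1 ≠ p.2),
      {t : ℝ | ∃ k : ℤ, (x p.1 - x p.2) + t * ((x' p.1 - x p.1) - (x' p.2 - x p.2)) = k}).Countable := by
    refine Set.Countable.biUnion (Finset.countable_toSet _) ?_
    rintro ⟨i, j⟩ hij
    simp only [Finset.coe_filter, Finset.mem_product, Set.mem_ofPred_eq] at hij
    apply affine_countable
    intro h0 k hk
    simp only at hk h0
    exact hx i hij.1.1 j hij.1.2 hij.2 k hk (by linarith)
  obtain ⟨r, hr, hr'⟩ := (hcount.dense_compl ℝ).exists_between hts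
  refine ⟨r, hr', ne, maps, inj, top_ne, ?_⟩
  intro y hy z hz hyz
  by_contra hne
  apply hr
  simp only [Set.mem_iUnion]
  refine ⟨(y, z), by simp [hy, hz, hne], ?_⟩
  obtain ⟨k, hk⟩ := coe_eq_iff.1 hyz
  exact ⟨k, by simp only; linarith⟩

/-- Merged data of two diagrams. -/
structure Merged (R R' : RectDiagram) (Y Y' : Finset 𝕊) (top : 𝕊 → 𝕊) (X X' : 𝕊 → ℝ) : Prop where
  ne : (Y ∪ Y').Nonempty
  maps : ∀ y ∈ Y ∪ Y', top y ∈ Y ∪ Y'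
  inj : ∀ y ∈ Y ∪ Y', ∀ z ∈ Y ∪ Y', top y = top z → y = z
  top_ne : ∀ y ∈ Y ∪ Y', top y ≠ y
  hA : ∀ y ∈ Y ∪ Y', ∀ z ∈ Y ∪ Y', z ≠ y → toIco (z - y) < toIco (top y - y) →
    ∃ k : ℤ, (k : ℝ) < X y - X z ∧ X y - X z < k + 1 ∧ (k : ℝ) < X' y - X' z ∧ X' y - X' z < k + 1
  hB : ∀ y ∈ Y ∪ Y', ∃ k : ℤ,
    ((top y ∈ Y ∧ (k : ℝ) < X (top y) - X y ∧ X (top y) - X y < k + 1) ∨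
      (top y ∉ Y ∧ X (top y) - X y = k)) ∧
    ((top y ∈ Y' ∧ (k : ℝ) < X' (top y) - X' y ∧ X' (top y) - X' y < k + 1) ∨
      (top y ∉ Y' ∧ X' (top y) - X' y = k))
  g : ∃ g : 𝕊 → ℝ, ∀ y ∈ Y ∪ Y', top y ∉ Y → g (top y) < g y
  g' : ∃ g : 𝕊 → ℝ, ∀ y ∈ Y ∪ Y', top y ∉ Y' → g (top y) < g y
  pos : R.pos = Y.image fun y => (((X y : ℝ) : 𝕊), y)
  pos' : R'.pos = Y'.image fun y => (((X' y : ℝ) : 𝕊), y)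
  neg : ∀ y ∈ Y ∪ Y', top y ∈ Y → (((X y : ℝ) : 𝕊), top y) ∈ R.neg
  neg' : ∀ y ∈ Y ∪ Y', top y ∈ Y' → (((X' y : ℝ) : 𝕊), top y) ∈ R'.neg

section
variable {R R' : RectDiagram} {Y Y' : Finset 𝕊} {top : 𝕊 → 𝕊} {X X' : 𝕊 → ℝ}

lemma Merged.symm (m : Merged R R' Y Y' top X X') : Merged R' R Y' Y top X' X := by
  have e : Y' ∪ Y = Y ∪ Y' := Finset.union_comm _ _
  refine ⟨?_, ?_, ?_, ?_, ?_, ?_, ?_, ?_, m.pos', m.pos, ?_, ?_⟩ <;> rw [e]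
  · exact m.ne
  · exact m.maps
  · exact m.inj
  · exact m.top_ne
  · intro y hy z hz h1 h2
    obtain ⟨k, h3, h4, h5, h6⟩ := m.hA y hy z hz h1 h2
    exact ⟨k, h5, h6, h3, h4⟩
  · intro y hy
    obtain ⟨k, h3, h4⟩ := m.hB y hy
    exact ⟨k, h4, h3⟩
  · exact m.g'
  · exact m.g
  · exact m.neg'
  · exact m.neg

lemma Merged.ex_pred (m : Merged R R' Y Y' top X X') {y : 𝕊} (hy : y ∈ Y ∪ Y') :
    ∃ w ∈ Y ∪ Y', top w = y := by
  have : (Y ∪ Y').image top = Y ∪ Y' := by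
    apply Finset.eq_of_subset_of_card_le
    · intro y hy
      obtain ⟨z, hz, rfl⟩ := Finset.mem_image.1 hy
      exact m.maps z hz
    · rw [Finset.card_image_of_injOn]
      intro y hy z hz; exact m.inj y hy z hz
  rw [← this] at hy
  simpa using hy

lemma Merged.orb (m : Merged R R' Y Y' top X X') (y : 𝕊) (hy : y ∈ Y ∪ Y') :
    ∃ n : ℕ, top^[n] y ∈ Y := by
  classical
  obtain ⟨g, hg⟩ := m.g
  obtain ⟨N, hN⟩ : ∃ N, ((Y ∪ Y').filter fun z => g z < g y).card = N := ⟨_, rfl⟩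
  induction N using Nat.strong_induction_on generalizing y with
  | _ N ih =>
    by_cases ht : top y ∈ Y
    · exact ⟨1, ht⟩
    · have hlt := hg y hy ht
      obtain ⟨n, hn⟩ := ih _ (by
        rw [← hN]
        apply Finset.card_lt_card
        rw [Finset.ssubset_iff_of_subset]
        · exact ⟨top y, by simp [hlt, Finset.mem_union.1 (m.maps y hy)], by simp⟩
        · intro z hz
          simp only [Finset.mem_filter] at hz ⊢
          exact ⟨hz.1, hz.2.trans hlt⟩) (top y) (m.maps y hy) rfl
      exact ⟨n + 1, by rw [Function.iterate_succ_apply]; exact hn⟩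

lemma Merged.back (m : Merged R R' Y Y' top X X') (y : 𝕊) (hy : y ∈ Y ∪ Y') :
    ∃ w ∈ Y, Relation.ReflTransGen (fun a b => a ∈ Y ∪ Y' ∧ b = top a ∧ b ∉ Y) w y := by
  classical
  obtain ⟨g, hg⟩ := m.g
  obtain ⟨N, hN⟩ : ∃ N, ((Y ∪ Y').filter fun z => g y < g z).card = N := ⟨_, rfl⟩
  induction N using Nat.strong_induction_on generalizing y with
  | _ N ih =>
    by_cases ht : y ∈ Y
    · exact ⟨y, ht, Relation.ReflTransGen.refl⟩
    · obtain ⟨w, hw, rfl⟩ := m.ex_pred hy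
      have hlt := hg w hw ht
      obtain ⟨n, hn, hn'⟩ := ih _ (by
        rw [← hN]
        apply Finset.card_lt_card
        rw [Finset.ssubset_iff_of_subset]
        · exact ⟨w, by simp [hlt, Finset.mem_union.1 hw], by simp⟩
        · intro z hz
          simp only [Finset.mem_filter] at hz ⊢
          exact ⟨hz.1, hlt.trans hz.2⟩) w hw rfl
      exact ⟨n, hn, hn'.tail ⟨hw, rfl, ht⟩⟩

lemma Merged.eta (m : Merged R R' Y Y' top X X') {w y : 𝕊}
    (h : Relation.ReflTransGen (fun a b => a ∈ Y ∪ Y' ∧ b = top a ∧ b ∉ Y) w y) :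
    (∃ k : ℤ, X y - X w = k) ∧ (w = y ∨ X' w - X w < X' y - X y) := by
  induction h with
  | refl => exact ⟨⟨0, by simp⟩, Or.inl rfl⟩
  | tail _ h ih =>
    obtain ⟨ha, rfl, hb⟩ := h
    obtain ⟨⟨k, hk⟩, ih2⟩ := ih
    obtain ⟨l, hl, hl'⟩ := m.hB _ ha
    have hl1 := (hl.resolve_left fun h => hb h.1).2
    have hY' : top _ ∈ Y' := (Finset.mem_union.1 (m.maps _ ha)).resolve_left hb
    have hl2 := (hl'.resolve_right fun h => h.1 hY').2.1
    refine ⟨⟨k + l, by push_cast; linarith⟩, Or.inr ?_⟩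
    rcases ih2 with rfl | ih2 <;> linarith

lemma Merged.generic (m : Merged R R' Y Y' top X X') :
    ∀ i ∈ Y ∪ Y', ∀ j ∈ Y ∪ Y', i ≠ j → ∀ k : ℤ, X i - X j = k → X' i - X' j ≠ k := by
  intro i hi j hj hij k hk hk'
  obtain ⟨i0, hi0, hi1⟩ := m.back i hi
  obtain ⟨j0, hj0, hj1⟩ := m.back j hj
  obtain ⟨⟨a, ha⟩, -⟩ := m.eta hi1
  obtain ⟨⟨b, hb⟩, -⟩ := m.eta hj1
  have he : i0 = j0 := by
    have h1 : (((X i0 : ℝ) : 𝕊), i0) ∈ R.pos := by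
      rw [m.pos]; exact Finset.mem_image.2 ⟨i0, hi0, rfl⟩
    have h2 : (((X j0 : ℝ) : 𝕊), j0) ∈ R.pos := by
      rw [m.pos]; exact Finset.mem_image.2 ⟨j0, hj0, rfl⟩
    exact congrArg Prod.snd (R.thetaInjPos h1 h2 (coe_eq_iff.2 ⟨k + b - a, by push_cast; linarith⟩))
  subst he
  have hu : Relator.RightUnique (fun a b => a ∈ Y ∪ Y' ∧ b = top a ∧ b ∉ Y) := by
    rintro a b c ⟨-, rfl, -⟩ ⟨-, rfl, -⟩; rfl
  rcases Relation.ReflTransGen.total_of_right_unique hu hi1 hj1 with h | h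
  · rcases (m.eta h).2 with h | h
    · exact hij h
    · linarith
  · rcases (m.eta h).2 with h | h
    · exact hij h.symm
    · linarith

lemma Merged.margin (m : Merged R R' Y Y' top X X') : ∃ ε > 0, ∀ t, 0 < t → t < ε →
    ∀ h : Good (Y ∪ Y') top (fun i => X i + t * (X' i - X i)), EquivOfType .rII (Dg h) R := by
  classical
  set Z := Y ∪ Y' with hZ
  obtain ⟨δ1, hδ1, hm1⟩ := uniform_pos (Z ×ˢ Z) (fun p δ => p.2 ≠ p.1 →
      toIco (p.2 - p.1) < toIco (top p.1 - p.1) → ∀ k : ℤ, δ ≤ |X p.1 - X p.2 - k|)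
    (by
      rintro ⟨i, j⟩ δ δ' h hle h1 h2 k
      exact hle.trans (h h1 h2 k))
    (by
      rintro ⟨i, j⟩ hij
      rw [Finset.mem_product] at hij
      by_cases hh : j ≠ i ∧ toIco (j - i) < toIco (top i - i)
      · obtain ⟨k, h1, h2, h3, h4⟩ := m.hA i hij.1 j hij.2 hh.1 hh.2
        obtain ⟨d, hd, h5, h6⟩ := exists_margin h1 h2
        exact ⟨d, hd, fun _ _ l => far_of_between h5 h6 l⟩
      · exact ⟨1, one_pos, fun a b => absurd ⟨a, b⟩ hh⟩)
  obtain ⟨δ2, hδ2, hm2⟩ := uniform_pos Z (fun y δ => top y ∈ Y → ∀ k : ℤ, δ ≤ |X (top y) - X y - k|)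
    (by
      rintro y δ δ' h hle h1 k
      exact hle.trans (h h1 k))
    (by
      intro y hy
      obtain ⟨k, h1, -⟩ := m.hB y hy
      rcases h1 with ⟨-, h1, h2⟩ | ⟨h1, -⟩
      · obtain ⟨d, hd, h5, h6⟩ := exists_margin h1 h2
        exact ⟨d, hd, fun _ l => far_of_between h5 h6 l⟩
      · exact ⟨1, one_pos, fun a => absurd a h1⟩)
  obtain ⟨M, hM, hMb⟩ : ∃ M > 0, ∀ i ∈ Z, |X' i - X i| < M := by
    refine ⟨1 + ∑ i ∈ Z, |X' i - X i|, by positivity, fun i hi => ?_⟩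
    have := Finset.single_le_sum (f := fun i => |X' i - X i|) (fun i _ => abs_nonneg _) hi
    linarith
  obtain ⟨δ, hδ, hd1, hd2, hd3⟩ : ∃ δ > 0, 4 * δ ≤ δ1 ∧ 4 * δ ≤ δ2 ∧ δ < 1 / 8 := by
    refine ⟨min (min δ1 δ2) (1/4) / 4, ?_, ?_, ?_, ?_⟩
    · have := lt_min (lt_min hδ1 hδ2) (show (0:ℝ) < 1/4 by norm_num)
      positivity
    · have := min_le_left (min δ1 δ2) (1/4); have := min_le_left δ1 δ2; linarith
    · have := min_le_left (min δ1 δ2) (1/4); have := min_le_right δ1 δ2; linarith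
    · have := min_le_right (min δ1 δ2) (1/4); linarith
  refine ⟨δ / M, by positivity, ?_⟩
  intro t ht0 ht1 h
  have b : Bd Y Z top X (fun i => X i + t * (X' i - X i)) δ R.neg := by
    refine ⟨h, Finset.subset_union_left, hδ, hd3, ?_, ?_, ?_, m.orb, ?_, m.neg⟩
    · intro y hy z hz h1 h2 k
      exact hd1.trans (hm1 (y, z) (Finset.mem_product.2 ⟨hy, hz⟩) h1 h2 k)
    · intro y hy h1 k
      exact hd2.trans (hm2 y hy h1 k)
    · intro y hy h1
      obtain ⟨k, h2, h3⟩ := m.hB y hy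
      have h4 := (h2.resolve_left fun h => h1 h.1).2
      have hY' : top y ∈ Y' := (Finset.mem_union.1 (m.maps y hy)).resolve_left h1
      have h5 := (h3.resolve_right fun h => h.1 hY').2.1
      refine ⟨k, h4, ?_⟩
      nlinarith
    · intro y hy
      have h1 := hMb y hy
      simp only [add_sub_cancel_left]
      rw [abs_mul, abs_of_pos ht0]
      rw [lt_div_iff₀ hM] at ht1
      nlinarith [abs_nonneg (X' y - X y)]
  exact b.final R rfl m.pos

theorem Merged.equiv (m : Merged R R' Y Y' top X X') : EquivOfType .rII R R' := by
  classical
  obtain ⟨ε, hε, h1⟩ := m.margin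
  obtain ⟨ε', hε', h2⟩ := m.symm.margin
  obtain ⟨t, ⟨ht0, ht1⟩, ht⟩ := exists_good_between' m.ne m.maps m.inj m.top_ne m.generic
    (show (0:ℝ) < min ε 1 from lt_min hε one_pos)
  have hg : ∀ i ∈ Y' ∪ Y, ∀ j ∈ Y' ∪ Y, i ≠ j → ∀ k : ℤ, X' i - X' j = k → X i - X j ≠ k := m.symm.generic
  obtain ⟨s, ⟨hs0, hs1⟩, hs⟩ := exists_good_between' m.symm.ne m.symm.maps m.symm.inj m.symm.top_ne hg
    (show (0:ℝ) < min ε' 1 from lt_min hε' one_pos)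
  rw [lt_min_iff] at ht1 hs1
  have e1 := h1 t ht0 ht1.1 ht
  have e2 := h2 s hs0 hs1.1 hs
  have hs2 : Good (Y ∪ Y') top (fun i => X' i + s * (X i - X' i)) := by
    have := hs
    rwa [Finset.union_comm Y' Y] at this
  have e2' : EquivOfType .rII (Dg hs2) R' := by
    have : Dg hs2 = Dg hs := by
      apply rect_ext
      · simp only [Dg, Finset.union_comm Y' Y]
      · simp only [Dg, Finset.union_comm Y' Y]
    rw [this]
    exact e2
  have e3 : Exch (Dg ht) (Dg hs2) := by
    apply exch_path
    intro i hi j hj hji hn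
    have key : ∀ a b a' b' : ℝ, ∀ k : ℤ, (k:ℝ) ≤ a - b → a - b < k + 1 → (k:ℝ) ≤ a' - b' → a' - b' < k + 1 →
        (k < a - b ∨ k < a' - b') →
        (k:ℝ) < (a + t * (a' - a)) - (b + t * (b' - b)) ∧ (a + t * (a' - a)) - (b + t * (b' - b)) < k + 1 ∧
        (k:ℝ) < (a' + s * (a - a')) - (b' + s * (b - b')) ∧ (a' + s * (a - a')) - (b' + s * (b - b')) < k + 1 := by
      intro a b a' b' k g1 g2 g3 g4 g5
      have p1 : (0:ℝ) < 1 - t := by linarith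
      have p2 : (0:ℝ) < 1 - s := by linarith
      refine ⟨?_, ?_, ?_, ?_⟩
      · rcases g5 with g5 | g5 <;> nlinarith
      · nlinarith
      · rcases g5 with g5 | g5 <;> nlinarith
      · nlinarith
    have flip : (∃ k : ℤ, (k:ℝ) ≤ X j - X i ∧ X j - X i < k + 1 ∧ (k:ℝ) ≤ X' j - X' i ∧ X' j - X' i < k + 1 ∧
        (k < X j - X i ∨ k < X' j - X' i)) → ∃ k : ℤ,
        (k:ℝ) < (X i + t * (X' i - X i)) - (X j + t * (X' j - X j)) ∧
        (X i + t * (X' i - X i)) - (X j + t * (X' j - X j)) < k + 1 ∧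
        (k:ℝ) < (X' i + s * (X i - X' i)) - (X' j + s * (X j - X' j)) ∧
        (X' i + s * (X i - X' i)) - (X' j + s * (X j - X' j)) < k + 1 := by
      rintro ⟨k, g1, g2, g3, g4, g5⟩
      obtain ⟨q1, q2, q3, q4⟩ := key _ _ _ _ k g1 g2 g3 g4 g5
      exact ⟨-k - 1, by push_cast; linarith, by push_cast; linarith, by push_cast; linarith,
        by push_cast; linarith⟩
    have consec : ∀ y ∈ Y ∪ Y', ∃ k : ℤ, (k:ℝ) ≤ X (top y) - X y ∧ X (top y) - X y < k + 1 ∧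
        (k:ℝ) ≤ X' (top y) - X' y ∧ X' (top y) - X' y < k + 1 ∧
        (k < X (top y) - X y ∨ k < X' (top y) - X' y) := by
      intro y hy
      obtain ⟨k, g1, g2⟩ := m.hB y hy
      have hm := Finset.mem_union.1 (m.maps y hy)
      refine ⟨k, ?_⟩
      rcases g1 with ⟨-, g1, g1'⟩ | ⟨g0, g1⟩
      · rcases g2 with ⟨-, g2, g2'⟩ | ⟨-, g2⟩
        · exact ⟨g1.le, g1', g2.le, g2', Or.inl g1⟩
        · exact ⟨g1.le, g1', g2.ge, by linarith, Or.inl g1⟩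
      · rcases g2 with ⟨-, g2, g2'⟩ | ⟨g3, g2⟩
        · exact ⟨g1.ge, by linarith, g2.le, g2', Or.inr g2⟩
        · exact absurd hm (not_or.2 ⟨g0, g3⟩)
    rcases near_cases m.inj hi hj hji hn with hlt | hlt | rfl | rfl
    · obtain ⟨k, g1, g2, g3, g4⟩ := m.hA i hi j hj hji hlt
      exact ⟨k, key _ _ _ _ k g1.le g2 g3.le g4 (Or.inl g1)⟩
    · obtain ⟨k, g1, g2, g3, g4⟩ := m.hA j hj i hi (Ne.symm hji) hlt
      exact flip ⟨k, g1.le, g2, g3.le, g4, Or.inl g1⟩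
    · exact flip (consec i hi)
    · obtain ⟨k, g1, g2, g3, g4, g5⟩ := consec j hj
      exact ⟨k, key _ _ _ _ k g1 g2 g3 g4 g5⟩
  exact Relation.ReflTransGen.trans e1.symm (Relation.ReflTransGen.trans e3.equiv e2')

end
end

section


/-! ### Staircases in the plane -/

def Ke (c d : ℝ × ℝ) : Set (ℝ × ℝ) :=
  {p | (p.1 = c.1 ∧ c.2 ≤ p.2 ∧ p.2 ≤ d.2) ∨ (p.2 = d.2 ∧ c.1 ≤ p.1 ∧ p.1 ≤ d.1)}

def Cv (P : ℤ → ℝ × ℝ) : Set (ℝ × ℝ) := {p | ∃ n, p ∈ Ke (P n) (P (n + 1))}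

def Rt (P : ℤ → ℝ × ℝ) : Set (ℝ × ℝ) := {p | ∃ n, (P n).1 < p.1 ∧ p.2 < (P (n + 1)).2}

def Lt (P : ℤ → ℝ × ℝ) : Set (ℝ × ℝ) := {p | ∃ n, p.1 < (P n).1 ∧ (P n).2 < p.2}

structure Stair (P : ℤ → ℝ × ℝ) : Prop where
  x0 : ∀ n, (P n).1 < (P (n + 1)).1
  y0 : ∀ n, (P n).2 < (P (n + 1)).2
  xb : ∀ s, ∃ n, (P n).1 ≤ s ∧ s < (P (n + 1)).1
  yb : ∀ s, ∃ n, (P n).2 ≤ s ∧ s < (P (n + 1)).2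
  zb : ∀ s, ∃ n, (P n).1 + (P n).2 ≤ s ∧ s < (P (n + 1)).1 + (P (n + 1)).2

namespace Stair

variable {P : ℤ → ℝ × ℝ}

lemma xm (h : Stair P) : StrictMono fun n => (P n).1 := strictMono_int_of_lt_succ h.x0
lemma ym (h : Stair P) : StrictMono fun n => (P n).2 := strictMono_int_of_lt_succ h.y0
lemma xlt (h : Stair P) {n m : ℤ} : (P n).1 < (P m).1 ↔ n < m := h.xm.lt_iff_lt
lemma ylt (h : Stair P) {n m : ℤ} : (P n).2 < (P m).2 ↔ n < m := h.ym.lt_iff_lt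
lemma xle (h : Stair P) {n m : ℤ} : (P n).1 ≤ (P m).1 ↔ n ≤ m := h.xm.le_iff_le
lemma yle (h : Stair P) {n m : ℤ} : (P n).2 ≤ (P m).2 ↔ n ≤ m := h.ym.le_iff_le

lemma cover (h : Stair P) (p : ℝ × ℝ) : p ∈ Rt P ∨ p ∈ Cv P ∨ p ∈ Lt P := by
  obtain ⟨n, h1, h2⟩ := h.yb p.2
  rcases lt_trichotomy (P n).1 p.1 with h3 | h3 | h3
  · exact Or.inl ⟨n, h3, h2⟩
  · exact Or.inr (Or.inl ⟨n, Or.inl ⟨h3.symm, h1, h2.le⟩⟩)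
  · rcases h1.lt_or_eq with h1 | h1
    · exact Or.inr (Or.inr ⟨n, h3, h1⟩)
    · by_cases h4 : (P (n - 1)).1 ≤ p.1
      · refine Or.inr (Or.inl ⟨n - 1, Or.inr ?_⟩)
        rw [sub_add_cancel]
        exact ⟨h1.symm, h4, h3.le⟩
      · rw [not_le] at h4
        exact Or.inr (Or.inr ⟨n - 1, h4, h1 ▸ h.ylt.2 (by omega)⟩)

lemma rt_lt (h : Stair P) {p : ℝ × ℝ} (h1 : p ∈ Rt P) (h2 : p ∈ Lt P) : False := by
  obtain ⟨n, h3, h4⟩ := h1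
  obtain ⟨m, h5, h6⟩ := h2
  have := h.xlt.1 (h3.trans h5)
  have := h.ylt.1 (h6.trans h4)
  omega

lemma rt_cv (h : Stair P) {p : ℝ × ℝ} (h1 : p ∈ Rt P) (h2 : p ∈ Cv P) : False := by
  obtain ⟨n, h3, h4⟩ := h1
  obtain ⟨m, ⟨h5, h6, h7⟩ | ⟨h5, h6, h7⟩⟩ := h2
  · rw [h5] at h3
    have := h.xlt.1 h3
    have := h.ylt.1 (h6.trans_lt h4)
    omega
  · rw [h5] at h4
    have := h.ylt.1 h4
    have := h.xlt.1 (h3.trans_le h7)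
    omega

lemma lt_cv (h : Stair P) {p : ℝ × ℝ} (h1 : p ∈ Lt P) (h2 : p ∈ Cv P) : False := by
  obtain ⟨n, h3, h4⟩ := h1
  obtain ⟨m, ⟨h5, h6, h7⟩ | ⟨h5, h6, h7⟩⟩ := h2
  · rw [h5] at h3
    have := h.xlt.1 h3
    have := h.ylt.1 (h4.trans_le h7)
    omega
  · rw [h5] at h4
    have := h.ylt.1 h4
    have := h.xlt.1 (h6.trans_lt h3)
    omega

lemma isOpen_rt : IsOpen (Rt P) := by
  have : Rt P = ⋃ n, {p : ℝ × ℝ | (P n).1 < p.1 ∧ p.2 < (P (n + 1)).2} := by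
    ext p; simp [Rt]
  rw [this]
  refine isOpen_iUnion fun n => ?_
  exact (isOpen_lt continuous_const continuous_fst).inter (isOpen_lt continuous_snd continuous_const)

lemma isOpen_lt' : IsOpen (Lt P) := by
  have : Lt P = ⋃ n, {p : ℝ × ℝ | p.1 < (P n).1 ∧ (P n).2 < p.2} := by
    ext p; simp [Lt]
  rw [this]
  refine isOpen_iUnion fun n => ?_
  exact (isOpen_lt continuous_fst continuous_const).inter (isOpen_lt continuous_const continuous_snd)

lemma preconn_rt : IsPreconnected (Rt P) := by
  have : Rt P = ⋃ n, (Ioi (P n).1 ×ˢ Iio (P (n + 1)).2) := by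
    ext p; simp [Rt]
  rw [this]
  refine IsPreconnected.iUnion_of_chain (fun n => isPreconnected_Ioi.prod isPreconnected_Iio) fun n => ?_
  refine ⟨(max (P n).1 (P (n + 1)).1 + 1, min (P (n + 1)).2 (P (n + 1 + 1)).2 - 1), ?_⟩
  have e : Order.succ n = n + 1 := rfl
  rw [e]
  have := le_max_left (P n).1 (P (n + 1)).1
  have := le_max_right (P n).1 (P (n + 1)).1
  have := min_le_left (P (n + 1)).2 (P (n + 1 + 1)).2
  have := min_le_right (P (n + 1)).2 (P (n + 1 + 1)).2
  refine ⟨⟨?_, ?_⟩, ⟨?_, ?_⟩⟩ <;> simp only [mem_Ioi, mem_Iio] <;> linarith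

lemma chain (h : Stair P) {p q : ℝ × ℝ} (hp : p ∈ Cv P) (hq : q ∈ Cv P) (h1 : p.1 < q.1) : p.2 ≤ q.2 := by
  by_contra h2
  rw [not_le] at h2
  refine h.rt_cv (p := q) ?_ hq
  obtain ⟨m, ⟨h5, h6, h7⟩ | ⟨h5, h6, h7⟩⟩ := hp
  · exact ⟨m, h5 ▸ h1, by linarith⟩
  · exact ⟨m, by linarith, by linarith⟩

lemma mono (h : Stair P) {p q : ℝ × ℝ} (hp : p ∈ Cv P) (hq : q ∈ Cv P) (h1 : p.1 + p.2 ≤ q.1 + q.2) :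
    p.1 ≤ q.1 ∧ p.2 ≤ q.2 := by
  rcases lt_trichotomy p.1 q.1 with h2 | h2 | h2
  · exact ⟨h2.le, h.chain hp hq h2⟩
  · exact ⟨h2.le, by linarith⟩
  · have := h.chain hq hp h2
    exact ⟨by linarith, by linarith⟩

lemma ex_sum (h : Stair P) (s : ℝ) : ∃ p ∈ Cv P, p.1 + p.2 = s := by
  obtain ⟨n, h1, h2⟩ := h.zb s
  have := h.x0 n
  have := h.y0 n
  by_cases h3 : s ≤ (P n).1 + (P (n + 1)).2
  · exact ⟨((P n).1, s - (P n).1), ⟨n, Or.inl ⟨rfl, by simp only; linarith, by simp only; linarith⟩⟩, by simp⟩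
  · rw [not_le] at h3
    exact ⟨(s - (P (n + 1)).2, (P (n + 1)).2), ⟨n, Or.inr ⟨rfl, by simp only; linarith, by simp only; linarith⟩⟩,
      by simp⟩

lemma vert_mem (n : ℤ) {y : ℝ} (h1 : (P n).2 ≤ y) (h2 : y ≤ (P (n + 1)).2) : ((P n).1, y) ∈ Cv P :=
  ⟨n, Or.inl ⟨rfl, h1, h2⟩⟩

lemma vertex_mem (h : Stair P) (n : ℤ) : P n ∈ Cv P := ⟨n, Or.inl ⟨rfl, le_rfl, (h.y0 n).le⟩⟩

lemma ext (h : Stair P) {p q : ℝ × ℝ} (hp : p ∈ Cv P) (hq : q ∈ Cv P) (h1 : p.1 + p.2 = q.1 + q.2) : p = q := by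
  have h2 := h.mono hp hq h1.le
  have h3 := h.mono hq hp h1.ge
  exact Prod.ext (le_antisymm h2.1 h3.1) (le_antisymm h2.2 h3.2)

end Stair

/-- the parametrization of the staircase by `x + y` -/
def Ap {P : ℤ → ℝ × ℝ} (h : Stair P) (s : ℝ) : ℝ × ℝ := (h.ex_sum s).choose

lemma Ap_mem {P : ℤ → ℝ × ℝ} (h : Stair P) (s : ℝ) : Ap h s ∈ Cv P := (h.ex_sum s).choose_spec.1
lemma Ap_sum {P : ℤ → ℝ × ℝ} (h : Stair P) (s : ℝ) : (Ap h s).1 + (Ap h s).2 = s :=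
  (h.ex_sum s).choose_spec.2
lemma Ap_eq {P : ℤ → ℝ × ℝ} (h : Stair P) {s : ℝ} {p : ℝ × ℝ} (hp : p ∈ Cv P) (hs : p.1 + p.2 = s) :
    Ap h s = p := h.ext (Ap_mem h s) hp (by rw [Ap_sum, hs])

lemma Ap_continuous {P : ℤ → ℝ × ℝ} (h : Stair P) : Continuous (Ap h) := by
  have key : LipschitzWith 1 (Ap h) := by
    · refine LipschitzWith.of_dist_le_mul fun s t => ?_
      rw [NNReal.coe_one, one_mul]
      wlog hst : s ≤ t generalizing s t
      · rw [dist_comm, dist_comm s t]; exact this t s (le_of_not_ge hst)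
      have h1 := h.mono (Ap_mem h s) (Ap_mem h t) (by rw [Ap_sum, Ap_sum]; exact hst)
      have h2 := Ap_sum h s
      have h3 := Ap_sum h t
      rw [Prod.dist_eq, Real.dist_eq, Real.dist_eq, Real.dist_eq, abs_sub_comm, abs_sub_comm _ (Ap h t).2,
        abs_sub_comm s, abs_of_nonneg (by linarith), abs_of_nonneg (by linarith), abs_of_nonneg (by linarith)]
      exact max_le (by linarith) (by linarith)
  exact key.continuous

/-- two points at the same level -/
lemma Stair.level {P : ℤ → ℝ × ℝ} (h : Stair P) {p q : ℝ × ℝ} (hp : p ∈ Cv P) (hq : q ∈ Cv P)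
    (h1 : p.1 < q.1) (h2 : p.2 = q.2) : ∃ n, (P n).2 = p.2 := by
  obtain ⟨n, h3, h4⟩ := h.yb p.2
  refine ⟨n, ?_⟩
  rcases h3.lt_or_eq with h3 | h3
  · exfalso
    rcases lt_trichotomy (P n).1 p.1 with h5 | h5 | h5
    · exact h.rt_cv ⟨n, h5, h4⟩ hp
    · exact h.rt_cv (p := q) ⟨n, h5 ▸ h1, h2 ▸ h4⟩ hq
    · exact h.lt_cv ⟨n, h5, h3⟩ hp
  · exact h3

end

section


def pr (p : ℝ × ℝ) : Torus := ((p.1 : 𝕊), (p.2 : 𝕊))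

def Step (R : RectDiagram) (p q : ℝ × ℝ) : Prop :=
  pr p ∈ R.pos ∧ pr q ∈ R.pos ∧ pr (p.1, q.2) ∈ R.neg ∧ p.1 < q.1 ∧ q.1 < p.1 + 1 ∧ p.2 < q.2 ∧ q.2 < p.2 + 1

def IsStr (R : RectDiagram) (P : ℤ → ℝ × ℝ) : Prop := ∀ n, Step R (P n) (P (n + 1))

lemma lift_above {x : ℝ} {a : 𝕊} (h : (x : 𝕊) ≠ a) : ∃ x' : ℝ, x < x' ∧ x' < x + 1 ∧ (x' : 𝕊) = a := by
  refine ⟨x + toIco (a - x), ?_, ?_, ?_⟩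
  · linarith [toIco_pos h]
  · linarith [toIco_lt_one (a - x)]
  · rw [AddCircle.coe_add, coe_toIco]; abel

lemma lift_below {x : ℝ} {a : 𝕊} (h : (x : 𝕊) ≠ a) : ∃ x' : ℝ, x' < x ∧ x < x' + 1 ∧ (x' : 𝕊) = a := by
  refine ⟨x - toIco (x - a), ?_, ?_, ?_⟩
  · linarith [toIco_pos h.symm]
  · linarith [toIco_lt_one (x - a)]
  · rw [AddCircle.coe_sub, coe_toIco]; abel

lemma coe_eq_of_lt {a b : ℝ} (h : (a : 𝕊) = b) (h1 : a < b + 1) (h2 : b < a + 1) : a = b := by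
  obtain ⟨k, hk⟩ := coe_eq_iff.1 h
  have h3 : (k : ℝ) < 1 := by linarith
  have h4 : (-1 : ℝ) < k := by linarith
  have h5 : k < 1 := by exact_mod_cast h3
  have h6 : -1 < k := by exact_mod_cast h4
  have : k = 0 := by omega
  simp [hk, this]

namespace RectDiagram
variable (R : RectDiagram)

lemma pos_th {a b c : 𝕊} (h1 : (a, b) ∈ R.pos) (h2 : (a, c) ∈ R.pos) : b = c :=
  congrArg Prod.snd (R.thetaInjPos (x₁ := (a, b)) (x₂ := (a, c)) h1 h2 rfl)
lemma neg_th {a b c : 𝕊} (h1 : (a, b) ∈ R.neg) (h2 : (a, c) ∈ R.neg) : b = c :=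
  congrArg Prod.snd (R.thetaInjNeg (x₁ := (a, b)) (x₂ := (a, c)) h1 h2 rfl)
lemma pos_ph {a b c : 𝕊} (h1 : (a, c) ∈ R.pos) (h2 : (b, c) ∈ R.pos) : a = b :=
  congrArg Prod.fst (R.phiInjPos (x₁ := (a, c)) (x₂ := (b, c)) h1 h2 rfl)
lemma neg_ph {a b c : 𝕊} (h1 : (a, c) ∈ R.neg) (h2 : (b, c) ∈ R.neg) : a = b :=
  congrArg Prod.fst (R.phiInjNeg (x₁ := (a, c)) (x₂ := (b, c)) h1 h2 rfl)

lemma pos_neg_ne {p : Torus} (h1 : p ∈ R.pos) (h2 : p ∈ R.neg) : False :=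
  Finset.disjoint_left.1 R.disj h1 h2

lemma pos_up {a b : 𝕊} (h : (a, b) ∈ R.pos) : ∃ c, (a, c) ∈ R.neg := by
  have h1 : a ∈ R.pos.image Prod.fst := Finset.mem_image.2 ⟨_, h, rfl⟩
  rw [R.thetaEq, Finset.mem_image] at h1
  obtain ⟨⟨x, y⟩, h2, rfl⟩ := h1
  exact ⟨y, h2⟩
lemma neg_down {a b : 𝕊} (h : (a, b) ∈ R.neg) : ∃ c, (a, c) ∈ R.pos := by
  have h1 : a ∈ R.neg.image Prod.fst := Finset.mem_image.2 ⟨_, h, rfl⟩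
  rw [← R.thetaEq, Finset.mem_image] at h1
  obtain ⟨⟨x, y⟩, h2, rfl⟩ := h1
  exact ⟨y, h2⟩
lemma pos_left {a b : 𝕊} (h : (a, b) ∈ R.pos) : ∃ c, (c, b) ∈ R.neg := by
  have h1 : b ∈ R.pos.image Prod.snd := Finset.mem_image.2 ⟨_, h, rfl⟩
  rw [R.phiEq, Finset.mem_image] at h1
  obtain ⟨⟨x, y⟩, h2, rfl⟩ := h1
  exact ⟨x, h2⟩
lemma neg_right {a b : 𝕊} (h : (a, b) ∈ R.neg) : ∃ c, (c, b) ∈ R.pos := by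
  have h1 : b ∈ R.neg.image Prod.snd := Finset.mem_image.2 ⟨_, h, rfl⟩
  rw [← R.phiEq, Finset.mem_image] at h1
  obtain ⟨⟨x, y⟩, h2, rfl⟩ := h1
  exact ⟨x, h2⟩
end RectDiagram

variable {R : RectDiagram}

lemma Step.exists_next {p : ℝ × ℝ} (h : pr p ∈ R.pos) : ∃ q, Step R p q := by
  obtain ⟨c, hc⟩ := R.pos_up h
  obtain ⟨y, h1, h2, rfl⟩ := lift_above (x := p.2) (a := c) fun e => R.pos_neg_ne h (by rw [← e] at hc; exact hc)
  obtain ⟨d, hd⟩ := R.neg_right hc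
  obtain ⟨x, h3, h4, rfl⟩ := lift_above (x := p.1) (a := d) fun e => R.pos_neg_ne hd (by rw [← e]; exact hc)
  exact ⟨(x, y), h, hd, hc, h3, h4, h1, h2⟩

lemma Step.exists_prev {q : ℝ × ℝ} (h : pr q ∈ R.pos) : ∃ p, Step R p q := by
  obtain ⟨c, hc⟩ := R.pos_left h
  obtain ⟨x, h1, h2, rfl⟩ := lift_below (x := q.1) (a := c) fun e => R.pos_neg_ne h (by rw [← e] at hc; exact hc)
  obtain ⟨d, hd⟩ := R.neg_down hc
  obtain ⟨y, h3, h4, rfl⟩ := lift_below (x := q.2) (a := d) fun e => R.pos_neg_ne hd (by rw [← e]; exact hc)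
  exact ⟨(x, y), hd, h, hc, h1, h2, h3, h4⟩

lemma Step.next_unique {p q q' : ℝ × ℝ} (h : Step R p q) (h' : Step R p q') : q = q' := by
  obtain ⟨h1, h2, h3, h4, h5, h6, h7⟩ := h
  obtain ⟨g1, g2, g3, g4, g5, g6, g7⟩ := h'
  have e2 : (q.2 : 𝕊) = q'.2 := R.neg_th h3 g3
  have e1 : (q.1 : 𝕊) = q'.1 := R.pos_ph (c := q'.2) (by rw [← e2]; exact h2) g2
  exact Prod.ext (coe_eq_of_lt e1 (by linarith) (by linarith)) (coe_eq_of_lt e2 (by linarith) (by linarith))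

lemma Step.prev_unique {p p' q : ℝ × ℝ} (h : Step R p q) (h' : Step R p' q) : p = p' := by
  obtain ⟨h1, h2, h3, h4, h5, h6, h7⟩ := h
  obtain ⟨g1, g2, g3, g4, g5, g6, g7⟩ := h'
  have e1 : (p.1 : 𝕊) = p'.1 := R.neg_ph h3 g3
  have e2 : (p.2 : 𝕊) = p'.2 := R.pos_th (a := p'.1) (by rw [← e1]; exact h1) g1
  exact Prod.ext (coe_eq_of_lt e1 (by linarith) (by linarith)) (coe_eq_of_lt e2 (by linarith) (by linarith))

lemma IsStr.unique {P Q : ℤ → ℝ × ℝ} (hP : IsStr R P) (hQ : IsStr R Q) (h : P 0 = Q 0) : P = Q := by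
  funext n
  induction n using Int.induction_on with
  | zero => exact h
  | succ n ih => exact (hP n).next_unique (ih ▸ hQ n)
  | pred n ih =>
    have h1 := hP (-(n:ℤ) - 1)
    have h2 := hQ (-(n:ℤ) - 1)
    rw [sub_add_cancel] at h1 h2
    exact h1.prev_unique (ih ▸ h2)

lemma IsStr.shift {P : ℤ → ℝ × ℝ} (hP : IsStr R P) (m : ℤ) : IsStr R fun n => P (n + m) := by
  intro n
  have := hP (n + m)
  rwa [show n + m + 1 = n + 1 + m by ring] at this

/-- equality of strands up to the shift of the index -/
def Sim (P Q : ℤ → ℝ × ℝ) : Prop := ∃ m : ℤ, ∀ n, Q n = P (n + m)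

lemma Sim.refl (P : ℤ → ℝ × ℝ) : Sim P P := ⟨0, fun n => by simp⟩
lemma Sim.symm {P Q : ℤ → ℝ × ℝ} (h : Sim P Q) : Sim Q P := by
  obtain ⟨m, h⟩ := h
  exact ⟨-m, fun n => by rw [h]; congr 1; ring⟩
lemma Sim.trans {P Q S : ℤ → ℝ × ℝ} (h : Sim P Q) (h' : Sim Q S) : Sim P S := by
  obtain ⟨m, h⟩ := h
  obtain ⟨l, h'⟩ := h'
  exact ⟨l + m, fun n => by rw [h', h]; congr 1; ring⟩
lemma Sim.shift (P : ℤ → ℝ × ℝ) (m : ℤ) : Sim P fun n => P (n + m) := ⟨m, fun _ => rfl⟩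

lemma Sim.cv {P Q : ℤ → ℝ × ℝ} (h : Sim P Q) : Cv P = Cv Q := by
  have key : ∀ P Q : ℤ → ℝ × ℝ, Sim P Q → Cv Q ⊆ Cv P := by
    rintro P Q ⟨m, h⟩ p ⟨n, hn⟩
    rw [h, h, show n + 1 + m = n + m + 1 by ring] at hn
    exact ⟨n + m, hn⟩
  exact Subset.antisymm (key _ _ h.symm) (key _ _ h)

lemma IsStr.sim {P Q : ℤ → ℝ × ℝ} (hP : IsStr R P) (hQ : IsStr R Q) {n m : ℤ} (h : P n = Q m) : Sim P Q := by
  have := IsStr.unique (hP.shift n) (hQ.shift m) (by simpa using h)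
  exact (Sim.shift P n).trans (this ▸ (Sim.shift Q m).symm)

lemma exists_str {p : ℝ × ℝ} (h : pr p ∈ R.pos) : ∃ P, IsStr R P ∧ P 0 = p := by
  let T := {p : ℝ × ℝ // pr p ∈ R.pos}
  choose f hf using fun p : T => Step.exists_next p.2
  let F : T → T := fun p => ⟨f p, (hf p).2.1⟩
  have hb : Function.Bijective F := by
    constructor
    · intro p q e
      have e' : f p = f q := congrArg Subtype.val e
      exact Subtype.ext ((hf p).prev_unique (e' ▸ hf q))
    · intro q
      obtain ⟨p, hp⟩ := Step.exists_prev q.2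
      exact ⟨⟨p, hp.1⟩, Subtype.ext ((hf ⟨p, hp.1⟩).next_unique hp)⟩
  let e : Equiv.Perm T := Equiv.ofBijective F hb
  refine ⟨fun n => ((e ^ n) ⟨p, h⟩).1, fun n => ?_, rfl⟩
  have : (e ^ (n + 1)) ⟨p, h⟩ = F ((e ^ n) ⟨p, h⟩) := by
    rw [add_comm, zpow_add, zpow_one]; rfl
  simp only [this]
  exact hf _

lemma exists_gap (G : Finset 𝕊) : ∃ δ > 0, ∀ a ∈ G, ∀ b ∈ G, a ≠ b → δ ≤ toIco (b - a) := by
  obtain ⟨δ, hδ, h⟩ := uniform_pos (G ×ˢ G) (fun p δ => p.1 ≠ p.2 → δ ≤ toIco (p.2 - p.1))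
    (fun p δ δ' h hle h1 => hle.trans (h h1))
    (fun p _ => by
      by_cases h : p.1 = p.2
      · exact ⟨1, one_pos, fun h' => absurd h h'⟩
      · exact ⟨_, toIco_pos h, fun _ => le_rfl⟩)
  exact ⟨δ, hδ, fun a ha b hb hab => h (a, b) (Finset.mem_product.2 ⟨ha, hb⟩) hab⟩

lemma bracket {z : ℤ → ℝ} {δ : ℝ} (hδ : 0 < δ) (h : ∀ n, z n + δ ≤ z (n + 1)) (s : ℝ) :
    ∃ n, z n ≤ s ∧ s < z (n + 1) := by
  have hm : StrictMono z := strictMono_int_of_lt_succ fun n => by linarith [h n]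
  have h1 : ∀ n : ℕ, z 0 + n * δ ≤ z n := by
    intro n
    induction n with
    | zero => simp
    | succ n ih => push_cast; linarith [h n]
  have h2 : ∀ n : ℕ, z (-n) ≤ z 0 - n * δ := by
    intro n
    induction n with
    | zero => simp
    | succ n ih =>
      have := h (-(n:ℤ) - 1)
      rw [sub_add_cancel] at this
      push_cast
      rw [show -((n:ℤ) + 1) = -(n:ℤ) - 1 by ring]
      linarith
  obtain ⟨N, hN⟩ := exists_nat_gt ((s - z 0) / δ)
  obtain ⟨M, hM⟩ := exists_nat_gt ((z 0 - s) / δ)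
  rw [div_lt_iff₀ hδ] at hN hM
  obtain ⟨n, hn, hn'⟩ := Int.exists_greatest_of_bdd (P := fun n => z n ≤ s)
    ⟨N, fun n hn => by
      have := h1 N
      exact (hm.lt_iff_lt.1 (show z n < z N by linarith)).le⟩ ⟨-M, by linarith [h2 M]⟩
  refine ⟨n, hn, ?_⟩
  by_contra hc
  rw [not_lt] at hc
  have := hn' _ hc
  omega

lemma IsStr.stair {P : ℤ → ℝ × ℝ} (h : IsStr R P) : Stair P := by
  obtain ⟨δ, hδ, h1⟩ := exists_gap (R.pos.image Prod.fst)
  obtain ⟨δ', hδ', h2⟩ := exists_gap (R.pos.image Prod.snd)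
  have key : ∀ {δ : ℝ} {G : Finset 𝕊} (hG : ∀ a ∈ G, ∀ b ∈ G, a ≠ b → δ ≤ toIco (b - a)) {a b : ℝ}
      (ha : (a:𝕊) ∈ G) (hb : (b:𝕊) ∈ G) (hab : a < b) (hab' : b < a + 1), a + δ ≤ b := by
    intro δ G hG a b ha hb hab hab'
    have := hG _ ha _ hb (fun e => hab.ne (coe_eq_of_lt e (by linarith) hab'))
    rw [toIco_coe_sub hab.le hab'] at this
    linarith
  have hx : ∀ n, (P n).1 + δ ≤ (P (n+1)).1 := fun n =>
    key h1 (Finset.mem_image.2 ⟨_, (h n).1, rfl⟩) (Finset.mem_image.2 ⟨_, (h n).2.1, rfl⟩) (h n).2.2.2.1 (h n).2.2.2.2.1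
  have hy : ∀ n, (P n).2 + δ' ≤ (P (n+1)).2 := fun n =>
    key h2 (Finset.mem_image.2 ⟨_, (h n).1, rfl⟩) (Finset.mem_image.2 ⟨_, (h n).2.1, rfl⟩)
      (h n).2.2.2.2.2.1 (h n).2.2.2.2.2.2
  exact ⟨fun n => (h n).2.2.2.1, fun n => (h n).2.2.2.2.2.1, bracket hδ hx, bracket hδ' hy,
    bracket (z := fun n => (P n).1 + (P n).2) (add_pos hδ hδ') fun n => by linarith [hx n, hy n]⟩

lemma mem_verts_V {p c d : ℝ × ℝ} (h : Step R c d) (h1 : p.1 = c.1) (h2 : c.2 < p.2) (h3 : p.2 < d.2) :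
    OnVertInt R (pr p) := by
  obtain ⟨g1, g2, g3, g4, g5, g6, g7⟩ := h
  refine ⟨_, _, _, g1, g3, ?_, ?_⟩
  · simp [pr, h1]
  · exact (mem_openArc_lift g6.le g7).2 ⟨0, by simpa using h2, by simpa using h3⟩

lemma mem_verts_H {p c d : ℝ × ℝ} (h : Step R c d) (h1 : p.2 = d.2) (h2 : c.1 < p.1) (h3 : p.1 < d.1) :
    OnHorizInt R (pr p) := by
  obtain ⟨g1, g2, g3, g4, g5, g6, g7⟩ := h
  refine ⟨_, _, _, g3, g2, ?_, ?_⟩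
  · simp [pr, h1]
  · exact (mem_openArc_lift g4.le g5).2 ⟨0, by simpa using h2, by simpa using h3⟩

lemma step_VV {p c d c' d' : ℝ × ℝ} (h : Step R c d) (h' : Step R c' d') (h1 : p.1 = c.1) (h2 : c.2 ≤ p.2)
    (h3 : p.2 ≤ d.2) (h1' : p.1 = c'.1) (h2' : c'.2 ≤ p.2) (h3' : p.2 ≤ d'.2) : c = c' := by
  obtain ⟨g1, g2, g3, g4, g5, g6, g7⟩ := h
  obtain ⟨k1, k2, k3, k4, k5, k6, k7⟩ := h'
  have e : c.1 = c'.1 := h1.symm.trans h1'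
  refine Prod.ext e (coe_eq_of_lt ?_ (by linarith) (by linarith))
  exact R.pos_th (a := c'.1) (by rw [← e]; exact g1) k1

lemma step_HH {p c d c' d' : ℝ × ℝ} (h : Step R c d) (h' : Step R c' d') (h1 : p.2 = d.2) (h2 : c.1 ≤ p.1)
    (h3 : p.1 ≤ d.1) (h1' : p.2 = d'.2) (h2' : c'.1 ≤ p.1) (h3' : p.1 ≤ d'.1) : d = d' := by
  obtain ⟨g1, g2, g3, g4, g5, g6, g7⟩ := h
  obtain ⟨k1, k2, k3, k4, k5, k6, k7⟩ := h'
  have e : d.2 = d'.2 := h1.symm.trans h1'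
  refine Prod.ext (coe_eq_of_lt ?_ (by linarith) (by linarith)) e
  exact R.pos_ph (c := d'.2) (by rw [← e]; exact g2) k2

/-- Distinct strands meet only over double points. -/
lemma IsStr.sep {P Q : ℤ → ℝ × ℝ} (hP : IsStr R P) (hQ : IsStr R Q) {p : ℝ × ℝ} (h1 : p ∈ Cv P) (h2 : p ∈ Cv Q)
    (hX : pr p ∉ DoublePts R) : Sim P Q := by
  have hVV : ∀ {P Q : ℤ → ℝ × ℝ} (hP : IsStr R P) (hQ : IsStr R Q) {n m : ℤ},
      (p.1 = (P n).1 ∧ (P n).2 ≤ p.2 ∧ p.2 ≤ (P (n+1)).2) →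
      (p.1 = (Q m).1 ∧ (Q m).2 ≤ p.2 ∧ p.2 ≤ (Q (m+1)).2) → Sim P Q := by
    intro P Q hP hQ n m h h'
    exact hP.sim hQ (step_VV (hP n) (hQ m) h.1 h.2.1 h.2.2 h'.1 h'.2.1 h'.2.2)
  have hHH : ∀ {P Q : ℤ → ℝ × ℝ} (hP : IsStr R P) (hQ : IsStr R Q) {n m : ℤ},
      (p.2 = (P (n+1)).2 ∧ (P n).1 ≤ p.1 ∧ p.1 ≤ (P (n+1)).1) →
      (p.2 = (Q (m+1)).2 ∧ (Q m).1 ≤ p.1 ∧ p.1 ≤ (Q (m+1)).1) → Sim P Q := by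
    intro P Q hP hQ n m h h'
    exact hP.sim hQ (step_HH (hP n) (hQ m) h.1 h.2.1 h.2.2 h'.1 h'.2.1 h'.2.2)
  have hVH : ∀ {P Q : ℤ → ℝ × ℝ} (hP : IsStr R P) (hQ : IsStr R Q) {n m : ℤ},
      (p.1 = (P n).1 ∧ (P n).2 ≤ p.2 ∧ p.2 ≤ (P (n+1)).2) →
      (p.2 = (Q (m+1)).2 ∧ (Q m).1 ≤ p.1 ∧ p.1 ≤ (Q (m+1)).1) → Sim P Q := by
    intro P Q hP hQ n m h h'
    rcases h.2.1.lt_or_eq with a1 | a1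
    swap
    · refine hHH hP hQ (n := n - 1) ?_ h'
      rw [sub_add_cancel]
      exact ⟨a1.symm, h.1 ▸ (hP.stair.xlt.2 (by omega)).le, h.1.le⟩
    rcases h.2.2.lt_or_eq with a2 | a2
    swap
    · exact hHH hP hQ (n := n) ⟨a2, h.1.ge, h.1 ▸ (hP.stair.x0 n).le⟩ h'
    rcases h'.2.1.lt_or_eq with a3 | a3
    swap
    · exact hVV hP hQ (m := m) h ⟨a3.symm, h'.1 ▸ (hQ.stair.y0 m).le, h'.1.le⟩
    rcases h'.2.2.lt_or_eq with a4 | a4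
    swap
    · exact hVV hP hQ (m := m + 1) h ⟨a4, h'.1.ge, h'.1 ▸ (hQ.stair.y0 (m+1)).le⟩
    exact absurd ⟨mem_verts_V (hP n) h.1 a1 a2, mem_verts_H (hQ m) h'.1 a3 a4⟩ hX
  obtain ⟨n, h1 | h1⟩ := h1
  · obtain ⟨m, h2 | h2⟩ := h2
    · exact hVV hP hQ h1 h2
    · exact hVH hP hQ h1 h2
  · obtain ⟨m, h2 | h2⟩ := h2
    · exact (hVH hQ hP h2 h1).symm
    · exact hHH hP hQ h1 h2

lemma pos_not_dbl {p : Torus} (h : p ∈ R.pos) : p ∉ DoublePts R := by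
  rintro ⟨⟨a, b, c, h1, h2, h3, h4⟩, -⟩
  have : p.2 = b := R.pos_th (a := p.1) h (h3 ▸ h1)
  rw [this] at h4
  have h5 := h4.1
  rw [sub_self, toIco_zero] at h5
  exact lt_irrefl _ h5

lemma IsStr.cv_eq {P Q : ℤ → ℝ × ℝ} (hP : IsStr R P) (hQ : IsStr R Q) (h : Cv P = Cv Q) : Sim P Q :=
  hP.sep hQ (hP.stair.vertex_mem 0) (h ▸ hP.stair.vertex_mem 0) (pos_not_dbl (hP 0).1)

end

section


variable {R : RectDiagram}

lemma liftV {p : ℝ × ℝ} {θ φ₁ φ₂ : 𝕊} (h1 : (θ, φ₁) ∈ R.pos) (h2 : (θ, φ₂) ∈ R.neg) (h3 : (p.1 : 𝕊) = θ) :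
    ∃ c d, Step R c d ∧ p.1 = c.1 ∧ p.2 - c.2 = toIco (p.2 - φ₁) ∧ d.2 - c.2 = toIco (φ₂ - φ₁) := by
  have ea : ((p.2 - toIco (p.2 - φ₁) : ℝ) : 𝕊) = φ₁ := by rw [AddCircle.coe_sub, coe_toIco]; abel
  have hc : pr (p.1, p.2 - toIco (p.2 - φ₁)) ∈ R.pos := by
    rw [pr, ea, h3]; exact h1
  obtain ⟨d, hd⟩ := Step.exists_next hc
  refine ⟨_, d, hd, rfl, by simp, ?_⟩
  obtain ⟨g1, g2, g3, g4, g5, g6, g7⟩ := hd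
  have e : (d.2 : 𝕊) = φ₂ := R.neg_th (a := θ) (by rw [← h3]; exact g3) h2
  have := toIco_coe_sub g6.le g7
  rw [e] at this
  simp only [ea] at this
  simp only [this]

lemma liftH {p : ℝ × ℝ} {θ₁ θ₂ φ : 𝕊} (h1 : (θ₁, φ) ∈ R.neg) (h2 : (θ₂, φ) ∈ R.pos) (h3 : (p.2 : 𝕊) = φ) :
    ∃ c d, Step R c d ∧ p.2 = d.2 ∧ p.1 - c.1 = toIco (p.1 - θ₁) ∧ d.1 - c.1 = toIco (θ₂ - θ₁) := by
  have ea : ((p.1 - toIco (p.1 - θ₁) : ℝ) : 𝕊) = θ₁ := by rw [AddCircle.coe_sub, coe_toIco]; abel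
  have eb : ((p.1 - toIco (p.1 - θ₁) + toIco (θ₂ - θ₁) : ℝ) : 𝕊) = θ₂ := by
    rw [AddCircle.coe_add, ea, coe_toIco]; abel
  have hd : pr (p.1 - toIco (p.1 - θ₁) + toIco (θ₂ - θ₁), p.2) ∈ R.pos := by
    rw [pr, eb, h3]; exact h2
  obtain ⟨c, hc⟩ := Step.exists_prev hd
  obtain ⟨g1, g2, g3, g4, g5, g6, g7⟩ := id hc
  have e : (c.1 : 𝕊) = θ₁ := R.neg_ph (c := φ) (by rw [← h3]; exact g3) h1
  have := toIco_coe_sub g4.le g5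
  simp only [eb, e] at this
  refine ⟨c, _, hc, rfl, ?_, ?_⟩
  · linarith
  · simp only; linarith

lemma dbl_V {p : ℝ × ℝ} (h : OnVertInt R (pr p)) : ∃ c d, Step R c d ∧ p.1 = c.1 ∧ c.2 < p.2 ∧ p.2 < d.2 := by
  obtain ⟨θ, a, b, h1, h2, h3, h4, h5⟩ := h
  obtain ⟨c, d, hs, g1, g2, g3⟩ := liftV (p := p) h1 h2 h3
  simp only [pr] at h4 h5
  exact ⟨c, d, hs, g1, by linarith, by linarith⟩

lemma dbl_H {p : ℝ × ℝ} (h : OnHorizInt R (pr p)) : ∃ c d, Step R c d ∧ p.2 = d.2 ∧ c.1 < p.1 ∧ p.1 < d.1 := by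
  obtain ⟨θ, a, b, h1, h2, h3, h4, h5⟩ := h
  obtain ⟨c, d, hs, g1, g2, g3⟩ := liftH (p := p) h1 h2 h3
  simp only [pr] at h4 h5
  exact ⟨c, d, hs, g1, by linarith, by linarith⟩

lemma gamma_step {p : ℝ × ℝ} (h : pr p ∈ Gamma R) : ∃ c d, Step R c d ∧ p ∈ Ke c d := by
  rcases h with ⟨θ, a, b, h1, h2, h3, h4⟩ | ⟨θ, a, b, h1, h2, h3, h4⟩
  · obtain ⟨c, d, hs, g1, g2, g3⟩ := liftV (p := p) h1 h2 h3
    simp only [pr, closedArc, mem_ofPred_eq] at h4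
    have := toIco_nonneg (p.2 - a)
    exact ⟨c, d, hs, Or.inl ⟨g1, by linarith, by linarith⟩⟩
  · obtain ⟨c, d, hs, g1, g2, g3⟩ := liftH (p := p) h1 h2 h3
    simp only [pr, closedArc, mem_ofPred_eq] at h4
    have := toIco_nonneg (p.1 - θ)
    exact ⟨c, d, hs, Or.inr ⟨g1, by linarith, by linarith⟩⟩

lemma Step.str {c d : ℝ × ℝ} (h : Step R c d) : ∃ P, IsStr R P ∧ P 0 = c ∧ P 1 = d := by
  obtain ⟨P, hP, h0⟩ := exists_str h.1
  refine ⟨P, hP, h0, ?_⟩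
  have := hP 0
  rw [h0] at this
  exact this.next_unique h

lemma Ke_sub {P : ℤ → ℝ × ℝ} : Ke (P 0) (P 1) ⊆ Cv P := fun _ h => ⟨0, h⟩

lemma gamma_lift {p : ℝ × ℝ} (h : pr p ∈ Gamma R) : ∃ P, IsStr R P ∧ p ∈ Cv P := by
  obtain ⟨c, d, hs, hp⟩ := gamma_step h
  obtain ⟨P, hP, rfl, rfl⟩ := hs.str
  exact ⟨P, hP, Ke_sub hp⟩

lemma cv_gamma {P : ℤ → ℝ × ℝ} (hP : IsStr R P) {p : ℝ × ℝ} (h : p ∈ Cv P) : pr p ∈ Gamma R := by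
  obtain ⟨n, h⟩ := h
  obtain ⟨g1, g2, g3, g4, g5, g6, g7⟩ := hP n
  rcases h with ⟨h1, h2, h3⟩ | ⟨h1, h2, h3⟩
  · refine Or.inl ⟨_, _, _, g1, g3, by simp [pr, h1], ?_⟩
    exact (mem_closedArc_lift g6.le g7).2 ⟨0, by simpa using h2, by simpa using h3⟩
  · refine Or.inr ⟨_, _, _, g3, g2, by simp [pr, h1], ?_⟩
    exact (mem_closedArc_lift g4.le g5).2 ⟨0, by simpa using h2, by simpa using h3⟩

/-- translates -/
def tr (k l : ℤ) (P : ℤ → ℝ × ℝ) : ℤ → ℝ × ℝ := fun n => ((P n).1 + k, (P n).2 + l)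

lemma pr_tr (p : ℝ × ℝ) (k l : ℤ) : pr (p.1 + k, p.2 + l) = pr p := by simp only [pr, coe_add_int]

lemma pr_eq_iff {p q : ℝ × ℝ} : pr p = pr q ↔ ∃ k l : ℤ, p = (q.1 + k, q.2 + l) := by
  constructor
  · intro h
    obtain ⟨k, hk⟩ := coe_eq_iff.1 (congrArg Prod.fst h)
    obtain ⟨l, hl⟩ := coe_eq_iff.1 (congrArg Prod.snd h)
    exact ⟨k, l, Prod.ext hk hl⟩
  · rintro ⟨k, l, rfl⟩
    exact pr_tr q k l

lemma Step.tr {c d : ℝ × ℝ} (h : Step R c d) (k l : ℤ) : Step R (c.1 + k, c.2 + l) (d.1 + k, d.2 + l) := by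
  obtain ⟨g1, g2, g3, g4, g5, g6, g7⟩ := h
  refine ⟨by rwa [pr_tr], by rwa [pr_tr], ?_, by simp only; linarith, by simp only; linarith,
    by simp only; linarith, by simp only; linarith⟩
  exact (pr_tr (c.1, d.2) k l).symm ▸ g3

lemma IsStr.tr {P : ℤ → ℝ × ℝ} (hP : IsStr R P) (k l : ℤ) : IsStr R (tr k l P) := fun n => (hP n).tr k l

lemma mem_cv_tr {P : ℤ → ℝ × ℝ} {k l : ℤ} {p : ℝ × ℝ} : (p.1 + k, p.2 + l) ∈ Cv (tr k l P) ↔ p ∈ Cv P := by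
  simp [Cv, tr, Ke]

lemma Sim.tr {P Q : ℤ → ℝ × ℝ} (h : Sim P Q) (k l : ℤ) : Sim (tr k l P) (tr k l Q) := by
  obtain ⟨m, h⟩ := h
  exact ⟨m, fun n => by simp only [_root_.tr, h]⟩

/-- local finiteness -/
lemma finite_lift (G : Finset 𝕊) (a b : ℝ) : {x : ℝ | (x : 𝕊) ∈ G ∧ a ≤ x ∧ x ≤ b}.Finite := by
  have : {x : ℝ | (x : 𝕊) ∈ G ∧ a ≤ x ∧ x ≤ b} ⊆
      ⋃ g ∈ G, (fun k : ℤ => toIco g + k) '' Icc ⌊a - 1⌋ ⌈b⌉ := by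
    rintro x ⟨h1, h2, h3⟩
    refine mem_biUnion h1 ?_
    obtain ⟨k, hk⟩ := coe_eq_iff.1 (coe_toIco (x : 𝕊)).symm
    have := toIco_nonneg (x : 𝕊)
    have := toIco_lt_one (x : 𝕊)
    refine ⟨k, ⟨?_, ?_⟩, hk.symm⟩
    · rw [← Int.cast_le (R := ℝ)]
      linarith [Int.floor_le (a - 1)]
    · rw [← Int.cast_le (R := ℝ)]
      linarith [Int.le_ceil b]
  exact Set.Finite.subset (Finset.finite_toSet G |>.biUnion fun g _ => (finite_Icc _ _).image _) this

lemma no_level (G : Finset 𝕊) (a : ℝ) : ∃ η > 0, ∀ t : ℝ, a < t → t ≤ a + η → (t : 𝕊) ∉ G := by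
  have hf := (finite_lift G a (a + 1)).subset (t := {x : ℝ | (x : 𝕊) ∈ G ∧ a < x ∧ x ≤ a + 1})
    (fun x hx => ⟨hx.1, hx.2.1.le, hx.2.2⟩)
  have : ∀ᶠ t in nhds a, t ∈ {x : ℝ | (x : 𝕊) ∈ G ∧ a < x ∧ x ≤ a + 1}ᶜ :=
    hf.isClosed.isOpen_compl.mem_nhds fun h => lt_irrefl _ h.2.1
  obtain ⟨ε, hε, h⟩ := Metric.eventually_nhds_iff.1 this
  refine ⟨min (ε / 2) 1, by positivity, fun t h1 h2 h3 => ?_⟩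
  have h4 := min_le_left (ε / 2) 1
  have h5 := min_le_right (ε / 2) 1
  refine h (y := t) ?_ ⟨h3, h1, by linarith⟩
  rw [Real.dist_eq, abs_of_pos (by linarith)]
  linarith

lemma dbl_level {p : Torus} (h : p ∈ DoublePts R) : p.2 ∈ R.pos.image Prod.snd := by
  obtain ⟨-, a, b, c, h1, h2, h3, -⟩ := h
  exact Finset.mem_image.2 ⟨_, h2, h3.symm⟩

lemma dbl_theta {p : Torus} (h : p ∈ DoublePts R) : p.1 ∈ R.pos.image Prod.fst := by
  obtain ⟨⟨a, b, c, h1, h2, h3, -⟩, -⟩ := h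
  exact Finset.mem_image.2 ⟨_, h1, h3.symm⟩

lemma countable_lift (G : Finset 𝕊) : {x : ℝ | (x : 𝕊) ∈ G}.Countable := by
  have : {x : ℝ | (x : 𝕊) ∈ G} ⊆ ⋃ n : ℕ, {x : ℝ | (x : 𝕊) ∈ G ∧ (-n : ℝ) ≤ x ∧ x ≤ n} := by
    intro x hx
    obtain ⟨n, hn⟩ := exists_nat_ge |x|
    exact mem_iUnion.2 ⟨n, hx, by linarith [neg_abs_le x], by linarith [le_abs_self x]⟩
  exact (countable_iUnion fun n => (finite_lift G _ _).countable).mono this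

lemma dbl_countable : {p : ℝ × ℝ | pr p ∈ DoublePts R}.Countable := by
  refine ((countable_lift (R.pos.image Prod.fst)).prod (countable_lift (R.pos.image Prod.snd))).mono ?_
  intro p hp
  exact ⟨dbl_theta hp, dbl_level hp⟩

lemma Ke_closed (c d : ℝ × ℝ) : IsClosed (Ke c d) := by
  refine IsClosed.union ?_ ?_
  · exact (isClosed_eq continuous_fst continuous_const).inter
      ((isClosed_le continuous_const continuous_snd).inter (isClosed_le continuous_snd continuous_const))
  · exact (isClosed_eq continuous_snd continuous_const).inter
      ((isClosed_le continuous_const continuous_fst).inter (isClosed_le continuous_fst continuous_const))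

lemma Ke_near {c d p : ℝ × ℝ} (h : Step R c d) (hp : p ∈ Ke c d) :
    p.1 - 1 ≤ c.1 ∧ c.1 ≤ p.1 ∧ p.2 - 1 ≤ c.2 ∧ c.2 ≤ p.2 := by
  obtain ⟨g1, g2, g3, g4, g5, g6, g7⟩ := h
  rcases hp with ⟨h1, h2, h3⟩ | ⟨h1, h2, h3⟩
  · exact ⟨by linarith, by linarith, by linarith, by linarith⟩
  · exact ⟨by linarith, by linarith, by linarith, by linarith⟩

lemma edges_locallyFinite :
    LocallyFinite fun e : {e : (ℝ × ℝ) × (ℝ × ℝ) // Step R e.1 e.2} => Ke e.1.1 e.1.2 := by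
  intro p
  refine ⟨Metric.ball p 1, Metric.ball_mem_nhds p one_pos, ?_⟩
  have hf := ((finite_lift (R.pos.image Prod.fst) (p.1 - 2) (p.1 + 1)).prod
    (finite_lift (R.pos.image Prod.snd) (p.2 - 2) (p.2 + 1)))
  refine Set.Finite.of_finite_image (f := fun e => e.1.1) (hf.subset ?_) ?_
  · rintro _ ⟨⟨⟨c, d⟩, hs⟩, ⟨q, hq, hq'⟩, rfl⟩
    have h1 := Ke_near hs hq
    rw [Metric.mem_ball, Prod.dist_eq, max_lt_iff, Real.dist_eq, Real.dist_eq, abs_lt, abs_lt] at hq'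
    simp only at *
    exact ⟨⟨Finset.mem_image.2 ⟨_, hs.1, rfl⟩, by linarith, by linarith⟩,
      ⟨Finset.mem_image.2 ⟨_, hs.1, rfl⟩, by linarith, by linarith⟩⟩
  · rintro ⟨⟨c, d⟩, hs⟩ - ⟨⟨c', d'⟩, hs'⟩ - h
    simp only at h hs hs'
    subst h
    have := hs.next_unique hs'
    subst this
    rfl

/-- Near a non-double point of a strand the lift of `Γ` is the strand. -/
lemma IsStr.local {P : ℤ → ℝ × ℝ} (hP : IsStr R P) {p : ℝ × ℝ} (hp : p ∈ Cv P) (hX : pr p ∉ DoublePts R) :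
    ∀ᶠ q in nhds p, pr q ∈ Gamma R → q ∈ Cv P := by
  have := (edges_locallyFinite (R := R)).iInter_compl_mem_nhds (fun e => Ke_closed _ _) p
  filter_upwards [this] with q hq hg
  obtain ⟨c, d, hs, hqe⟩ := gamma_step hg
  have hpe : p ∈ Ke c d := by
    by_contra hc
    have := mem_iInter₂.1 hq ⟨(c, d), hs⟩ hc
    exact this hqe
  obtain ⟨Q, hQ, rfl, rfl⟩ := hs.str
  rw [(hP.sep hQ hp (Ke_sub hpe) hX).cv]
  exact Ke_sub hqe

end

section


/-- A lift of the homeomorphism to the plane. -/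
structure LM (R R' : RectDiagram) (F : ℝ × ℝ → ℝ × ℝ) : Prop where
  cont : Continuous F
  inj : Function.Injective F
  eqv : ∀ (p : ℝ × ℝ) (k l : ℤ), F (p.1 + k, p.2 + l) = ((F p).1 + k, (F p).2 + l)
  bdd : ∃ M : ℝ, 0 < M ∧ ∀ p, |(F p).1 - p.1| ≤ M ∧ |(F p).2 - p.2| ≤ M
  gam : ∀ p, pr p ∈ Gamma R → pr (F p) ∈ Gamma R'
  surj : ∀ q, pr q ∈ Gamma R' → ∃ p, pr p ∈ Gamma R ∧ F p = q
  fix : ∀ p, pr p ∈ DoublePts R → ∀ᶠ q in nhds p, F q = q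
  dbl : DoublePts R = DoublePts R'

lemma pr_continuous : Continuous pr :=
  ((AddCircle.continuous_mk' 1).comp continuous_fst).prodMk ((AddCircle.continuous_mk' 1).comp continuous_snd)

lemma lift_coord (K : ℝ × Torus → 𝕊) (hK : Continuous K) (h0 : ∀ x, K (0, x) = 0) :
    ∃ d : Torus → ℝ, Continuous d ∧ (∀ x, (d x : 𝕊) = K (1, x)) ∧
      ∀ x, (∀ t, K (t, x) = 0) → d x = 0 := by
  let Kc : C(unitInterval × Torus, 𝕊) := ⟨fun q => K (q.1, q.2), by fun_prop⟩
  let f0 : C(Torus, ℝ) := ⟨fun _ => 0, continuous_const⟩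
  have H0 : ∀ a, Kc (0, a) = ((f0 a : ℝ) : 𝕊) := by
    intro a
    simp [Kc, f0, h0]
  let cov := AddCircle.isCoveringMap_coe (1 : ℝ)
  let D := cov.liftHomotopy Kc f0 H0
  have hD : ∀ q, ((D q : ℝ) : 𝕊) = Kc q := fun q => congrFun (cov.liftHomotopy_lifts Kc f0 H0) q
  refine ⟨fun x => D (1, x), by fun_prop, fun x => ?_, fun x hx => ?_⟩
  · rw [hD]; rfl
  · have h1 : D (1, x) = D (0, x) := by
      refine cov.const_of_comp (g := fun t => D (t, x)) (by fun_prop) ?_ 1 0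
      intro t t'
      rw [hD, hD]
      simp only [Kc, ContinuousMap.coe_mk, hx]
    change D (1, x) = 0
    rw [h1]
    exact cov.liftHomotopy_zero Kc f0 H0 x

theorem exists_LM {R R' : RectDiagram} (hX : DoublePts R = DoublePts R') {U : Set Torus} (hU : IsOpen U)
    (hXU : DoublePts R ⊆ U) (h : IsotopicRelFixed (Gamma R) (Gamma R') U) : ∃ F, LM R R' F := by
  obtain ⟨H, ⟨hc, h0⟩, hfix, himg⟩ := h
  have h0' : ∀ x, H 0 x = x := fun x => by rw [h0]; rfl
  obtain ⟨d1, c1, l1, f1⟩ := lift_coord (fun q => (H q.1 q.2).1 - q.2.1)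
    ((continuous_fst.comp hc).sub (continuous_fst.comp continuous_snd)) (fun x => by simp [h0'])
  obtain ⟨d2, c2, l2, f2⟩ := lift_coord (fun q => (H q.1 q.2).2 - q.2.2)
    ((continuous_snd.comp hc).sub (continuous_snd.comp continuous_snd)) (fun x => by simp [h0'])
  have bd : ∀ d : Torus → ℝ, Continuous d → ∃ M, ∀ x, |d x| ≤ M := by
    intro d hd
    obtain ⟨M, hM⟩ := isCompact_univ.exists_bound_of_continuousOn (f := d) hd.continuousOn
    exact ⟨M, fun x => by simpa using hM x (mem_univ x)⟩
  obtain ⟨M1, hM1⟩ := bd d1 c1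
  obtain ⟨M2, hM2⟩ := bd d2 c2
  let F : ℝ × ℝ → ℝ × ℝ := fun p => (p.1 + d1 (pr p), p.2 + d2 (pr p))
  have hF : ∀ p, pr (F p) = H 1 (pr p) := by
    intro p
    refine Prod.ext ?_ ?_
    · simp only [F, pr, AddCircle.coe_add]
      rw [l1]; simp
    · simp only [F, pr, AddCircle.coe_add]
      rw [l2]; simp
  have heqv : ∀ (p : ℝ × ℝ) (k l : ℤ), F (p.1 + k, p.2 + l) = ((F p).1 + k, (F p).2 + l) := by
    intro p k l
    simp only [F, pr_tr]
    exact Prod.ext (by simp only; ring) (by simp only; ring)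
  have hp := pr_continuous
  refine ⟨F, ⟨by fun_prop, ?_, heqv, ?_, ?_, ?_, ?_, hX⟩⟩
  · intro p q e
    have h1 : pr p = pr q := (H 1).injective (by rw [← hF, ← hF, e])
    have e1 := congrArg Prod.fst e
    have e2 := congrArg Prod.snd e
    simp only [F, h1, add_left_inj] at e1 e2
    exact Prod.ext e1 e2
  · refine ⟨max (max M1 M2) 1, by positivity, fun p => ⟨?_, ?_⟩⟩
    · simp only [F, add_sub_cancel_left]
      exact (hM1 _).trans ((le_max_left _ _).trans (le_max_left _ _))
    · simp only [F, add_sub_cancel_left]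
      exact (hM2 _).trans ((le_max_right _ _).trans (le_max_left _ _))
  · intro p hp
    rw [hF, ← himg]
    exact ⟨_, hp, rfl⟩
  · intro q hq
    rw [← himg] at hq
    obtain ⟨r, hr, hrq⟩ := hq
    obtain ⟨a, ha⟩ := exists_lift r.1
    obtain ⟨b, hb⟩ := exists_lift r.2
    have hab : pr (a, b) = r := Prod.ext ha hb
    have : pr q = pr (F (a, b)) := by rw [hF, hab, hrq]
    obtain ⟨k, l, hkl⟩ := pr_eq_iff.1 this
    refine ⟨(a + k, b + l), ?_, ?_⟩
    · rw [pr_tr (a, b), hab]; exact hr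
    · rw [heqv (a, b), hkl]
  · intro p hpX
    have : ∀ᶠ q in nhds p, pr q ∈ U := hp.continuousAt (hU.mem_nhds (hXU hpX))
    filter_upwards [this] with q hq
    have e1 := f1 (pr q) (fun t => by simp [hfix t _ hq])
    have e2 := f2 (pr q) (fun t => by simp [hfix t _ hq])
    simp [F, e1, e2]

end

section


variable {R R' : RectDiagram} {F : ℝ × ℝ → ℝ × ℝ}

structure Pair (R R' : RectDiagram) (F : ℝ × ℝ → ℝ × ℝ) (P P' : ℤ → ℝ × ℝ) : Prop where
  hP : IsStr R P
  hP' : IsStr R' P'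
  img : F '' Cv P = Cv P'
  mono : ∀ p ∈ Cv P, ∀ q ∈ Cv P, p.1 + p.2 ≤ q.1 + q.2 → (F p).1 + (F p).2 ≤ (F q).1 + (F q).2

lemma LM.fixed (L : LM R R' F) {p : ℝ × ℝ} (h : pr p ∈ DoublePts R) : F p = p := (L.fix p h).self_of_nhds

lemma LM.not_dbl (L : LM R R' F) {p : ℝ × ℝ} (h : pr p ∉ DoublePts R) : pr (F p) ∉ DoublePts R := by
  intro h1
  have := L.inj (L.fixed h1)
  rw [this] at h1
  exact h h1

lemma LM.locally (L : LM R R' F) {P : ℤ → ℝ × ℝ} (hP : IsStr R P) (s : ℝ) :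
    ∃ P', IsStr R' P' ∧ ∀ᶠ s' in nhds s, F (Ap hP.stair s') ∈ Cv P' := by
  have hA := Ap_continuous hP.stair
  by_cases hX : pr (Ap hP.stair s) ∈ DoublePts R
  · have hfix : ∀ᶠ s' in nhds s, F (Ap hP.stair s') = Ap hP.stair s' := hA.continuousAt.eventually (L.fix _ hX)
    have hX' := hX
    rw [L.dbl] at hX'
    have hsum := Ap_sum hP.stair s
    obtain ⟨n, h⟩ := Ap_mem hP.stair s
    rcases h with ⟨h1, h2, h3⟩ | ⟨h1, h2, h3⟩
    · obtain ⟨c, d, hs, g1, g2, g3⟩ := dbl_V hX.1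
      have e := step_VV (hP n) hs h1 h2 h3 g1 g2.le g3.le
      have e' := (hP n).next_unique (e ▸ hs)
      obtain ⟨c', d', hs', g1', g2', g3'⟩ := dbl_V hX'.1
      obtain ⟨P', hP', rfl, rfl⟩ := hs'.str
      refine ⟨P', hP', ?_⟩
      have i1 : ∀ᶠ s' in nhds s, max c.2 (P' 0).2 + (P n).1 < s' :=
        lt_mem_nhds (by linarith [max_lt g2 g2'])
      have i2 : ∀ᶠ s' in nhds s, s' < min d.2 (P' 1).2 + (P n).1 :=
        gt_mem_nhds (by linarith [lt_min g3 g3'])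
      filter_upwards [hfix, i1, i2] with s' k1 k2 k3
      have := le_max_left c.2 (P' 0).2
      have := le_max_right c.2 (P' 0).2
      have := min_le_left d.2 (P' 1).2
      have := min_le_right d.2 (P' 1).2
      rw [k1, Ap_eq hP.stair (p := ((P n).1, s' - (P n).1))
        (Stair.vert_mem n (by rw [e]; rw [e] at k2; linarith) (by rw [e']; linarith)) (by simp)]
      exact ⟨0, Or.inl ⟨h1.symm.trans g1', by simp only; linarith, by simp only [zero_add]; linarith⟩⟩
    · obtain ⟨c, d, hs, g1, g2, g3⟩ := dbl_H hX.2
      have e := step_HH (hP n) hs h1 h2 h3 g1 g2.le g3.le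
      have e' := (hP n).prev_unique (e ▸ hs)
      obtain ⟨c', d', hs', g1', g2', g3'⟩ := dbl_H hX'.2
      obtain ⟨P', hP', rfl, rfl⟩ := hs'.str
      refine ⟨P', hP', ?_⟩
      have i1 : ∀ᶠ s' in nhds s, max c.1 (P' 0).1 + (P (n+1)).2 < s' :=
        lt_mem_nhds (by linarith [max_lt g2 g2'])
      have i2 : ∀ᶠ s' in nhds s, s' < min d.1 (P' 1).1 + (P (n+1)).2 :=
        gt_mem_nhds (by linarith [lt_min g3 g3'])
      filter_upwards [hfix, i1, i2] with s' k1 k2 k3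
      have := le_max_left c.1 (P' 0).1
      have := le_max_right c.1 (P' 0).1
      have := min_le_left d.1 (P' 1).1
      have := min_le_right d.1 (P' 1).1
      rw [k1, Ap_eq hP.stair (p := (s' - (P (n+1)).2, (P (n+1)).2))
        ⟨n, Or.inr ⟨rfl, by rw [e']; simp only; linarith, by simp only; rw [e] at k3 ⊢; linarith⟩⟩ (by simp)]
      exact ⟨0, Or.inr ⟨h1.symm.trans g1', by simp only; linarith, by simp only [zero_add]; linarith⟩⟩
  · have h1 := L.gam _ (cv_gamma hP (Ap_mem hP.stair s))
    obtain ⟨P', hP', hm⟩ := gamma_lift h1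
    have h2 := L.not_dbl hX
    rw [L.dbl] at h2
    refine ⟨P', hP', ?_⟩
    have h3 := hP'.local hm h2
    have h4 : ∀ᶠ s' in nhds s, pr (F (Ap hP.stair s')) ∈ Gamma R' → F (Ap hP.stair s') ∈ Cv P' :=
      (L.cont.comp hA).continuousAt.eventually h3
    filter_upwards [h4] with s' h5
    exact h5 (L.gam _ (cv_gamma hP (Ap_mem hP.stair s')))

lemma LM.globally (L : LM R R' F) {P : ℤ → ℝ × ℝ} (hP : IsStr R P) :
    ∃ P', IsStr R' P' ∧ ∀ s, F (Ap hP.stair s) ∈ Cv P' := by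
  obtain ⟨P', hP', h0⟩ := L.locally hP 0
  refine ⟨P', hP', ?_⟩
  let S : Set ℝ := {s | ∀ᶠ s' in nhds s, F (Ap hP.stair s') ∈ Cv P'}
  have hAinj : Function.Injective (Ap hP.stair) := fun s t e => by rw [← Ap_sum hP.stair s, e, Ap_sum]
  have hSo : IsOpen S := by
    rw [isOpen_iff_mem_nhds]
    intro s hs
    exact eventually_eventually_nhds.2 hs
  have hSc : IsClosed S := by
    rw [← closure_subset_iff_isClosed]
    intro s hs
    obtain ⟨Q, hQ, hq⟩ := L.locally hP s
    have hq' := eventually_eventually_nhds.2 hq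
    obtain ⟨t, ht1, ht2⟩ := mem_closure_iff_nhds.1 hs _ hq'
    have hcount : {t : ℝ | pr (F (Ap hP.stair t)) ∈ DoublePts R'}.Countable :=
      (dbl_countable (R := R')).preimage (L.inj.comp hAinj)
    obtain ⟨r, hr, hr'⟩ := (hcount.dense_compl ℝ).inter_nhds_nonempty (ht1.and ht2)
    have := hP'.sep hQ hr'.2 hr'.1 hr
    change ∀ᶠ s' in nhds s, F (Ap hP.stair s') ∈ Cv P'
    rw [this.cv]
    exact hq
  have := IsClopen.eq_univ ⟨hSc, hSo⟩ ⟨0, h0⟩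
  intro s
  have hs : s ∈ S := this ▸ mem_univ s
  have hs' : ∀ᶠ s' in nhds s, F (Ap hP.stair s') ∈ Cv P' := hs
  exact hs'.self_of_nhds

theorem LM.exists_pair (L : LM R R' F) {P : ℤ → ℝ × ℝ} (hP : IsStr R P) : ∃ P', Pair R R' F P P' := by
  obtain ⟨P', hP', h⟩ := L.globally hP
  have hA := Ap_continuous hP.stair
  have hAinj : Function.Injective (Ap hP.stair) := fun s t e => by rw [← Ap_sum hP.stair s, e, Ap_sum]
  obtain ⟨M, hM0, hM⟩ := L.bdd
  let g : ℝ → ℝ := fun s => (F (Ap hP.stair s)).1 + (F (Ap hP.stair s)).2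
  have hcF := L.cont
  have hg : Continuous g := by fun_prop
  have hginj : Function.Injective g := by
    intro s t e
    exact hAinj (L.inj (hP'.stair.ext (h s) (h t) e))
  have hb : ∀ s, |g s - s| ≤ 2 * M := by
    intro s
    have h1 := hM (Ap hP.stair s)
    have h2 := Ap_sum hP.stair s
    have h3 := abs_add_le ((F (Ap hP.stair s)).1 - (Ap hP.stair s).1) ((F (Ap hP.stair s)).2 - (Ap hP.stair s).2)
    have h4 : g s - s = ((F (Ap hP.stair s)).1 - (Ap hP.stair s).1) + ((F (Ap hP.stair s)).2 - (Ap hP.stair s).2) := by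
      simp only [g]; linarith
    rw [h4]; linarith [h1.1, h1.2]
  have hmono : StrictMono g := by
    rcases hg.strictMono_of_inj hginj with h1 | h1
    · exact h1
    · exfalso
      have h2 := h1 (show (0:ℝ) < 4 * M + 1 by linarith)
      have h3 := abs_le.1 (hb 0)
      have h4 := abs_le.1 (hb (4 * M + 1))
      linarith [h3.1, h3.2, h4.1, h4.2]
  have hsurj : Function.Surjective g := by
    apply hg.surjective
    · refine Filter.tendsto_atTop_mono (f := fun s => s - 2 * M) (fun s => ?_) (Filter.tendsto_atTop_add_const_right _ _ Filter.tendsto_id)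
      linarith [(abs_le.1 (hb s)).1]
    · refine Filter.tendsto_atBot_mono (f := fun s => s + 2 * M) (g := g) (fun s => ?_) (Filter.tendsto_atBot_add_const_right _ _ Filter.tendsto_id)
      linarith [(abs_le.1 (hb s)).2]
  refine ⟨P', hP, hP', ?_, ?_⟩
  · apply Subset.antisymm
    · rintro _ ⟨p, hp, rfl⟩
      rw [← Ap_eq hP.stair hp rfl]
      exact h _
    · intro q hq
      obtain ⟨s, hs⟩ := hsurj (q.1 + q.2)
      exact ⟨_, Ap_mem hP.stair s, hP'.stair.ext (h s) hq hs⟩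
  · intro p hp q hq hpq
    have := hmono.monotone hpq
    simp only [g, Ap_eq hP.stair hp rfl, Ap_eq hP.stair hq rfl] at this
    exact this

theorem Pair.sim_right {P P' : ℤ → ℝ × ℝ} (h : Pair R R' F P P') {Q' : ℤ → ℝ × ℝ} (h' : Sim P' Q') (hQ' : IsStr R' Q') :
    Pair R R' F P Q' := ⟨h.hP, hQ', by rw [h.img, h'.cv], h.mono⟩

theorem Pair.sim_left {P P' : ℤ → ℝ × ℝ} (h : Pair R R' F P P') {Q : ℤ → ℝ × ℝ} (h' : Sim P Q) (hQ : IsStr R Q) :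
    Pair R R' F Q P' := ⟨hQ, h.hP', by rw [← h'.cv, h.img], by rw [← h'.cv]; exact h.mono⟩

theorem LM.exists_pair' (L : LM R R' F) {P' : ℤ → ℝ × ℝ} (hP' : IsStr R' P') : ∃ P, Pair R R' F P P' := by
  obtain ⟨p, hp, e⟩ := L.surj _ (cv_gamma hP' (hP'.stair.vertex_mem 0))
  obtain ⟨P, hP, hpP⟩ := gamma_lift hp
  obtain ⟨Q', h⟩ := L.exists_pair hP
  have h1 : P' 0 ∈ Cv Q' := by
    rw [← h.img]; exact ⟨p, hpP, e⟩
  exact ⟨P, h.sim_right (h.hP'.sep hP' h1 (hP'.stair.vertex_mem 0) (pos_not_dbl (hP' 0).1)) hP'⟩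

theorem Pair.uniq_right {P P' Q' : ℤ → ℝ × ℝ} (h : Pair R R' F P P') (h' : Pair R R' F P Q') : Sim P' Q' :=
  h.hP'.cv_eq h'.hP' (h.img.symm.trans h'.img)

theorem Pair.uniq_left (L : LM R R' F) {P P' Q : ℤ → ℝ × ℝ} (h : Pair R R' F P P') (h' : Pair R R' F Q P') : Sim P Q :=
  h.hP.cv_eq h'.hP (L.inj.image_injective (h.img.trans h'.img.symm))

lemma cv_tr (P : ℤ → ℝ × ℝ) (k l : ℤ) : Cv (tr k l P) = (fun p : ℝ × ℝ => (p.1 + k, p.2 + l)) '' Cv P := by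
  ext p
  constructor
  · intro h
    refine ⟨(p.1 - k, p.2 - l), ?_, by simp⟩
    rw [← mem_cv_tr (k := k) (l := l)]
    simpa using h
  · rintro ⟨q, hq, rfl⟩
    exact mem_cv_tr.2 hq

theorem Pair.tr (L : LM R R' F) {P P' : ℤ → ℝ × ℝ} (h : Pair R R' F P P') (k l : ℤ) :
    Pair R R' F (tr k l P) (tr k l P') := by
  refine ⟨h.hP.tr k l, h.hP'.tr k l, ?_, ?_⟩
  · rw [cv_tr, cv_tr, ← h.img, image_image, image_image]
    exact image_congr fun p _ => L.eqv p k l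
  · rw [cv_tr]
    rintro _ ⟨p, hp, rfl⟩ _ ⟨q, hq, rfl⟩ hpq
    simp only [L.eqv] at hpq ⊢
    linarith [h.mono p hp q hq (by linarith)]

end

section


theorem LM.rt {R R' : RectDiagram} {F : ℝ × ℝ → ℝ × ℝ} (L : LM R R' F) {P P' : ℤ → ℝ × ℝ} (h : Pair R R' F P P') {p : ℝ × ℝ} (hp : p ∈ Rt P) :
    F p ∈ Rt P' := by
  obtain ⟨M, hM0, hM⟩ := L.bdd
  have hS := h.hP.stair
  have hS' := h.hP'.stair
  have hsub : F '' Rt P ⊆ Rt P' ∪ Lt P' := by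
    rintro _ ⟨q, hq, rfl⟩
    rcases hS'.cover (F q) with h1 | h1 | h1
    · exact Or.inl h1
    · exfalso
      rw [← h.img] at h1
      obtain ⟨q', hq', e⟩ := h1
      rw [L.inj e] at hq'
      exact hS.rt_cv hq hq'
    · exact Or.inr h1
  have hne : (F '' Rt P ∩ Rt P').Nonempty := by
    obtain ⟨n, h1, h2⟩ := hS'.yb M
    obtain ⟨m, h3, h4⟩ := hS.yb 0
    refine ⟨F (max (P m).1 ((P' n).1 + M) + 1, 0), ⟨_, ⟨m, ?_, h4⟩, rfl⟩, n, ?_, ?_⟩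
    · simp only
      linarith [le_max_left (P m).1 ((P' n).1 + M)]
    · have := (abs_le.1 (hM (max (P m).1 ((P' n).1 + M) + 1, 0)).1).1
      simp only at this
      linarith [le_max_right (P m).1 ((P' n).1 + M)]
    · have := (abs_le.1 (hM (max (P m).1 ((P' n).1 + M) + 1, 0)).2).2
      simp only at this
      linarith
  exact IsPreconnected.subset_left_of_subset_union Stair.isOpen_rt Stair.isOpen_lt'
    (Set.disjoint_left.2 fun _ h1 h2 => hS'.rt_lt h1 h2) hsub hne
    (Stair.preconn_rt.image _ L.cont.continuousOn) ⟨p, hp, rfl⟩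

lemma Stair.cross {P Q : ℤ → ℝ × ℝ} (h : Stair P) (hQ : Stair Q) {b c : ℝ × ℝ} (hb : b ∈ Rt P) (hb' : b ∈ Cv Q)
    (hc : c ∈ Lt P) (hc' : c ∈ Cv Q) : ∃ z ∈ Cv P, z ∈ Cv Q ∧
      ((b.1 + b.2 ≤ z.1 + z.2 ∧ z.1 + z.2 ≤ c.1 + c.2) ∨ (c.1 + c.2 ≤ z.1 + z.2 ∧ z.1 + z.2 ≤ b.1 + b.2)) := by
  by_contra hcon
  have hpre : IsPreconnected (Ap hQ '' uIcc (b.1 + b.2) (c.1 + c.2)) :=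
    isPreconnected_uIcc.image _ (Ap_continuous hQ).continuousOn
  have hsub : Ap hQ '' uIcc (b.1 + b.2) (c.1 + c.2) ⊆ Rt P ∪ Lt P := by
    rintro _ ⟨s, hs, rfl⟩
    rcases h.cover (Ap hQ s) with h1 | h1 | h1
    · exact Or.inl h1
    · exfalso
      refine hcon ⟨_, h1, Ap_mem hQ s, ?_⟩
      rw [Ap_sum]
      exact mem_uIcc.1 hs
    · exact Or.inr h1
  have hbm : b ∈ Ap hQ '' uIcc (b.1 + b.2) (c.1 + c.2) := ⟨_, left_mem_uIcc, Ap_eq hQ hb' rfl⟩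
  have hcm : c ∈ Ap hQ '' uIcc (b.1 + b.2) (c.1 + c.2) := ⟨_, right_mem_uIcc, Ap_eq hQ hc' rfl⟩
  have := IsPreconnected.subset_left_of_subset_union Stair.isOpen_rt Stair.isOpen_lt'
    (Set.disjoint_left.2 fun _ h1 h2 => h.rt_lt h1 h2) hsub ⟨b, hbm, hb⟩ hpre hcm
  exact h.rt_lt this hc

lemma IsStr.ne_of_level {R : RectDiagram} {P Q : ℤ → ℝ × ℝ} (hP : IsStr R P) (hQ : IsStr R Q) (hPQ : ¬ Sim P Q) {φ : ℝ} {n m : ℤ}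
    (h1 : (P n).2 ≤ φ) (h2 : φ ≤ (P (n + 1)).2) (h3 : (Q m).2 ≤ φ) (h4 : φ ≤ (Q (m + 1)).2) : (P n).1 ≠ (Q m).1 := by
  intro e
  exact hPQ (hP.sim hQ (step_VV (p := ((P n).1, φ)) (hP n) (hQ m) rfl h1 h2 e h3 h4))

theorem LM.order {R R' : RectDiagram} {F : ℝ × ℝ → ℝ × ℝ} (L : LM R R' F) {P P' Q Q' : ℤ → ℝ × ℝ} (hP : Pair R R' F P P') (hQ : Pair R R' F Q Q')
    (hPQ : ¬ Sim P Q) {φ ψ : ℝ} {n m k l : ℤ}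
    (hn : (P n).2 ≤ φ) (hn' : φ < (P (n + 1)).2) (hm : (Q m).2 ≤ φ) (hm' : φ < (Q (m + 1)).2)
    (hk : (P' k).2 ≤ ψ) (hk' : ψ < (P' (k + 1)).2) (hl : (Q' l).2 ≤ ψ) (hl' : ψ < (Q' (l + 1)).2)
    (hX : ∀ x t : ℝ, min φ ψ < t → t ≤ max φ ψ → pr (x, t) ∉ DoublePts R)
    (hlt : (P n).1 < (Q m).1) : (P' k).1 < (Q' l).1 := by
  have hPQ' : ¬ Sim P' Q' := fun h => hPQ (hP.uniq_left L (hQ.sim_right h.symm hP.hP'))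
  have hne := hP.hP'.ne_of_level hQ.hP' hPQ' hk hk'.le hl hl'.le
  by_contra hcon
  have hlt' : (Q' l).1 < (P' k).1 := lt_of_le_of_ne (not_lt.1 hcon) hne.symm
  obtain ⟨η1, h1, h1'⟩ := no_level (R.pos.image Prod.snd) φ
  obtain ⟨η2, h2, h2'⟩ := no_level (R.pos.image Prod.snd) ψ
  obtain ⟨η, hη, hη'⟩ : ∃ η > 0, η < η1 ∧ η < η2 ∧ φ + η < (P (n+1)).2 ∧ φ + η < (Q (m+1)).2 ∧
      ψ + η < (P' (k+1)).2 ∧ ψ + η < (Q' (l+1)).2 := by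
    obtain ⟨η, hη, h⟩ := exists_between (show 0 < min η1 (min η2 (min ((P (n+1)).2 - φ) (min ((Q (m+1)).2 - φ)
      (min ((P' (k+1)).2 - ψ) ((Q' (l+1)).2 - ψ))))) by
        simp only [lt_min_iff]; refine ⟨h1, h2, ?_, ?_, ?_, ?_⟩ <;> linarith)
    simp only [lt_min_iff] at h
    refine ⟨η, hη, h.1, h.2.1, ?_, ?_, ?_, ?_⟩ <;> linarith [h.2.2.1, h.2.2.2.1, h.2.2.2.2.1, h.2.2.2.2.2]
  obtain ⟨g1, g2, g3, g4, g5, g6⟩ := hη'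
  have hX' : ∀ x t : ℝ, min φ ψ + η ≤ t → t ≤ max φ ψ + η → pr (x, t) ∉ DoublePts R := by
    intro x t e1 e2 hd
    rcases le_or_gt t (max φ ψ) with e3 | e3
    · exact hX x t (by linarith) e3 hd
    · have := dbl_level hd
      rcases max_choice φ ψ with e4 | e4
      · rw [e4] at e3 e2
        exact h1' t e3 (by linarith) this
      · rw [e4] at e3 e2
        exact h2' t e3 (by linarith) this
  have hbQ : ((Q m).1, φ + η) ∈ Cv Q := Stair.vert_mem m (by linarith) g4.le
  have hbP : ((Q m).1, φ + η) ∈ Rt P := ⟨n, hlt, g3⟩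
  have hFb := L.rt hP hbP
  have hFb' : F ((Q m).1, φ + η) ∈ Cv Q' := by rw [← hQ.img]; exact ⟨_, hbQ, rfl⟩
  have hcQ : ((Q' l).1, ψ + η) ∈ Cv Q' := Stair.vert_mem l (by linarith) g6.le
  have hcP : ((Q' l).1, ψ + η) ∈ Lt P' := ⟨k, hlt', by simp only; linarith⟩
  obtain ⟨z, hz1, hz2, hz⟩ := hP.hP'.stair.cross hQ.hP'.stair hFb hFb' hcP hcQ
  have hzX : pr z ∈ DoublePts R := by
    rw [L.dbl]
    by_contra hX
    exact hPQ' (hP.hP'.sep hQ.hP' hz1 hz2 hX)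
  have hzF := L.fixed hzX
  have hzQ : z ∈ Cv Q := by
    have := hz2
    rw [← hQ.img] at this
    obtain ⟨a, ha, e⟩ := this
    rwa [L.inj (e.trans hzF.symm)] at ha
  have hzb : F ((Q m).1, φ + η) ≠ z := fun e => hP.hP'.stair.rt_cv hFb (e ▸ hz1)
  have hmin : min φ ψ ≤ φ ∧ min φ ψ ≤ ψ ∧ φ ≤ max φ ψ ∧ ψ ≤ max φ ψ :=
    ⟨min_le_left _ _, min_le_right _ _, le_max_left _ _, le_max_right _ _⟩
  rcases hz with ⟨i1, i2⟩ | ⟨i1, i2⟩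
  · have j2 := (hQ.hP'.stair.mono hz2 hcQ i2).2
    have j1 : φ + η ≤ z.2 := by
      rcases le_or_gt ((Q m).1 + (φ + η)) (z.1 + z.2) with e | e
      · exact (hQ.hP.stair.mono hbQ hzQ e).2
      · have := hQ.mono z hzQ _ hbQ e.le
        rw [hzF] at this
        exact absurd (hQ.hP'.stair.ext hFb' hz2 (le_antisymm i1 this)) hzb
    simp only at j2
    exact hX' z.1 z.2 (by linarith [hmin.1]) (by linarith [hmin.2.2.2]) hzX
  · have j2 := (hQ.hP'.stair.mono hcQ hz2 i1).2
    have j1 : z.2 ≤ φ + η := by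
      rcases le_or_gt (z.1 + z.2) ((Q m).1 + (φ + η)) with e | e
      · exact (hQ.hP.stair.mono hzQ hbQ e).2
      · have := hQ.mono _ hbQ z hzQ e.le
        rw [hzF] at this
        exact absurd (hQ.hP'.stair.ext hFb' hz2 (le_antisymm this i2)) hzb
    simp only at j2
    exact hX' z.1 z.2 (by linarith [hmin.2.1]) (by linarith [hmin.2.2.1]) hzX

lemma lvl_pt {R : RectDiagram} {P : ℤ → ℝ × ℝ} (hP : IsStr R P) {n : ℤ} {x y : ℝ} (hn : (P n).2 = y) (hx : pr (x, y) ∈ DoublePts R) :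
    ∃ x' : ℝ, pr (x', y) ∈ DoublePts R ∧ ∀ᶠ t : ℝ in nhds x', (t, y) ∈ Cv P := by
  obtain ⟨c, d, hs, g1, g2, g3⟩ := dbl_H hx.2
  simp only at g1 g2 g3
  have hs' := hP (n - 1)
  rw [sub_add_cancel] at hs'
  have e1 : (d.1 : 𝕊) = ((P n).1 : ℝ) := by
    refine R.pos_ph hs.2.1 ?_
    rw [← g1, ← hn]
    exact hs'.2.1
  obtain ⟨k, hk⟩ := coe_eq_iff.1 e1
  have e2 : d = ((P n).1 + k, (P n).2 + (0:ℤ)) := Prod.ext hk (by simp [← g1, hn])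
  have e3 := hs'.tr k 0
  rw [← e2] at e3
  have e4 := hs.prev_unique e3
  rw [e4] at g2
  refine ⟨x - k, ?_, ?_⟩
  · have := pr_tr (x - k, y) k 0
    simp only [sub_add_cancel, Int.cast_zero, add_zero] at this
    rwa [← this]
  · have i1 : ∀ᶠ t in nhds (x - k), (P (n - 1)).1 < t := lt_mem_nhds (by simp only at g2; linarith)
    have i2 : ∀ᶠ t in nhds (x - k), t < (P n).1 := gt_mem_nhds (by linarith)
    filter_upwards [i1, i2] with t h1 h2
    refine ⟨n - 1, Or.inr ⟨?_, h1.le, ?_⟩⟩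
    · rw [sub_add_cancel]; exact hn.symm
    · rw [sub_add_cancel]; exact h2.le

theorem LM.jump {R R' : RectDiagram} {F : ℝ × ℝ → ℝ × ℝ} (L : LM R R' F) {P P' : ℤ → ℝ × ℝ} (hP : Pair R R' F P P') {x y : ℝ}
    (hx : pr (x, y) ∈ DoublePts R) : (∃ n, (P n).2 = y) ↔ ∃ n, (P' n).2 = y := by
  have hfix : ∀ x', pr (x', y) ∈ DoublePts R → ∀ᶠ t : ℝ in nhds x', F (t, y) = (t, y) := fun x' h =>
    (Continuous.continuousAt (f := fun t : ℝ => (t, y)) (by fun_prop)).eventually (L.fix _ h)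
  constructor
  · rintro ⟨n, hn⟩
    obtain ⟨x', h1, h2⟩ := lvl_pt hP.hP hn hx
    have h3 := h2.and (hfix x' h1)
    obtain ⟨t, ht, h4⟩ := h3.exists_gt
    have h5 := h3.self_of_nhds
    refine hP.hP'.stair.level (p := (x', y)) (q := (t, y)) ?_ ?_ ht rfl
    · rw [← hP.img]; exact ⟨_, h5⟩
    · rw [← hP.img]; exact ⟨_, h4⟩
  · rintro ⟨n, hn⟩
    obtain ⟨x', h1, h2⟩ := lvl_pt hP.hP' hn (L.dbl ▸ hx)
    rw [← L.dbl] at h1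
    have h3 := h2.and (hfix x' h1)
    obtain ⟨t, ht, h4⟩ := h3.exists_gt
    have h5 := h3.self_of_nhds
    rw [← hP.img] at h4 h5
    refine hP.hP.stair.level (p := (x', y)) (q := (t, y)) ?_ ?_ ht rfl
    · obtain ⟨⟨a, ha, e⟩, h6⟩ := h5
      rwa [L.inj (e.trans h6.symm)] at ha
    · obtain ⟨⟨a, ha, e⟩, h6⟩ := h4
      rwa [L.inj (e.trans h6.symm)] at ha

end

section


/-- every rectangular diagram is given by edge data -/
lemma exists_Dg (S : RectDiagram) : ∃ (top : 𝕊 → 𝕊) (x : 𝕊 → ℝ) (h : Good (S.pos.image Prod.snd) top x), S = Dg h := by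
  have hp : ∀ b : 𝕊, ∃ a : 𝕊, b ∈ S.pos.image Prod.snd → (a, b) ∈ S.pos := by
    intro b
    by_cases hb : b ∈ S.pos.image Prod.snd
    · obtain ⟨⟨a, b'⟩, h1, rfl⟩ := Finset.mem_image.1 hb
      exact ⟨a, fun _ => h1⟩
    · exact ⟨0, fun h => absurd h hb⟩
  choose f hf using hp
  have hq : ∀ b : 𝕊, ∃ c : 𝕊, b ∈ S.pos.image Prod.snd → (f b, c) ∈ S.neg := by
    intro b
    by_cases hb : b ∈ S.pos.image Prod.snd
    · obtain ⟨c, hc⟩ := S.pos_up (hf b hb)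
      exact ⟨c, fun _ => hc⟩
    · exact ⟨0, fun h => absurd h hb⟩
  choose g hg using hq
  have hmem : ∀ {a b : 𝕊}, (a, b) ∈ S.pos → b ∈ S.pos.image Prod.snd := fun h => Finset.mem_image.2 ⟨_, h, rfl⟩
  have hfi : ∀ y ∈ S.pos.image Prod.snd, ∀ z ∈ S.pos.image Prod.snd, f y = f z → y = z := by
    intro y hy z hz e
    have h1 := hf y hy
    rw [e] at h1
    exact S.pos_th h1 (hf z hz)
  have hG : Good (S.pos.image Prod.snd) g (fun b => toIco (f b)) := by
    refine ⟨?_, ?_, ?_, ?_, ?_⟩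
    · obtain ⟨p, hp⟩ := S.nonempty
      rcases Finset.mem_union.1 hp with hp | hp
      · exact ⟨_, hmem (a := p.1) (b := p.2) hp⟩
      · obtain ⟨c, hc⟩ := S.neg_down (a := p.1) (b := p.2) hp
        exact ⟨_, hmem hc⟩
    · intro y hy
      obtain ⟨c, hc⟩ := S.neg_right (hg y hy)
      exact hmem hc
    · intro y hy z hz e
      have h1 := hg y hy
      rw [e] at h1
      exact hfi y hy z hz (S.neg_ph h1 (hg z hz))
    · intro y hy e
      have h1 := hg y hy
      rw [e] at h1
      exact S.pos_neg_ne (hf y hy) h1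
    · intro y hy z hz e
      simp only [coe_toIco] at e
      exact hfi y hy z hz e
  refine ⟨g, fun b => toIco (f b), hG, rect_ext ?_ ?_⟩
  · ext ⟨a, b⟩
    rw [mem_pos_Dg]
    simp only [coe_toIco]
    constructor
    · intro h
      exact ⟨hmem h, S.pos_ph h (hf b (hmem h))⟩
    · rintro ⟨h1, rfl⟩
      exact hf b h1
  · ext ⟨a, b⟩
    rw [mem_neg_Dg]
    simp only [coe_toIco]
    constructor
    · intro h
      obtain ⟨c, hc⟩ := S.neg_down h
      have e := S.pos_ph hc (hf c (hmem hc))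
      refine ⟨c, hmem hc, e, ?_⟩
      rw [e] at h
      exact S.neg_th h (hg c (hmem hc))
    · rintro ⟨y, hy, rfl, rfl⟩
      exact hg y hy

/-- real numbers whose classes are far apart mod 1 -/
lemma gap_floor {G : Finset 𝕊} {δ : ℝ} (hG : ∀ a ∈ G, ∀ b ∈ G, a ≠ b → δ ≤ toIco (b - a)) {x y : ℝ}
    (hx : (x : 𝕊) ∈ G) (hy : (y : 𝕊) ∈ G) (hne : (x : 𝕊) ≠ y) : ∃ k : ℤ, k + δ ≤ x - y ∧ x - y ≤ k + 1 - δ := by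
  refine ⟨⌊x - y⌋, ?_, ?_⟩
  · have h1 := hG _ hy _ hx hne.symm
    rw [← AddCircle.coe_sub, toIco_coe] at h1
    have := Int.floor_add_fract (x - y)
    linarith
  · have h1 := hG _ hx _ hy hne
    rw [← AddCircle.coe_sub, show y - x = -(x - y) by ring, toIco_coe, Int.fract_neg] at h1
    · have := Int.floor_add_fract (x - y)
      linarith
    · intro h2
      apply hne
      rw [coe_eq_iff]
      refine ⟨⌊x - y⌋, ?_⟩
      have := Int.floor_add_fract (x - y)
      linarith

lemma gap_lt {G : Finset 𝕊} {δ : ℝ} (hG : ∀ a ∈ G, ∀ b ∈ G, a ≠ b → δ ≤ toIco (b - a)) {x y : ℝ}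
    (hδ : δ ≤ 1) (hx : (x : 𝕊) ∈ G) (hy : (y : 𝕊) ∈ G) (h1 : x < y) (h2 : y < x + δ) : False := by
  by_cases hne : (x : 𝕊) = y
  · obtain ⟨k, hk⟩ := coe_eq_iff.1 hne
    have h5 : (k : ℝ) < 0 := by linarith
    have h6 : (-1 : ℝ) < k := by linarith
    have h5' : k < 0 := by exact_mod_cast h5
    have h6' : -1 < k := by exact_mod_cast h6
    omega
  · obtain ⟨k, h3, h4⟩ := gap_floor hG hx hy hne
    have h5 : (k : ℝ) < 0 := by linarith
    have h6 : (-1 : ℝ) < k := by linarith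
    have h5' : k < 0 := by exact_mod_cast h5
    have h6' : -1 < k := by exact_mod_cast h6
    omega

theorem perturb (R : RectDiagram) {e : 𝕊 → ℝ} {δ : ℝ}
    (hG : ∀ a ∈ R.pos.image Prod.snd, ∀ b ∈ R.pos.image Prod.snd, a ≠ b → δ ≤ toIco (b - a))
    (he : ∀ b, 0 ≤ e b ∧ e b < δ) : ∃ R'', Exch R R'' ∧
      (∀ a b, (a, b) ∈ R''.pos ↔ ∃ b0, (a, b0) ∈ R.pos ∧ b = b0 + (e b0 : ℝ)) ∧
      (∀ a b, (a, b) ∈ R''.neg ↔ ∃ b0, (a, b0) ∈ R.neg ∧ b = b0 + (e b0 : ℝ)) := by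
  obtain ⟨top, x, h, hD⟩ := exists_Dg (swapR R)
  set Z := (swapR R).pos.image Prod.snd
  let x'' : 𝕊 → ℝ := fun i => x i + e (x i : ℝ)
  have hmem : ∀ i ∈ Z, (i, ((x i : ℝ) : 𝕊)) ∈ R.pos := by
    intro i hi
    rw [← mem_swap_pos, hD, mem_pos_Dg]
    exact ⟨hi, rfl⟩
  have hmem' : ∀ i ∈ Z, ((x i : ℝ) : 𝕊) ∈ R.pos.image Prod.snd := fun i hi => Finset.mem_image.2 ⟨_, hmem i hi, rfl⟩
  have key : ∀ i ∈ Z, ∀ j ∈ Z, j ≠ i → ∃ k : ℤ, (k : ℝ) < x i - x j ∧ x i - x j < k + 1 ∧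
      (k : ℝ) < x'' i - x'' j ∧ x'' i - x'' j < k + 1 := by
    intro i hi j hj hij
    obtain ⟨k, h1, h2⟩ := gap_floor hG (hmem' i hi) (hmem' j hj) (fun e => hij (h.xinj _ hj _ hi e.symm))
    have h3 := he (x i : ℝ)
    have h4 := he (x j : ℝ)
    refine ⟨k, ?_, ?_, ?_, ?_⟩ <;> (try simp only [x'']) <;> linarith [h3.1, h3.2, h4.1, h4.2]
  have h'' : Good Z top x'' := by
    refine ⟨h.ne, h.maps, h.inj, h.top_ne, ?_⟩
    intro i hi j hj hij
    by_contra hne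
    obtain ⟨k, -, -, h1, h2⟩ := key i hi j hj (Ne.symm hne)
    obtain ⟨l, hl⟩ := coe_eq_iff.1 hij
    have h3 : (k : ℝ) < l := by linarith
    have h4 : (l : ℝ) < k + 1 := by linarith
    have h3' : k < l := by exact_mod_cast h3
    have h4' : l < k + 1 := by exact_mod_cast h4
    omega
  refine ⟨swapR (Dg h''), ?_, ?_, ?_⟩
  · have := (exch_path h h'' fun i hi j hj hij _ => key i hi j hj hij).swap
    rwa [← hD, swap_swap] at this
  · intro a b
    rw [mem_swap_pos, mem_pos_Dg]
    constructor
    · rintro ⟨h1, rfl⟩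
      exact ⟨_, hmem a h1, by simp only [x'']; rw [AddCircle.coe_add]⟩
    · rintro ⟨b0, h1, rfl⟩
      rw [← mem_swap_pos, hD, mem_pos_Dg] at h1
      obtain ⟨h1, rfl⟩ := h1
      exact ⟨h1, by simp only [x'']; rw [AddCircle.coe_add]⟩
  · intro a b
    rw [mem_swap_neg, mem_neg_Dg]
    constructor
    · rintro ⟨y, hy, rfl, rfl⟩
      refine ⟨(x y : ℝ), ?_, by simp only [x'']; rw [AddCircle.coe_add]⟩
      rw [← mem_swap_neg, hD, mem_neg_Dg]
      exact ⟨y, hy, rfl, rfl⟩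
    · rintro ⟨b0, h1, rfl⟩
      rw [← mem_swap_neg, hD, mem_neg_Dg] at h1
      obtain ⟨y, hy, rfl, rfl⟩ := h1
      exact ⟨y, hy, by simp only [x'']; rw [AddCircle.coe_add], rfl⟩

end

section


structure Corr (R R' : RectDiagram) (Pr : (ℤ → ℝ × ℝ) → (ℤ → ℝ × ℝ) → Prop) : Prop where
  str : ∀ {P Q}, Pr P Q → IsStr R P
  str' : ∀ {P Q}, Pr P Q → IsStr R' Q
  ex : ∀ {P}, IsStr R P → ∃ Q, Pr P Q
  ex' : ∀ {Q}, IsStr R' Q → ∃ P, Pr P Q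
  tr : ∀ {P Q}, Pr P Q → ∀ k l, Pr (tr k l P) (tr k l Q)
  shift : ∀ {P Q}, Pr P Q → ∀ m m' : ℤ, Pr (fun n => P (n + m)) (fun n => Q (n + m'))
  uniq : ∀ {P Q P1 Q1}, Pr P Q → Pr P1 Q1 → (Sim P P1 ↔ Sim Q Q1)
  order : ∀ {P Q P1 Q1}, Pr P Q → Pr P1 Q1 → ¬ Sim P P1 → ∀ {φ : ℝ} {n m k l : ℤ},
    (P n).2 ≤ φ → φ < (P (n + 1)).2 → (P1 m).2 ≤ φ → φ < (P1 (m + 1)).2 →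
    (Q k).2 ≤ φ → φ < (Q (k + 1)).2 → (Q1 l).2 ≤ φ → φ < (Q1 (l + 1)).2 →
    (P n).1 < (P1 m).1 → (Q k).1 < (Q1 l).1
  jump : ∀ {P Q}, Pr P Q → ∀ {y : ℝ}, (y : 𝕊) ∈ R.pos.image Prod.snd → (y : 𝕊) ∈ R'.pos.image Prod.snd →
    ((∃ n, (P n).2 = y) ↔ ∃ n, (Q n).2 = y)

def pert (e : 𝕊 → ℝ) (P : ℤ → ℝ × ℝ) : ℤ → ℝ × ℝ := fun n => ((P n).1, (P n).2 + e ((P n).2 : ℝ))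

section
variable {R R' : RectDiagram} {e : 𝕊 → ℝ} {δ : ℝ}

lemma pert_str
    (hG : ∀ a ∈ R.pos.image Prod.snd, ∀ b ∈ R.pos.image Prod.snd, a ≠ b → δ ≤ toIco (b - a))
    (he : ∀ b, 0 ≤ e b ∧ e b < δ)
    (hp : ∀ a b, (a, b) ∈ R'.pos ↔ ∃ b0, (a, b0) ∈ R.pos ∧ b = b0 + (e b0 : ℝ))
    (hn : ∀ a b, (a, b) ∈ R'.neg ↔ ∃ b0, (a, b0) ∈ R.neg ∧ b = b0 + (e b0 : ℝ))
    {P : ℤ → ℝ × ℝ} (hP : IsStr R P) : IsStr R' (pert e P) := by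
  intro n
  obtain ⟨g1, g2, g3, g4, g5, g6, g7⟩ := hP n
  have m1 : (((P n).2 : ℝ) : 𝕊) ∈ R.pos.image Prod.snd := Finset.mem_image.2 ⟨_, g1, rfl⟩
  have m2 : (((P (n+1)).2 : ℝ) : 𝕊) ∈ R.pos.image Prod.snd := Finset.mem_image.2 ⟨_, g2, rfl⟩
  have hne : (((P (n+1)).2 : ℝ) : 𝕊) ≠ ((P n).2 : ℝ) := by
    intro e
    have := coe_eq_of_lt e (by linarith) (by linarith)
    linarith
  obtain ⟨k, h1, h2⟩ := gap_floor hG m2 m1 hne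
  have hk : k = 0 := by
    have := he 0
    have h5 : (k : ℝ) < 1 := by linarith
    have h6 : (-1 : ℝ) < k := by linarith
    have h5' : k < 1 := by exact_mod_cast h5
    have h6' : -1 < k := by exact_mod_cast h6
    omega
  subst hk
  have e1 := he ((P n).2 : ℝ)
  have e2 := he ((P (n+1)).2 : ℝ)
  simp only [Int.cast_zero] at h1 h2
  refine ⟨(hp _ _).2 ⟨_, g1, ?_⟩, (hp _ _).2 ⟨_, g2, ?_⟩, (hn _ _).2 ⟨_, g3, ?_⟩, g4, g5, ?_, ?_⟩
  · simp only [pert, AddCircle.coe_add]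
  · simp only [pert, AddCircle.coe_add]
  · simp only [pert, AddCircle.coe_add]
  · simp only [pert]; linarith [e1.1, e1.2, e2.1, e2.2]
  · simp only [pert]; linarith [e1.1, e1.2, e2.1, e2.2]

lemma pert_inj
    (hG : ∀ a ∈ R.pos.image Prod.snd, ∀ b ∈ R.pos.image Prod.snd, a ≠ b → δ ≤ toIco (b - a))
    (he : ∀ b, 0 ≤ e b ∧ e b < δ) (hδ : δ ≤ 1) {x y : ℝ} (hx : (x : 𝕊) ∈ R.pos.image Prod.snd)
    (hy : (y : 𝕊) ∈ R.pos.image Prod.snd) (h : x + e (x : 𝕊) = y + e (y : 𝕊)) : x = y := by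
  have e1 := he (x : 𝕊)
  have e2 := he (y : 𝕊)
  rcases lt_trichotomy x y with h1 | h1 | h1
  · exact (gap_lt hG hδ hx hy h1 (by linarith)).elim
  · exact h1
  · exact (gap_lt hG hδ hy hx h1 (by linarith)).elim

lemma IsStr.mem_snd {P : ℤ → ℝ × ℝ} (hP : IsStr R P) (n : ℤ) : (((P n).2 : ℝ) : 𝕊) ∈ R.pos.image Prod.snd :=
  Finset.mem_image.2 ⟨_, (hP n).1, rfl⟩

lemma pert_sim
    (hG : ∀ a ∈ R.pos.image Prod.snd, ∀ b ∈ R.pos.image Prod.snd, a ≠ b → δ ≤ toIco (b - a))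
    (he : ∀ b, 0 ≤ e b ∧ e b < δ) (hδ : δ ≤ 1) {P Q : ℤ → ℝ × ℝ} (hP : IsStr R P) (hQ : IsStr R Q) :
    Sim P Q ↔ Sim (pert e P) (pert e Q) := by
  constructor
  · rintro ⟨m, h⟩
    exact ⟨m, fun n => by simp only [pert, h]⟩
  · rintro ⟨m, h⟩
    have h0 : ∀ n, (Q n).1 = (P (n + m)).1 := fun n => (congrArg Prod.fst (h n) : (pert e Q n).1 = _)
    refine ⟨m, fun n => Prod.ext (h0 n) ?_⟩
    exact pert_inj hG he hδ (hQ.mem_snd n) (hP.mem_snd _) (congrArg Prod.snd (h n))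

end

theorem LM.exists_corr {R R' : RectDiagram} {F : ℝ × ℝ → ℝ × ℝ} (L : LM R R' F) :
    ∃ R'' Pr, Exch R' R'' ∧ Corr R R'' Pr := by
  classical
  obtain ⟨δ', hδ', hG'⟩ := exists_gap (R.pos.image Prod.snd ∪ R'.pos.image Prod.snd)
  obtain ⟨δ, hδ0, hδ1, hGu⟩ : ∃ δ > 0, δ ≤ 1 ∧ ∀ a ∈ R.pos.image Prod.snd ∪ R'.pos.image Prod.snd,
      ∀ b ∈ R.pos.image Prod.snd ∪ R'.pos.image Prod.snd, a ≠ b → δ ≤ toIco (b - a) :=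
    ⟨min δ' 1, lt_min hδ' one_pos, min_le_right _ _, fun a ha b hb hab =>
      (min_le_left _ _).trans (hG' a ha b hb hab)⟩
  have hG : ∀ a ∈ R'.pos.image Prod.snd, ∀ b ∈ R'.pos.image Prod.snd, a ≠ b → δ ≤ toIco (b - a) :=
    fun a ha b hb => hGu a (Finset.mem_union_right _ ha) b (Finset.mem_union_right _ hb)
  obtain ⟨ε, hε⟩ : ∃ ε, ε = δ / 2 := ⟨_, rfl⟩
  let e : 𝕊 → ℝ := fun b => if ∃ a, (a, b) ∈ DoublePts R then 0 else ε
  have he0 : ∀ b, (∃ a, (a, b) ∈ DoublePts R) → e b = 0 := fun b h => if_pos h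
  have he1 : ∀ b, ¬ (∃ a, (a, b) ∈ DoublePts R) → e b = ε := fun b h => if_neg h
  have he : ∀ b, 0 ≤ e b ∧ e b < δ := by
    intro b
    by_cases h : ∃ a, (a, b) ∈ DoublePts R
    · rw [he0 b h]; exact ⟨le_rfl, hδ0⟩
    · rw [he1 b h]; constructor <;> linarith
  have he2 : ∀ b, e b ≤ ε := by
    intro b
    by_cases h : ∃ a, (a, b) ∈ DoublePts R
    · rw [he0 b h]; linarith
    · rw [he1 b h]
  obtain ⟨R'', hex, hp, hn⟩ := perturb R' hG he
  have hps : ∀ {P}, IsStr R' P → IsStr R'' (pert e P) := fun h => pert_str hG he hp hn h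
  -- heights of R and shifted heights
  have hXh : ∀ {t : ℝ}, (t : 𝕊) ∈ R'.pos.image Prod.snd → ((t + e t : ℝ) : 𝕊) ∈ R.pos.image Prod.snd → e t = 0 := by
    intro t h1 h2
    by_cases h : ∃ a, (a, (t : 𝕊)) ∈ DoublePts R
    · exact he0 _ h
    · rw [he1 _ h] at h2
      exact (gap_lt hGu hδ1 (Finset.mem_union_right _ h1) (Finset.mem_union_left _ h2) (by linarith) (by linarith)).elim
  have hord : ∀ {P P' Q Q'}, Pair R R' F P P' → Pair R R' F Q Q' → ¬ Sim P Q → ∀ {φ : ℝ} {n m k l : ℤ},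
      (P n).2 ≤ φ → φ < (P (n + 1)).2 → (Q m).2 ≤ φ → φ < (Q (m + 1)).2 →
      (pert e P' k).2 ≤ φ → φ < (pert e P' (k + 1)).2 → (pert e Q' l).2 ≤ φ → φ < (pert e Q' (l + 1)).2 →
      (P n).1 < (Q m).1 → (P' k).1 < (Q' l).1 := by
    intro P P' Q Q' hP hQ hPQ φ n m k l h1 h2 h3 h4 h5 h6 h7 h8 hlt
    simp only [pert] at h5 h6 h7 h8
    by_cases hc : ∃ t : ℝ, (t : 𝕊) ∈ R'.pos.image Prod.snd ∧ e t ≠ 0 ∧ t ≤ φ ∧ φ < t + ε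
    · obtain ⟨t, ht1, ht2, ht3, ht4⟩ := hc
      have huniq : ∀ s : ℝ, (s : 𝕊) ∈ R'.pos.image Prod.snd → φ - ε < s → s ≤ φ → s = t := by
        intro s hs i1 i2
        rcases lt_trichotomy s t with h | h | h
        · exact (gap_lt hG hδ1 hs ht1 h (by linarith)).elim
        · exact h
        · exact (gap_lt hG hδ1 ht1 hs h (by linarith)).elim
      have hlow : ∀ s : ℝ, (s : 𝕊) ∈ R'.pos.image Prod.snd → s + e s ≤ φ → s ≤ φ - ε := by
        intro s hs i1
        by_contra i2
        rw [not_le] at i2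
        have i3 := huniq s hs i2 (by linarith [(he s).1])
        subst i3
        rw [he1 _ fun h => ht2 (he0 _ h)] at i1
        linarith
      refine L.order hP hQ hPQ (ψ := φ - ε) h1 h2 h3 h4 (hlow _ (hP.hP'.mem_snd _) h5) (by linarith [he2 ((P' (k+1)).2 : ℝ)])
        (hlow _ (hQ.hP'.mem_snd _) h7) (by linarith [he2 ((Q' (l+1)).2 : ℝ)]) ?_ hlt
      intro x s i1 i2 hd
      rw [min_eq_right (by linarith)] at i1
      rw [max_eq_left (by linarith)] at i2
      have hd' := hd
      rw [L.dbl] at hd'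
      have := huniq s (dbl_level hd') i1 i2
      subst this
      exact ht2 (he0 _ ⟨_, hd⟩)
    · have hup : ∀ s : ℝ, (s : 𝕊) ∈ R'.pos.image Prod.snd → φ < s + e s → φ < s := by
        intro s hs i1
        by_contra i2
        rw [not_lt] at i2
        refine hc ⟨s, hs, fun h => ?_, i2, by linarith [he2 (s : 𝕊)]⟩
        rw [h] at i1; linarith
      refine L.order hP hQ hPQ (ψ := φ) h1 h2 h3 h4 (by linarith [(he ((P' k).2 : ℝ)).1]) (hup _ (hP.hP'.mem_snd _) h6)
        (by linarith [(he ((Q' l).2 : ℝ)).1]) (hup _ (hQ.hP'.mem_snd _) h8) ?_ hlt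
      intro x s i1 i2
      rw [min_self] at i1
      rw [max_self] at i2
      linarith
  refine ⟨R'', fun P Q => ∃ P', Pair R R' F P P' ∧ Q = pert e P', hex, ?_, ?_, ?_, ?_, ?_, ?_, ?_, ?_, ?_⟩
  · rintro P Q ⟨P', h, rfl⟩
    exact h.hP
  · rintro P Q ⟨P', h, rfl⟩
    exact hps h.hP'
  · intro P hP
    obtain ⟨P', h⟩ := L.exists_pair hP
    exact ⟨_, P', h, rfl⟩
  · intro Q hQ
    obtain ⟨b0, h1, h2⟩ := (hp _ _).1 (hQ 0).1
    have e1 : (((Q 0).2 - e b0 : ℝ) : 𝕊) = b0 := by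
      rw [AddCircle.coe_sub, h2]; abel
    obtain ⟨P', hP', h0⟩ := exists_str (R := R') (p := ((Q 0).1, (Q 0).2 - e b0)) (by
      unfold pr
      rw [e1]; exact h1)
    have e2 : pert e P' = Q := by
      refine (hps hP').unique hQ ?_
      simp only [pert, h0, e1, sub_add_cancel]
    obtain ⟨P, hP⟩ := L.exists_pair' hP'
    exact ⟨P, P', hP, e2.symm⟩
  · rintro P Q ⟨P', h, rfl⟩ k l
    refine ⟨_, h.tr L k l, ?_⟩
    funext n
    simp only [tr, pert, coe_add_int]
    congr 1
    ring
  · rintro P Q ⟨P', h, rfl⟩ m m'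
    exact ⟨fun n => P' (n + m'), (h.sim_left (Sim.shift _ _) (h.hP.shift _)).sim_right (Sim.shift _ _) (h.hP'.shift _), rfl⟩
  · rintro P Q P1 Q1 ⟨P', h, rfl⟩ ⟨P1', h', rfl⟩
    rw [← pert_sim hG he hδ1 h.hP' h'.hP']
    constructor
    · intro hs
      exact h.uniq_right (h'.sim_left hs.symm h.hP)
    · intro hs
      exact h.uniq_left L (h'.sim_right hs.symm h.hP')
  · rintro P Q P1 Q1 ⟨P', h, rfl⟩ ⟨P1', h', rfl⟩ hs φ n m k l h1 h2 h3 h4 h5 h6 h7 h8 hlt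
    exact hord h h' hs h1 h2 h3 h4 h5 h6 h7 h8 hlt
  · rintro P Q ⟨P', h, rfl⟩ y hy hy'
    obtain ⟨⟨a, b⟩, h1, h2⟩ := Finset.mem_image.1 hy'
    obtain ⟨b0, h3, h4⟩ := (hp _ _).1 h1
    obtain ⟨t, rfl⟩ := exists_lift b0
    simp only at h2
    have h5 : ((t + e t : ℝ) : 𝕊) = y := by rw [AddCircle.coe_add, ← h4, h2]
    have h6 := hXh (Finset.mem_image.2 ⟨_, h3, rfl⟩) (by rw [h5]; exact hy)
    rw [h6, add_zero] at h5
    rw [h5] at h6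
    have hX : ∃ a, (a, (y : 𝕊)) ∈ DoublePts R := by
      by_contra hX
      rw [he1 _ hX] at h6
      linarith
    obtain ⟨a, ha⟩ := hX
    obtain ⟨x, rfl⟩ := exists_lift a
    rw [L.jump h (x := x) ha]
    constructor
    · rintro ⟨n, hn⟩
      refine ⟨n, ?_⟩
      simp only [pert, hn, h6, add_zero]
    · rintro ⟨n, hn⟩
      refine ⟨n, ?_⟩
      simp only [pert] at hn
      have := hXh (h.hP'.mem_snd n) (by rw [hn]; exact hy)
      rw [this] at hn
      linarith

end

section


abbrev Hts (R : RectDiagram) : Finset 𝕊 := R.pos.image Prod.snd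

/-- the strand `P`, indexed so that it is at its `0`-th vertical edge at level `t` -/
structure Half (R : RectDiagram) (P : ℤ → ℝ × ℝ) (t : ℝ) : Prop where
  str : IsStr R P
  le : (P 0).2 ≤ t
  lt : t < (P 1).2
  eq : (t : 𝕊) ∈ Hts R → (P 0).2 = t

def nx (P : ℤ → ℝ × ℝ) (t : ℝ) : ℤ → ℝ × ℝ :=
  open Classical in if (P 1).2 = t then fun n => P (n + 1) else P

lemma nx_pos {P : ℤ → ℝ × ℝ} {t : ℝ} (h : (P 1).2 = t) : nx P t = fun n => P (n + 1) := if_pos h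
lemma nx_neg {P : ℤ → ℝ × ℝ} {t : ℝ} (h : (P 1).2 ≠ t) : nx P t = P := if_neg h

lemma Stair.idx {P : ℤ → ℝ × ℝ} (h : Stair P) {n m : ℤ} {t : ℝ} (h1 : (P n).2 ≤ t) (h2 : t < (P (n + 1)).2)
    (h3 : (P m).2 ≤ t) (h4 : t < (P (m + 1)).2) : n = m := by
  have := h.ylt.1 (h1.trans_lt h4)
  have := h.ylt.1 (h3.trans_lt h2)
  omega

lemma Stair.no_between {P : ℤ → ℝ × ℝ} (h : Stair P) {n : ℤ} (h1 : (P 0).2 < (P n).2) (h2 : (P n).2 < (P 1).2) : False := by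
  have := h.ylt.1 h1
  have := h.ylt.1 h2
  omega

section
variable {R : RectDiagram} {P Q : ℤ → ℝ × ℝ} {t t' : ℝ}

lemma Half.tr (h : Half R P t) (k l : ℤ) : Half R (tr k l P) (t + l) := by
  refine ⟨h.str.tr k l, ?_, ?_, ?_⟩
  · simp only [_root_.tr]; linarith [h.le]
  · simp only [_root_.tr]; linarith [h.lt]
  · intro hm
    rw [coe_add_int] at hm
    simp only [_root_.tr]; rw [h.eq hm]

lemma Half.sim_eq (h : Half R P t) (h' : Half R Q t) (hs : Sim P Q) : Q = P := by
  obtain ⟨m, hm⟩ := hs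
  have : m = 0 := by
    apply h.str.stair.idx (t := t) (n := m) (m := 0)
    · have := h'.le; rwa [hm, zero_add] at this
    · have := h'.lt; rwa [hm, add_comm] at this
    · exact h.le
    · exact h.lt
  subst this
  funext n
  rw [hm, add_zero]

lemma Half.eq_tr (h : Half R P t) (h' : Half R Q (t + (l : ℤ))) (ht : (t : 𝕊) ∈ Hts R) : ∃ k : ℤ, Q = _root_.tr k l P := by
  have e1 := h.eq ht
  have e2 := h'.eq (by rwa [coe_add_int])
  have h1 : (((Q 0).1 : ℝ) : 𝕊) = ((P 0).1 : ℝ) := by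
    have i1 := (h.str 0).1
    have i2 := (h'.str 0).1
    unfold pr at i1 i2
    rw [e1] at i1
    rw [e2, coe_add_int] at i2
    exact R.pos_ph i2 i1
  obtain ⟨k, hk⟩ := coe_eq_iff.1 h1
  refine ⟨k, h'.str.unique (h.str.tr k l) ?_⟩
  simp only [_root_.tr]
  exact Prod.ext hk (by simp only; rw [e2, e1])

lemma Half.nx (h : Half R P t) (h1 : t < t') (h2 : t' ≤ (P 1).2) (h3 : (t' : 𝕊) ∈ Hts R → (P 1).2 = t') :
    Half R (nx P t') t' := by
  by_cases hc : (P 1).2 = t'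
  · rw [nx_pos hc]
    refine ⟨h.str.shift 1, ?_, ?_, fun _ => ?_⟩
    · simp only [zero_add]; exact hc.le
    · rw [← hc]; exact h.str.stair.ylt.2 (by norm_num)
    · simp only [zero_add]; exact hc
  · rw [nx_neg hc]
    exact ⟨h.str, by linarith [h.le], lt_of_le_of_ne h2 (Ne.symm hc), fun hm => absurd (h3 hm) hc⟩

lemma nx_back {k l : ℤ} {s' : ℝ} (h1 : (P 0).2 < t') (h2 : (Q 0).2 < s') (hs : s' = t' + l)
    (h : nx Q s' = tr k l (nx P t')) : Q = tr k l P := by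
  by_cases hp : (P 1).2 = t' <;> by_cases hq : (Q 1).2 = s'
  · rw [nx_pos hp, nx_pos hq] at h
    funext n
    have := congrFun h (n - 1)
    simpa [tr] using this
  · rw [nx_pos hp, nx_neg hq] at h
    have := congrArg Prod.snd (congrFun h 0)
    simp only [tr, zero_add] at this
    linarith
  · rw [nx_neg hp, nx_pos hq] at h
    have := congrArg Prod.snd (congrFun h 0)
    simp only [tr, zero_add] at this
    linarith
  · rw [nx_neg hp, nx_neg hq] at h
    exact h

end

structure NT (R R' : RectDiagram) (Pr : (ℤ → ℝ × ℝ) → (ℤ → ℝ × ℝ) → Prop) (P Q : ℤ → ℝ × ℝ) (t : ℝ) : Prop where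
  pr : Pr P Q
  hP : Half R P t
  hQ : Half R' Q t
  mem : (t : 𝕊) ∈ Hts R ∪ Hts R'

section
variable {R R' : RectDiagram} {Pr : (ℤ → ℝ × ℝ) → (ℤ → ℝ × ℝ) → Prop} {P Q A B : ℤ → ℝ × ℝ} {t : ℝ}

def mn (P Q : ℤ → ℝ × ℝ) : ℝ := min (P 1).2 (Q 1).2

lemma Corr.half_ex (C : Corr R R' Pr) {y : 𝕊} (hy : y ∈ Hts R ∪ Hts R') : ∃ P Q t, NT R R' Pr P Q t ∧ (t : 𝕊) = y := by
  by_cases h : y ∈ Hts R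
  · obtain ⟨⟨a, b⟩, h1, rfl⟩ := Finset.mem_image.1 h
    obtain ⟨x, rfl⟩ := exists_lift a
    obtain ⟨t, rfl⟩ := exists_lift b
    obtain ⟨P, hP, h0⟩ := exists_str (R := R) (p := (x, t)) h1
    obtain ⟨Q, hQ⟩ := C.ex hP
    obtain ⟨m, h2, h3⟩ := (C.str' hQ).stair.yb t
    have hs := C.shift hQ 0 m
    simp only [add_zero] at hs
    have e0 : (P 0).2 = t := by rw [h0]
    refine ⟨P, fun n => Q (n + m), t, ⟨hs, ⟨hP, e0.le, ?_, fun _ => e0⟩, ⟨C.str' hs, ?_, ?_, ?_⟩, hy⟩, rfl⟩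
    · rw [← e0]; exact hP.stair.ylt.2 (by norm_num)
    · simpa using h2
    · rw [add_comm]; exact h3
    · intro h'
      obtain ⟨n, hn⟩ := (C.jump hQ h h').1 ⟨0, e0⟩
      have : n = m := (C.str' hQ).stair.idx hn.le (by rw [← hn]; exact (C.str' hQ).stair.y0 n) h2 h3
      simp only [zero_add, ← this, hn]
  · have h' : y ∈ Hts R' := (Finset.mem_union.1 hy).resolve_left h
    obtain ⟨⟨a, b⟩, h1, rfl⟩ := Finset.mem_image.1 h'
    obtain ⟨x, rfl⟩ := exists_lift a
    obtain ⟨t, rfl⟩ := exists_lift b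
    obtain ⟨Q, hQ', h0⟩ := exists_str (R := R') (p := (x, t)) h1
    obtain ⟨P, hQ⟩ := C.ex' hQ'
    obtain ⟨m, h2, h3⟩ := (C.str hQ).stair.yb t
    have hs := C.shift hQ m 0
    simp only [add_zero] at hs
    have e0 : (Q 0).2 = t := by rw [h0]
    refine ⟨fun n => P (n + m), Q, t, ⟨hs, ⟨C.str hs, ?_, ?_, fun h' => absurd h' h⟩, ⟨hQ', e0.le, ?_, fun _ => e0⟩, hy⟩, rfl⟩
    · simpa using h2
    · rw [add_comm]; exact h3
    · rw [← e0]; exact hQ'.stair.ylt.2 (by norm_num)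

lemma NT.tr (C : Corr R R' Pr) (h : NT R R' Pr P Q t) (k l : ℤ) : NT R R' Pr (tr k l P) (tr k l Q) (t + l) :=
  ⟨C.tr h.pr k l, h.hP.tr k l, h.hQ.tr k l, by rw [coe_add_int]; exact h.mem⟩

lemma NT.uniq (C : Corr R R' Pr) (h : NT R R' Pr P Q t) {s : ℝ} (h' : NT R R' Pr A B s) (hs : (s : 𝕊) = t) :
    ∃ k l : ℤ, A = _root_.tr k l P ∧ B = _root_.tr k l Q ∧ s = t + l := by
  obtain ⟨l, rfl⟩ := coe_eq_iff.1 hs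
  rcases Finset.mem_union.1 h.mem with hm | hm
  · obtain ⟨k, rfl⟩ := h.hP.eq_tr h'.hP hm
    have := (C.uniq (C.tr h.pr k l) h'.pr).1 (Sim.refl _)
    exact ⟨k, l, rfl, (h.hQ.tr k l).sim_eq h'.hQ this, rfl⟩
  · obtain ⟨k, rfl⟩ := h.hQ.eq_tr h'.hQ hm
    have := (C.uniq (C.tr h.pr k l) h'.pr).2 (Sim.refl _)
    exact ⟨k, l, (h.hP.tr k l).sim_eq h'.hP this, rfl, rfl⟩

lemma NT.lt (h : NT R R' Pr P Q t) : t < mn P Q := lt_min h.hP.lt h.hQ.lt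

lemma NT.lt_one (h : NT R R' Pr P Q t) : mn P Q < t + 1 := by
  rcases Finset.mem_union.1 h.mem with hm | hm
  · rw [← h.hP.eq hm]
    exact (min_le_left _ _).trans_lt (h.hP.str 0).2.2.2.2.2.2
  · rw [← h.hQ.eq hm]
    exact (min_le_right _ _).trans_lt (h.hQ.str 0).2.2.2.2.2.2

lemma NT.mem_mn (h : NT R R' Pr P Q t) : ((mn P Q : ℝ) : 𝕊) ∈ Hts R ∪ Hts R' := by
  rcases min_choice (P 1).2 (Q 1).2 with e | e
  · rw [mn, e]; exact Finset.mem_union_left _ (h.hP.str.mem_snd 1)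
  · rw [mn, e]; exact Finset.mem_union_right _ (h.hQ.str.mem_snd 1)

lemma NT.mn_P (C : Corr R R' Pr) (h : NT R R' Pr P Q t) : ((mn P Q : ℝ) : 𝕊) ∈ Hts R ↔ (P 1).2 = mn P Q := by
  constructor
  · intro hm
    by_contra hne
    have hlt : mn P Q < (P 1).2 := lt_of_le_of_ne (min_le_left _ _) (Ne.symm hne)
    have e : (Q 1).2 = mn P Q := by
      rcases min_choice (P 1).2 (Q 1).2 with e | e
      · exact absurd e.symm hne
      · exact e.symm
    obtain ⟨n, hn⟩ := (C.jump h.pr hm (by rw [← e]; exact h.hQ.str.mem_snd 1)).2 ⟨1, e⟩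
    exact h.hP.str.stair.no_between (n := n) (by rw [hn]; exact h.hP.le.trans_lt h.lt) (by rw [hn]; exact hlt)
  · intro e
    rw [← e]; exact h.hP.str.mem_snd 1

lemma NT.mn_Q (C : Corr R R' Pr) (h : NT R R' Pr P Q t) : ((mn P Q : ℝ) : 𝕊) ∈ Hts R' ↔ (Q 1).2 = mn P Q := by
  constructor
  · intro hm
    by_contra hne
    have hlt : mn P Q < (Q 1).2 := lt_of_le_of_ne (min_le_right _ _) (Ne.symm hne)
    have e : (P 1).2 = mn P Q := by
      rcases min_choice (P 1).2 (Q 1).2 with e | e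
      · exact e.symm
      · exact absurd e.symm hne
    obtain ⟨n, hn⟩ := (C.jump h.pr (by rw [← e]; exact h.hP.str.mem_snd 1) hm).1 ⟨1, e⟩
    exact h.hQ.str.stair.no_between (n := n) (by rw [hn]; exact h.hQ.le.trans_lt h.lt) (by rw [hn]; exact hlt)
  · intro e
    rw [← e]; exact h.hQ.str.mem_snd 1

lemma NT.next (C : Corr R R' Pr) (h : NT R R' Pr P Q t) : NT R R' Pr (nx P (mn P Q)) (nx Q (mn P Q)) (mn P Q) := by
  refine ⟨?_, h.hP.nx h.lt (min_le_left _ _) (h.mn_P C).1, h.hQ.nx h.lt (min_le_right _ _) (h.mn_Q C).1, h.mem_mn⟩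
  have h0 : ∀ A : ℤ → ℝ × ℝ, ∃ m : ℤ, nx A (mn P Q) = fun n => A (n + m) := by
    intro A
    by_cases hc : (A 1).2 = mn P Q
    · exact ⟨1, nx_pos hc⟩
    · exact ⟨0, by rw [nx_neg hc]; simp only [add_zero]⟩
  obtain ⟨m, e⟩ := h0 P
  obtain ⟨m', e'⟩ := h0 Q
  rw [e, e']
  exact C.shift h.pr m m'

lemma NT.eq_max (h : NT R R' Pr P Q t) : t = max (P 0).2 (Q 0).2 := by
  rcases Finset.mem_union.1 h.mem with hm | hm
  · have := h.hP.eq hm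
    rw [this, max_eq_left h.hQ.le]
  · have := h.hQ.eq hm
    rw [this, max_eq_right h.hP.le]

/-- two different strands at the level of the second one -/
lemma NT.not_sim (C : Corr R R' Pr) (h : NT R R' Pr P Q t) {s : ℝ} (h' : NT R R' Pr A B s) (h1 : t < s) (h2 : s < mn P Q) :
    ¬ Sim P A := by
  intro hs
  have hs' := (C.uniq h.pr h'.pr).1 hs
  obtain ⟨m, hm⟩ := hs
  obtain ⟨m', hm'⟩ := hs'
  rcases Finset.mem_union.1 h'.mem with h3 | h3
  · have e := h'.hP.eq h3
    rw [hm] at e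
    exact h.hP.str.stair.no_between (by rw [e]; exact h.hP.le.trans_lt h1) (by rw [e]; exact h2.trans_le (min_le_left _ _))
  · have e := h'.hQ.eq h3
    rw [hm'] at e
    exact h.hQ.str.stair.no_between (by rw [e]; exact h.hQ.le.trans_lt h1) (by rw [e]; exact h2.trans_le (min_le_right _ _))

lemma NT.floor (C : Corr R R' Pr) (h : NT R R' Pr P Q t) {s : ℝ} (h' : NT R R' Pr A B s) (h1 : t < s) (h2 : s < mn P Q) :
    ∃ k : ℤ, (k : ℝ) < (P 0).1 - (A 0).1 ∧ (P 0).1 - (A 0).1 < k + 1 ∧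
      (k : ℝ) < (Q 0).1 - (B 0).1 ∧ (Q 0).1 - (B 0).1 < k + 1 := by
  have hp1 : (P 0).2 ≤ s := h.hP.le.trans h1.le
  have hp2 : s < (P (0 + 1)).2 := h2.trans_le (min_le_left _ _)
  have hq1 : (Q 0).2 ≤ s := h.hQ.le.trans h1.le
  have hq2 : s < (Q (0 + 1)).2 := h2.trans_le (min_le_right _ _)
  have hk : ∀ k : ℤ, NT R R' Pr (_root_.tr k 0 A) (_root_.tr k 0 B) s := fun k => by
    have := h'.tr C k 0
    simpa using this
  have hne : ∀ k : ℤ, (P 0).1 ≠ (A 0).1 + k := by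
    intro k
    have i := hk k
    exact h.hP.str.ne_of_level i.hP.str (h.not_sim C i h1 h2) hp1 hp2.le (m := 0) i.hP.le i.hP.lt.le
  have hup : ∀ k : ℤ, (P 0).1 < (A 0).1 + k → (Q 0).1 < (B 0).1 + k := by
    intro k hlt
    have i := hk k
    exact C.order h.pr i.pr (h.not_sim C i h1 h2) (n := 0) (m := 0) (k := 0) (l := 0) hp1 hp2 i.hP.le i.hP.lt
      hq1 hq2 i.hQ.le i.hQ.lt hlt
  have hdn : ∀ k : ℤ, (A 0).1 + k < (P 0).1 → (B 0).1 + k < (Q 0).1 := by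
    intro k hlt
    have i := hk k
    exact C.order i.pr h.pr (fun hs => h.not_sim C i h1 h2 hs.symm) (n := 0) (m := 0) (k := 0) (l := 0) i.hP.le i.hP.lt
      hp1 hp2 i.hQ.le i.hQ.lt hq1 hq2 hlt
  have f1 := Int.floor_le ((P 0).1 - (A 0).1)
  have f2 := Int.lt_floor_add_one ((P 0).1 - (A 0).1)
  have f3 := hne ⌊(P 0).1 - (A 0).1⌋
  have f4 : (⌊(P 0).1 - (A 0).1⌋ : ℝ) < (P 0).1 - (A 0).1 := lt_of_le_of_ne f1 fun e => f3 (by rw [e]; ring)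
  refine ⟨⌊(P 0).1 - (A 0).1⌋, f4, f2, ?_, ?_⟩
  · linarith [hdn _ (show (A 0).1 + (⌊(P 0).1 - (A 0).1⌋ : ℤ) < (P 0).1 by linarith)]
  · have := hup (⌊(P 0).1 - (A 0).1⌋ + 1) (by push_cast; linarith)
    push_cast at this
    linarith

end

end

section


section
variable {R R' : RectDiagram} {Pr : (ℤ → ℝ × ℝ) → (ℤ → ℝ × ℝ) → Prop}

lemma pos_image_of {S : RectDiagram} {X : 𝕊 → ℝ} (h : ∀ y ∈ Hts S, (((X y : ℝ) : 𝕊), y) ∈ S.pos) :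
    S.pos = (Hts S).image fun y => (((X y : ℝ) : 𝕊), y) := by
  ext ⟨a, b⟩
  constructor
  · intro hm
    have hb : b ∈ Hts S := Finset.mem_image.2 ⟨(a, b), hm, rfl⟩
    exact Finset.mem_image.2 ⟨b, hb, Prod.ext (S.pos_ph (h b hb) hm) rfl⟩
  · intro hm
    obtain ⟨y, hy, e⟩ := Finset.mem_image.1 hm
    rw [← e]
    exact h y hy

lemma Half.pos_mem {S : RectDiagram} {P : ℤ → ℝ × ℝ} {t : ℝ} (h : Half S P t) {y : 𝕊} (hy : y ∈ Hts S) (e : (t : 𝕊) = y) :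
    ((((P 0).1 : ℝ) : 𝕊), y) ∈ S.pos := by
  have h0 := (h.str 0).1
  unfold pr at h0
  rw [h.eq (by rw [e]; exact hy), e] at h0
  exact h0

lemma nx_diff {S : RectDiagram} {P A : ℤ → ℝ × ℝ} {t : ℝ} {k l : ℤ} (hP : IsStr S P) (e : A = _root_.tr k l (nx P t)) {p : Prop}
    (hp : p ↔ (P 1).2 = t) :
    (p ∧ (k : ℝ) < (A 0).1 - (P 0).1 ∧ (A 0).1 - (P 0).1 < k + 1) ∨ (¬ p ∧ (A 0).1 - (P 0).1 = k) := by
  by_cases hc : (P 1).2 = t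
  · left
    rw [nx_pos hc] at e
    have h1 := (hP 0).2.2.2.1
    have h2 := (hP 0).2.2.2.2.1
    simp only [zero_add] at h1 h2
    refine ⟨hp.2 hc, ?_, ?_⟩ <;> rw [e] <;> simp only [_root_.tr, zero_add] <;> linarith
  · right
    rw [nx_neg hc] at e
    refine ⟨fun h => hc (hp.1 h), ?_⟩
    rw [e]; simp only [_root_.tr]; ring

lemma Corr.merged (C : Corr R R' Pr) : ∃ top X X', Merged R R' (Hts R) (Hts R') top X X' := by
  have hex : ∀ y : 𝕊, ∃ P Q t, y ∈ Hts R ∪ Hts R' → NT R R' Pr P Q t ∧ (t : 𝕊) = y := by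
    intro y
    by_cases hy : y ∈ Hts R ∪ Hts R'
    · obtain ⟨P, Q, t, h⟩ := C.half_ex hy
      exact ⟨P, Q, t, fun _ => h⟩
    · exact ⟨fun _ => 0, fun _ => 0, 0, fun h => absurd h hy⟩
  choose Pf Qf tf hf using hex
  have hkey : ∀ y ∈ Hts R ∪ Hts R', ∃ k l : ℤ,
      Pf ((mn (Pf y) (Qf y) : ℝ) : 𝕊) = _root_.tr k l (nx (Pf y) (mn (Pf y) (Qf y))) ∧
      Qf ((mn (Pf y) (Qf y) : ℝ) : 𝕊) = _root_.tr k l (nx (Qf y) (mn (Pf y) (Qf y))) ∧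
      tf ((mn (Pf y) (Qf y) : ℝ) : 𝕊) = mn (Pf y) (Qf y) + l := by
    intro y hy
    have h1 := (hf y hy).1
    have h2 := hf _ h1.mem_mn
    exact (h1.next C).uniq C h2.1 h2.2
  refine ⟨fun y => ((mn (Pf y) (Qf y) : ℝ) : 𝕊), fun y => (Pf y 0).1, fun y => (Qf y 0).1, ?_⟩
  refine ⟨?_, fun y hy => (hf y hy).1.mem_mn, ?_, ?_, ?_, ?_, ?_, ?_, ?_, ?_, ?_, ?_⟩
  · obtain ⟨_, _, h, _⟩ := exists_Dg R
    exact h.ne.mono Finset.subset_union_left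
  · intro y hy z hz e
    have h1 := (hf y hy).1
    have h2 := (hf z hz).1
    obtain ⟨k, l, e1, e2, e3⟩ := (h1.next C).uniq C (h2.next C) e.symm
    have i1 := nx_back (h1.hP.le.trans_lt h1.lt) (h2.hP.le.trans_lt h2.lt) e3 e1
    have i2 := nx_back (h1.hQ.le.trans_lt h1.lt) (h2.hQ.le.trans_lt h2.lt) e3 e2
    have i3 : tf z = tf y + l := by
      rw [h1.eq_max, h2.eq_max, i1, i2]
      simp only [_root_.tr]
      rw [max_add_add_right]
    rw [← (hf y hy).2, ← (hf z hz).2, i3, coe_add_int]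
  · intro y hy e
    have h1 := (hf y hy).1
    have e' : ((mn (Pf y) (Qf y) : ℝ) : 𝕊) = (tf y : ℝ) := by rw [(hf y hy).2]; exact e
    have := coe_eq_of_lt e' h1.lt_one (by linarith [h1.lt])
    exact absurd this (ne_of_gt h1.lt)
  · intro y hy z hz hne hlt
    have h1 := (hf y hy).1
    have h2 := (hf z hz).1
    have e1 : toIco (((mn (Pf y) (Qf y) : ℝ) : 𝕊) - y) = mn (Pf y) (Qf y) - tf y := by
      conv_lhs => rw [← (hf y hy).2]
      rw [(hf y hy).2]
      have := toIco_coe_sub h1.lt.le h1.lt_one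
      rwa [(hf y hy).2] at this
    rw [e1] at hlt
    have hpos : 0 < toIco (z - y) := toIco_pos (Ne.symm hne)
    have e2 : ((tf y + toIco (z - y) : ℝ) : 𝕊) = (tf z : ℝ) := by
      rw [AddCircle.coe_add, coe_toIco, (hf y hy).2, (hf z hz).2]; abel
    obtain ⟨j, hj⟩ := coe_eq_iff.1 e2
    have h3 := h2.tr C 0 j
    rw [← hj] at h3
    obtain ⟨k, hk⟩ := h1.floor C h3 (by linarith) (by linarith)
    simp only [_root_.tr, Int.cast_zero, add_zero] at hk
    exact ⟨k, hk⟩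
  · intro y hy
    have h1 := (hf y hy).1
    obtain ⟨k, l, e1, e2, e3⟩ := hkey y hy
    exact ⟨k, nx_diff h1.hP.str e1 (h1.mn_P C), nx_diff h1.hQ.str e2 (h1.mn_Q C)⟩
  · refine ⟨fun y => (Pf y 1).2 - tf y, ?_⟩
    intro y hy hn
    have h1 := (hf y hy).1
    obtain ⟨k, l, e1, e2, e3⟩ := hkey y hy
    rw [nx_neg fun h => hn ((h1.mn_P C).2 h)] at e1
    simp only
    rw [e3, e1]
    simp only [_root_.tr]
    linarith [h1.lt]
  · refine ⟨fun y => (Qf y 1).2 - tf y, ?_⟩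
    intro y hy hn
    have h1 := (hf y hy).1
    obtain ⟨k, l, e1, e2, e3⟩ := hkey y hy
    rw [nx_neg fun h => hn ((h1.mn_Q C).2 h)] at e2
    simp only
    rw [e3, e2]
    simp only [_root_.tr]
    linarith [h1.lt]
  · apply pos_image_of
    intro y hy
    have h1 := hf y (Finset.mem_union_left _ hy)
    exact h1.1.hP.pos_mem hy h1.2
  · apply pos_image_of
    intro y hy
    have h1 := hf y (Finset.mem_union_right _ hy)
    exact h1.1.hQ.pos_mem hy h1.2
  · intro y hy ht
    have h1 := (hf y hy).1
    have e := (h1.mn_P C).1 ht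
    have := (h1.hP.str 0).2.2.1
    simp only [zero_add, pr] at this
    rw [e] at this
    exact this
  · intro y hy ht
    have h1 := (hf y hy).1
    have e := (h1.mn_Q C).1 ht
    have := (h1.hQ.str 0).2.2.1
    simp only [zero_add, pr] at this
    rw [e] at this
    exact this

end

theorem main_thm (R R' : RectDiagram) (hX : DoublePts R = DoublePts R')
    (h : ∃ U : Set Torus, IsOpen U ∧ DoublePts R ⊆ U ∧ IsotopicRelFixed (Gamma R) (Gamma R') U) :
    EquivOfType .rII R R' := by
  obtain ⟨U, hU, hXU, hI⟩ := h
  obtain ⟨F, L⟩ := exists_LM hX hU hXU hI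
  obtain ⟨R'', Pr, hex, C⟩ := L.exists_corr
  obtain ⟨top, X, X', m⟩ := C.merged
  exact Relation.ReflTransGen.trans m.equiv (Exch.symm hex).equiv

end

/-- if `Γ_→II(R)` and `Γ_→II(R')` have the same set `X` of double
points and there is an isotopy of `T²` fixed on an open neighborhood of `X` taking
`Γ_→II(R)` to `Γ_→II(R')`, then `[R]_→II = [R']_→II`. -/
theorem stmt11 (R R' : RectDiagram)
    (hX : DoublePts R = DoublePts R')
    (h : ∃ U : Set Torus, IsOpen U ∧ DoublePts R ⊆ U ∧
      IsotopicRelFixed (Gamma R) (Gamma R') U) :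
    EquivOfType .rII R R' := by
  exact main_thm R R' hX h

end
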